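/- arXiv:1810.05280 — 3 statements merged into one kernel-verified Lean document; each statement's English description precedes it below -/
import Mathlib

section
/- Let k be a positive integer and let G be a finite simple graph that satisfies the NC property and is the union of k pairwise edge-disjoint copies of the complete graph K_k. Then χ_DP(G) = k. -/
open SimpleGraph

variable {V : Type*}

/-- A *hole* of `G`: an induced cycle of length at least 4, given as a closed walk. -/
def IsHole (G : SimpleGraph V) {a : V} (w : G.Walk a a) : Prop :=
  w.IsCycle ∧ 4 ≤ w.length ∧
    ∀ x y : V, x ∈ w.support → y ∈ w.support → G.Adj x y → s(x, y) ∈ w.edges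

/-- A graph is *chordal* if it has no hole. -/
def IsChordal (G : SimpleGraph V) : Prop :=
  ∀ (a : V) (w : G.Walk a a), ¬ IsHole G w

/-- Two edge lists share two consecutive edges. -/
def ShareTwoConsecutiveEdges (l₁ l₂ : List (Sym2 V)) : Prop :=
  ∃ x y z : V, x ≠ z ∧ s(x, y) ∈ l₁ ∧ s(y, z) ∈ l₁ ∧ s(x, y) ∈ l₂ ∧ s(y, z) ∈ l₂

/-- A vertex `u` satisfies the *NC property* in `G`: no hole through `u` and
no hole avoiding `u` share two consecutive edges. -/
def VertexNC (G : SimpleGraph V) (u : V) : Prop :=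
  ∀ (a b : V) (w₁ : G.Walk a a) (w₂ : G.Walk b b),
    IsHole G w₁ → IsHole G w₂ → u ∈ w₁.support → u ∉ w₂.support →
      ¬ ShareTwoConsecutiveEdges w₁.edges w₂.edges

/-- A *hole cover* of `G`: a nonempty vertex set meeting every hole of `G`. -/
def IsHoleCover (G : SimpleGraph V) (C : Set V) : Prop :=
  C.Nonempty ∧ ∀ (a : V) (w : G.Walk a a), IsHole G w → ∃ u ∈ C, u ∈ w.support

/-- A vertex set `C` satisfies the *NC property* in `G`: every vertex of `C`
satisfies the NC property and every hole of `G` contains at most one vertex of `C`. -/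
def SetNC (G : SimpleGraph V) (C : Set V) : Prop :=
  (∀ u ∈ C, VertexNC G u) ∧
    ∀ (a : V) (w : G.Walk a a), IsHole G w →
      ∀ u ∈ C, ∀ v ∈ C, u ∈ w.support → v ∈ w.support → u = v

/-- A graph satisfies the *NC property* if it has a hole cover satisfying the NC property. -/
def HasNCProperty (G : SimpleGraph V) : Prop :=
  ∃ C : Set V, IsHoleCover G C ∧ SetNC G C

/-- A DP-cover of `G` with lists of size `k`, realized on the vertex set `V × Fin k`:
the fibers `{v} × Fin k` are cliques, cross edges exist only over edges of `G`,
and the edges between two fibers form a matching. -/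
def IsDPCover (G : SimpleGraph V) (k : ℕ) (H : SimpleGraph (V × Fin k)) : Prop :=
  (∀ (v : V) (i j : Fin k), i ≠ j → H.Adj (v, i) (v, j)) ∧
  (∀ (u v : V) (i j : Fin k), u ≠ v → H.Adj (u, i) (v, j) → G.Adj u v) ∧
  (∀ (u v : V) (i j j' : Fin k), u ≠ v → H.Adj (u, i) (v, j) → H.Adj (u, i) (v, j') → j = j')

/-- `G` is DP-`k`-colorable: every DP-cover with lists of size `k` admits an
independent transversal. -/
def DPColorable (G : SimpleGraph V) (k : ℕ) : Prop :=
  ∀ H : SimpleGraph (V × Fin k), IsDPCover G k H →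
    ∃ f : V → Fin k, ∀ u v : V, ¬ H.Adj (u, f u) (v, f v)

/-- The DP-chromatic number: the least `k` such that `G` is DP-`k`-colorable. -/
noncomputable def dpChromaticNumber (G : SimpleGraph V) : ℕ :=
  sInf {k | DPColorable G k}

/-- `M` is a minor of `G`, via the branch-set characterization. -/
def HasMinor {W : Type*} (G : SimpleGraph V) (M : SimpleGraph W) : Prop :=
  ∃ B : W → Set V,
    (∀ i, (B i).Nonempty) ∧
    (∀ i, (G.induce (B i)).Connected) ∧
    (Pairwise fun i j => Disjoint (B i) (B j)) ∧
    ∀ i j, M.Adj i j → ∃ a ∈ B i, ∃ b ∈ B j, G.Adj a b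

/-- Locally chordalize by `u` all holes of `G` containing `u`: add all edges
joining `u` to the vertices of such holes (new edges go to the vertices
nonadjacent to `u`). -/
def localChordalize (G : SimpleGraph V) (u : V) : SimpleGraph V :=
  G ⊔ SimpleGraph.fromRel fun x y =>
    x = u ∧ ∃ (a : V) (w : G.Walk a a), IsHole G w ∧ u ∈ w.support ∧ y ∈ w.support

/-- Recursive local chordalizations along a list of vertices. -/
def chordalizeList (G : SimpleGraph V) : List V → SimpleGraph V
  | [] => G
  | u :: l => chordalizeList (localChordalize G u) l

/-- Delete a vertex set (keeping the ambient vertex type: the removed vertices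
become isolated). -/
def removeVerts (G : SimpleGraph V) (A : Set V) : SimpleGraph V where
  Adj x y := G.Adj x y ∧ x ∉ A ∧ y ∉ A
  symm := ⟨by intro x y h; exact ⟨h.1.symm, h.2.2, h.2.1⟩⟩
  loopless := ⟨by intro x h; exact G.loopless.irrefl x h.1⟩

/-- The chordalization chain corresponding to an ordered partition
`parts 0, …, parts (k-1)` (playing the role of `C₁, …, C_k`) of a hole cover:
`(lcChain G parts i).1 = Gᵢ` and `(lcChain G parts i).2 = Gᵢ*`. -/
def lcChain (G : SimpleGraph V) {k : ℕ} (parts : Fin k → List V) :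
    ℕ → SimpleGraph V × SimpleGraph V
  | 0 =>
      (removeVerts G {v | ∃ i, v ∈ parts i}, removeVerts G {v | ∃ i, v ∈ parts i})
  | i + 1 =>
      let Gi := (lcChain G parts i).2 ⊔
        removeVerts G {v | ∃ j : Fin k, i + 1 ≤ (j : ℕ) ∧ v ∈ parts j}
      (Gi, if h : i < k then chordalizeList Gi (parts ⟨i, h⟩) else Gi)

/-- `(parts 0, …, parts (k-1))` is a *local chordalization partition* of the hole
cover `C` of `G`. -/
def IsLCPartition (G : SimpleGraph V) (C : Set V) {k : ℕ} (parts : Fin k → List V) : Prop :=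
  (∀ i, (parts i).Nodup) ∧
  (∀ i, parts i ≠ []) ∧
  (Pairwise fun i j : Fin k => ∀ v, v ∈ parts i → v ∉ parts j) ∧
  {v | ∃ i, v ∈ parts i} = C ∧
  ∀ i : Fin k,
    IsHoleCover (lcChain G parts ((i : ℕ) + 1)).1 {v | v ∈ parts i} ∧
    SetNC (lcChain G parts ((i : ℕ) + 1)).1 {v | v ∈ parts i} ∧
    IsChordal (lcChain G parts ((i : ℕ) + 1)).2

/-- The *non-chordality index* of `G`. -/
noncomputable def ncIndex (G : SimpleGraph V) : ℕ := by
  classical exact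
    if IsChordal G then 0
    else sInf {k | ∃ (C : Set V) (parts : Fin k → List V),
      IsHoleCover G C ∧ IsLCPartition G C parts}

/-- `G` is `k`-list-colorable. -/
def ListColorable (G : SimpleGraph V) (k : ℕ) : Prop :=
  ∀ L : V → Finset ℕ, (∀ v, k ≤ (L v).card) →
    ∃ f : V → ℕ, (∀ v, f v ∈ L v) ∧ ∀ u v : V, G.Adj u v → f u ≠ f v

/-- The list chromatic number of `G`. -/
noncomputable def listChromaticNumber (G : SimpleGraph V) : ℕ :=
  sInf {k | ListColorable G k}

/-- `G` is the union of `k` pairwise edge-disjoint copies of `K_k`, given by the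
cliques `𝒦 0, …, 𝒦 (k-1)`. -/
def IsEdgeDisjointUnionOfKk {V : Type*} (G : SimpleGraph V) (k : ℕ)
    (𝒦 : Fin k → Finset V) : Prop :=
  (∀ i, G.IsNClique k (𝒦 i)) ∧
  (∀ i j : Fin k, i ≠ j → ∀ x y : V, x ∈ 𝒦 i → y ∈ 𝒦 i → x ∈ 𝒦 j → y ∈ 𝒦 j → x = y) ∧
  (∀ v : V, ∃ i, v ∈ 𝒦 i) ∧
  (∀ x y : V, G.Adj x y → ∃ i, x ∈ 𝒦 i ∧ y ∈ 𝒦 i)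


namespace NCP

/-- Induced (chordless) path, recursively. -/
def Ind (G : SimpleGraph V) : ∀ {a b : V}, G.Walk a b → Prop
  | _, _, .nil => True
  | _, _, .cons (u := x) (v := y) _ p =>
      x ∉ p.support ∧ (∀ z ∈ p.support, G.Adj x z → z = y) ∧ Ind G p

/-- The vertex set of a hole. -/
def HS (G : SimpleGraph V) (S : Set V) : Prop :=
  ∃ (a : V) (w : G.Walk a a), IsHole G w ∧ S = {x | x ∈ w.support}

/-- The set `S` splits at `v` as an induced path closed up by `v`. -/
def HSat (G : SimpleGraph V) (S : Set V) (v : V) : Prop :=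
  ∃ (a b : V) (p : G.Walk a b), Ind G p ∧ v ∉ p.support ∧ G.Adj v a ∧ G.Adj v b ∧ a ≠ b ∧
    ¬ G.Adj a b ∧ (∀ z ∈ p.support, G.Adj v z → z = a ∨ z = b) ∧
    S = {x | x = v ∨ x ∈ p.support}

/-- Any two vertices are joined by a walk inside the set. -/
def Conn (G : SimpleGraph V) (B : Set V) : Prop :=
  ∀ x ∈ B, ∀ y ∈ B, ∃ w : G.Walk x y, ∀ z ∈ w.support, z ∈ B

variable {G : SimpleGraph V}

lemma Ind.isPath {a b : V} {p : G.Walk a b} (h : Ind G p) : p.IsPath := by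
  induction p with
  | nil => simp
  | cons hh p ih =>
    obtain ⟨h1, h2, h3⟩ := h
    exact (Walk.cons_isPath_iff hh p).2 ⟨ih h3, h1⟩

lemma Ind.edges {a b : V} {p : G.Walk a b} (h : Ind G p) :
    ∀ x ∈ p.support, ∀ y ∈ p.support, G.Adj x y → s(x, y) ∈ p.edges := by
  induction p with
  | nil =>
    intro x hx y hy hxy
    simp at hx hy; subst hx; subst hy; exact absurd hxy (G.irrefl)
  | cons hh p ih =>
    obtain ⟨h1, h2, h3⟩ := h
    intro x hx y hy hxy
    rw [Walk.support_cons, List.mem_cons] at hx hy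
    rw [Walk.edges_cons, List.mem_cons]
    rcases hx with rfl | hx
    · rcases hy with rfl | hy
      · exact absurd hxy (G.irrefl)
      · left; rw [h2 y hy hxy]
    · rcases hy with rfl | hy
      · left; rw [h2 x hx hxy.symm, Sym2.eq_swap]
      · right; exact ih h3 x hx y hy hxy

lemma ind_of {a b : V} {p : G.Walk a b} (hp : p.IsPath)
    (he : ∀ x ∈ p.support, ∀ y ∈ p.support, G.Adj x y → s(x, y) ∈ p.edges) : Ind G p := by
  induction p with
  | nil => trivial
  | @cons x y z hh p ih =>
    rw [Walk.cons_isPath_iff] at hp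
    refine ⟨hp.2, ?_, ?_⟩
    · intro t ht hxt
      have := he x (by simp) t (by simp [ht]) hxt
      rw [Walk.edges_cons, List.mem_cons] at this
      rcases this with h | h
      · rw [Sym2.eq_iff] at h
        rcases h with ⟨_, h⟩ | ⟨h, h'⟩
        · exact h
        · exact absurd h' (fun e => hxt.ne e.symm)
      · exact absurd (Walk.fst_mem_support_of_mem_edges p h) hp.2
    · apply ih hp.1
      intro s hs t ht hst
      have := he s (by simp [hs]) t (by simp [ht]) hst
      rw [Walk.edges_cons, List.mem_cons] at this
      rcases this with h | h
      · exfalso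
        rw [Sym2.eq_iff] at h
        rcases h with ⟨h, _⟩ | ⟨_, h⟩
        · exact hp.2 (h ▸ hs)
        · exact hp.2 (h ▸ ht)
      · exact h

/-- Extend an induced path by a vertex, shortcutting. -/
lemma ind_extend {a b : V} (p : G.Walk a b) (hp : Ind G p) (x : V)
    (hx : x ∈ p.support ∨ ∃ y ∈ p.support, G.Adj x y) :
    ∃ q : G.Walk x b, Ind G q ∧ ∀ z ∈ q.support, z = x ∨ z ∈ p.support := by
  induction p with
  | nil =>
    rename_i c
    by_cases hxc : x = c
    · subst hxc
      exact ⟨.nil, trivial, by simp⟩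
    · have hadj : G.Adj x c := by
        rcases hx with h | ⟨y, hy, h⟩
        · simp at h; exact absurd h hxc
        · simp at hy; exact hy ▸ h
      refine ⟨.cons hadj .nil, ⟨by simpa using hxc, by simp, trivial⟩, by simp⟩
  | @cons c d e hh p ih =>
    by_cases hx' : x ∈ p.support ∨ ∃ y ∈ p.support, G.Adj x y
    · obtain ⟨q, h1, h2⟩ := ih hp.2.2 hx'
      refine ⟨q, h1, fun z hz => ?_⟩
      rcases h2 z hz with h | h
      · exact .inl h
      · right; simp [h]
    · push Not at hx'
      by_cases hxc : x = c
      · subst hxc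
        exact ⟨.cons hh p, hp, fun z hz => .inr hz⟩
      · have hadj : G.Adj x c := by
          rcases hx with h | ⟨y, hy, h⟩
          · simp [hxc, hx'.1] at h
          · simp only [Walk.support_cons, List.mem_cons] at hy
            rcases hy with rfl | hy
            · exact h
            · exact absurd h (hx'.2 y hy)
        refine ⟨.cons hadj (.cons hh p), ⟨by simp [hxc, hx'.1], ?_, hp⟩, by simp⟩
        intro z hz hxz
        simp only [Walk.support_cons, List.mem_cons] at hz
        rcases hz with h | hz
        · exact h
        · exact absurd hxz (hx'.2 z hz)

lemma exists_ind {a b : V} (w : G.Walk a b) :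
    ∃ q : G.Walk a b, Ind G q ∧ ∀ z ∈ q.support, z ∈ w.support := by
  induction w with
  | nil => exact ⟨.nil, trivial, by simp⟩
  | @cons c d e hh p ih =>
    obtain ⟨q, h1, h2⟩ := ih
    obtain ⟨r, h3, h4⟩ := ind_extend q h1 c (.inr ⟨d, by simp, hh⟩)
    refine ⟨r, h3, fun z hz => ?_⟩
    rcases h4 z hz with h | h
    · simp [h]
    · simp [h2 z h]

lemma HSat.HS {S : Set V} {v : V} (h : HSat G S v) : HS G S := by
  classical
  obtain ⟨a, b, p, hp, hv, hva, hvb, hab, hnab, hN, rfl⟩ := h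
  refine ⟨v, .cons hva (p.concat hvb.symm), ⟨?_, ?_, ?_⟩, ?_⟩
  · rw [Walk.cons_isCycle_iff]
    refine ⟨(Walk.concat_isPath_iff _).2 ⟨hp.isPath, hv⟩, ?_⟩
    rw [Walk.edges_concat, List.concat_eq_append, List.mem_append]
    rintro (h | h)
    · exact hv (Walk.fst_mem_support_of_mem_edges p h)
    · simp only [List.mem_singleton, Sym2.eq_iff] at h
      rcases h with ⟨h, _⟩ | ⟨_, h⟩
      · exact hvb.ne h
      · exact hab h
  · have : 2 ≤ p.length := by
      cases p with
      | nil => exact absurd rfl hab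
      | cons h q =>
        cases q with
        | nil => exact absurd h hnab
        | cons h' q' => simp
    simp; omega
  · have key : ∀ z ∈ p.support, G.Adj v z → s(v, z) ∈ (Walk.cons hva (p.concat hvb.symm)).edges := by
      intro z hz hvz
      rcases hN z hz hvz with rfl | rfl
      · simp
      · simp [Walk.edges_concat, Sym2.eq_swap]
    have hs : ∀ x, x ∈ (Walk.cons hva (p.concat hvb.symm)).support → x = v ∨ x ∈ p.support := by
      intro x hx
      simp [Walk.support_concat] at hx
      tauto
    intro x y hx0 hy0 hxy
    rcases hs x hx0 with hxv | hx
    · subst hxv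
      rcases hs y hy0 with hyv | hy
      · subst hyv
        exact absurd hxy G.irrefl
      · exact key y hy hxy
    · rcases hs y hy0 with hyv | hy
      · rw [hyv, Sym2.eq_swap]; exact key x hx (hyv ▸ hxy.symm)
      · have := hp.edges x hx y hy hxy
        simp [Walk.edges_concat, this]
  · ext x
    simp [Walk.support_concat]; tauto

lemma HS.at {S : Set V} {v : V} (h : HS G S) (hv : v ∈ S) : HSat G S v := by
  classical
  obtain ⟨a₀, w₀, ⟨hc₀, hl₀, he₀⟩, rfl⟩ := h
  have hv' : v ∈ w₀.support := hv
  obtain ⟨w, hc, hl, he, hS⟩ : ∃ w : G.Walk v v, w.IsCycle ∧ 4 ≤ w.length ∧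
      (∀ x y : V, x ∈ w.support → y ∈ w.support → G.Adj x y → s(x, y) ∈ w.edges) ∧
      {x | x ∈ w₀.support} = {x | x ∈ w.support} := by
    have hsup : ∀ x, x ∈ (w₀.rotate v hv').support ↔ x ∈ w₀.support := by
      intro x; exact Walk.mem_support_rotate_iff w₀ v hv'
    have hed := w₀.rotate_edges v hv'
    refine ⟨w₀.rotate v hv', hc₀.rotate hv', ?_, ?_, ?_⟩
    · have := hed.perm.length_eq
      rw [Walk.length_edges, Walk.length_edges] at this
      rw [this]; exact hl₀
    · intro x y hx hy hxy
      exact hed.perm.mem_iff.2 (he₀ x y ((hsup x).1 hx) ((hsup y).1 hy) hxy)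
    · ext x; exact (hsup x).symm
  rw [hS]
  clear hS hv hv' he₀ hl₀ hc₀
  cases w with
  | nil => simp at hl
  | @cons _ a _ hva p =>
    rw [Walk.cons_isCycle_iff] at hc
    cases hpr : p.reverse with
    | nil => exact absurd hva G.irrefl
    | @cons _ b _ hvb q =>
      have hpq : p = q.reverse.concat hvb.symm := by
        have := congrArg Walk.reverse hpr
        simpa [Walk.concat_eq_append] using this
      subst hpq
      rw [Walk.concat_isPath_iff] at hc
      set r := q.reverse with hr
      obtain ⟨⟨hrp, hvr⟩, hnin⟩ := hc
      have hsup : ∀ x, x ∈ (Walk.cons hva (r.concat hvb.symm)).support ↔ x = v ∨ x ∈ r.support := by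
        intro x
        simp [Walk.support_concat]; tauto
      have hedg : ∀ e, e ∈ (Walk.cons hva (r.concat hvb.symm)).edges →
          e = s(v, a) ∨ e ∈ r.edges ∨ e = s(b, v) := by
        intro e he; simp [Walk.edges_concat] at he; tauto
      have hN : ∀ z ∈ r.support, G.Adj v z → z = a ∨ z = b := by
        intro z hz hvz
        have := he v z (by simp) ((hsup z).2 (.inr hz)) hvz
        rcases hedg _ this with h | h | h
        · rw [Sym2.eq_iff] at h
          rcases h with ⟨_, h⟩ | ⟨_, h⟩
          · exact .inl h
          · exact absurd h.symm hvz.ne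
        · exact absurd (Walk.fst_mem_support_of_mem_edges r h) hvr
        · rw [Sym2.eq_iff] at h
          rcases h with ⟨h, _⟩ | ⟨_, h⟩
          · exact absurd h hvb.ne
          · exact .inr h
      have hedr : ∀ x ∈ r.support, ∀ y ∈ r.support, G.Adj x y → s(x, y) ∈ r.edges := by
        intro x hx y hy hxy
        have hxv : x ≠ v := fun e => hvr (e ▸ hx)
        have hyv : y ≠ v := fun e => hvr (e ▸ hy)
        rcases hedg _ (he x y ((hsup x).2 (.inr hx)) ((hsup y).2 (.inr hy)) hxy) with h | h | h
        · rw [Sym2.eq_iff] at h; tauto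
        · exact h
        · rw [Sym2.eq_iff] at h; tauto
      have hlen : 2 ≤ r.length := by simp at hl; omega
      have hab : a ≠ b := by
        intro e
        apply hnin
        simp [Walk.edges_concat, e, Sym2.eq_swap]
      have hind := ind_of hrp hedr
      refine ⟨a, b, r, hind, hvr, hva, hvb, hab, ?_, hN, ?_⟩
      · intro hadj
        clear_value r
        cases r with
        | nil => exact hab rfl
        | cons hh r' =>
          have hb := hind.2.1 b (by simp) hadj
          subst hb
          have := hind.2.2.isPath
          rw [Walk.isPath_iff_eq_nil] at this
          subst this
          simp at hlen
      · ext x; exact hsup x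

/-- Reachability inside a set. -/
def Rch (G : SimpleGraph V) (B : Set V) (x y : V) : Prop :=
  ∃ w : G.Walk x y, ∀ z ∈ w.support, z ∈ B

lemma Rch.left {B : Set V} {x y : V} (h : Rch G B x y) : x ∈ B := by
  obtain ⟨w, hw⟩ := h; exact hw x (by simp)

lemma Rch.right {B : Set V} {x y : V} (h : Rch G B x y) : y ∈ B := by
  obtain ⟨w, hw⟩ := h; exact hw y (by simp)

lemma Rch.refl {B : Set V} {x : V} (h : x ∈ B) : Rch G B x x := ⟨.nil, by simpa using h⟩

lemma Rch.symm {B : Set V} {x y : V} (h : Rch G B x y) : Rch G B y x := by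
  obtain ⟨w, hw⟩ := h; exact ⟨w.reverse, by simpa using hw⟩

lemma Rch.trans {B : Set V} {x y z : V} (h : Rch G B x y) (h' : Rch G B y z) : Rch G B x z := by
  obtain ⟨w, hw⟩ := h
  obtain ⟨w', hw'⟩ := h'
  refine ⟨w.append w', fun t ht => ?_⟩
  rw [Walk.mem_support_append_iff] at ht
  exact ht.elim (hw t) (hw' t)

lemma Rch.mono {B B' : Set V} {x y : V} (h : Rch G B x y) (hs : B ⊆ B') : Rch G B' x y := by
  obtain ⟨w, hw⟩ := h; exact ⟨w, fun z hz => hs (hw z hz)⟩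

lemma Rch.adj {B : Set V} {x y : V} (hx : x ∈ B) (hy : y ∈ B) (h : G.Adj x y) : Rch G B x y :=
  ⟨.cons h .nil, by simp [hx, hy]⟩

lemma Rch.bdry {B : Set V} {x y : V} (h : Rch G B x y) (P : Set V) (hx : x ∈ P) (hy : y ∉ P) :
    ∃ a b, a ∈ B ∧ b ∈ B ∧ G.Adj a b ∧ a ∈ P ∧ b ∉ P := by
  obtain ⟨w, hw⟩ := h
  obtain ⟨d, hd, h1, h2⟩ := w.exists_boundary_dart P hx hy
  exact ⟨d.fst, d.snd, hw _ (Walk.dart_fst_mem_support_of_mem_darts w hd),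
    hw _ (Walk.dart_snd_mem_support_of_mem_darts w hd), d.adj, h1, h2⟩

lemma Rch.of_self {B : Set V} {x y : V} (h : Rch G B x y) : Rch G {z | Rch G B x z} x y := by
  obtain ⟨w, hw⟩ := h
  classical
  refine ⟨w, fun z hz => ⟨w.takeUntil z hz, fun t ht => hw t (w.support_takeUntil_subset_support hz ht)⟩⟩

lemma conn_comp (B : Set V) (x : V) : Conn G {z | Rch G B x z} := by
  intro y hy z hz
  exact (Rch.of_self hy).symm.trans (Rch.of_self hz)

lemma rch_support {a b : V} (p : G.Walk a b) {x : V} (hx : x ∈ p.support) :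
    Rch G {z | z ∈ p.support} a x := by
  classical
  exact ⟨p.takeUntil x hx, fun t ht => p.support_takeUntil_subset_support hx ht⟩

lemma conn_support {a b : V} (p : G.Walk a b) : Conn G {z | z ∈ p.support} := by
  intro x hx y hy
  exact (rch_support p hx).symm.trans (rch_support p hy)

lemma conn_singleton (z : V) : Conn G {z} := by
  intro x hx y hy
  simp only [Set.mem_singleton_iff] at hx hy
  subst hx; subst hy; exact Rch.refl rfl

lemma F4 {U : Set V} {v x y : V} (hv : v ∉ U) (hxy : x ≠ y) (hn : ¬ G.Adj x y)
    (hvx : G.Adj v x) (hvy : G.Adj v y) (hN : ∀ z ∈ U, G.Adj v z → z = x ∨ z = y)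
    (hr : Rch G U x y) :
    ∃ S, HS G S ∧ v ∈ S ∧ x ∈ S ∧ y ∈ S ∧ ∀ z ∈ S, z = v ∨ z ∈ U := by
  obtain ⟨w, hw⟩ := hr
  obtain ⟨q, hq, hqs⟩ := exists_ind w
  refine ⟨{z | z = v ∨ z ∈ q.support}, HSat.HS (v := v) ⟨x, y, q, hq, fun h => hv (hw _ (hqs _ h)), hvx, hvy, hxy, hn,
    fun z hz h => hN z (hw _ (hqs _ hz)) h, rfl⟩, .inl rfl, .inr (by simp), .inr (by simp), ?_⟩
  rintro z (h | h)
  · exact .inl h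
  · exact .inr (hw _ (hqs _ h))

lemma first_step {p q : V} {T : Set V} (hpq : p ≠ q) (hn : ¬ G.Adj p q)
    (h : Rch G {z | z ∈ T ∨ z = p ∨ z = q} p q) :
    ∃ x ∈ T, G.Adj p x ∧ ∃ U : Set V, Rch G U x q ∧ p ∉ U ∧ (∀ z ∈ U, z ∈ T ∨ z = q) ∧
      ∀ z ∈ U, G.Adj p z → z = x := by
  obtain ⟨w, hw⟩ := h
  obtain ⟨r, hr, hrs⟩ := exists_ind w
  cases r with
  | nil => exact absurd rfl hpq
  | @cons _ x _ hpx r =>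
    obtain ⟨h1, h2, h3⟩ := hr
    have hU : ∀ z ∈ r.support, z ∈ T ∨ z = q := by
      intro z hz
      rcases hw z (hrs z (by simp [hz])) with h | h | h
      · exact .inl h
      · exact absurd hz (h ▸ h1)
      · exact .inr h
    refine ⟨x, ?_, hpx, {z | z ∈ r.support}, rch_support r (by simp), h1, hU, h2⟩
    rcases hU x (by simp) with h | h
    · exact h
    · exact absurd hpx (h ▸ hn)

lemma F4' {T R : Set V} {p q : V} (hpq : p ≠ q) (hn : ¬ G.Adj p q)
    (hTR : ∀ t ∈ T, ∀ r ∈ R, t ≠ r ∧ ¬ G.Adj t r)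
    (h1 : Rch G {z | z ∈ T ∨ z = p ∨ z = q} p q) (h2 : Rch G {z | z ∈ R ∨ z = p ∨ z = q} p q) :
    ∃ S, HS G S ∧ p ∈ S ∧ (∃ x ∈ S, x ∈ T) ∧ (∃ y ∈ S, y ∈ R) ∧
      ∀ z ∈ S, z ∈ T ∨ z ∈ R ∨ z = p ∨ z = q := by
  obtain ⟨x, hx, hpx, U, hU1, hU2, hU3, hU4⟩ := first_step hpq hn h1
  obtain ⟨y, hy, hpy, U', hU1', hU2', hU3', hU4'⟩ := first_step hpq hn h2
  obtain ⟨S, h1, h2, h3, h4, h5⟩ := F4 (U := U ∪ U') (v := p) (by simp [hU2, hU2']) (hTR x hx y hy).1 (hTR x hx y hy).2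
    hpx hpy (by
      rintro z (hz | hz) h
      · exact .inl (hU4 z hz h)
      · exact .inr (hU4' z hz h))
    ((hU1.mono Set.subset_union_left).trans (hU1'.mono Set.subset_union_right).symm)
  refine ⟨S, h1, h2, ⟨x, h3, hx⟩, ⟨y, h4, hy⟩, fun z hz => ?_⟩
  rcases h5 z hz with h | h | h
  · simp [h]
  · rcases hU3 z h with h | h <;> simp [h]
  · rcases hU3' z h with h | h <;> simp [h]

lemma rch_ends {T : Set V} {p q s t : V} (hT : Conn G T) (hs : s ∈ T) (ht : t ∈ T)
    (hp : G.Adj p s) (hq : G.Adj q t) : Rch G {z | z ∈ T ∨ z = p ∨ z = q} p q := by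
  have h : Rch G {z | z ∈ T ∨ z = p ∨ z = q} s t := Rch.mono (hT s hs t ht) (fun z hz => .inl hz)
  exact (Rch.adj (by simp) h.left hp).trans (h.trans (Rch.adj h.right (by simp) hq.symm))

lemma HS.nbrs {S : Set V} {v : V} (h : HS G S) (hv : v ∈ S) :
    ∃ a b, a ∈ S ∧ b ∈ S ∧ a ≠ b ∧ ¬ G.Adj a b ∧ G.Adj v a ∧ G.Adj v b := by
  obtain ⟨a, b, p, hp, hv, hva, hvb, hab, hnab, hN, rfl⟩ := h.at hv
  exact ⟨a, b, .inr (by simp), .inr (by simp), hab, hnab, hva, hvb⟩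

lemma HS.nonnbr {S : Set V} {v : V} (h : HS G S) (hv : v ∈ S) :
    ∃ y ∈ S, y ≠ v ∧ ¬ G.Adj v y := by
  obtain ⟨a, b, p, hp, hv', hva, hvb, hab, hnab, hN, rfl⟩ := h.at hv
  cases p with
  | nil => exact absurd rfl hab
  | @cons _ c _ hac p =>
    refine ⟨c, .inr (by simp), ?_, fun hvc => ?_⟩
    · rintro rfl
      exact hv' (by simp)
    · rcases hN c (by simp) hvc with h | h
      · exact hac.ne h.symm
      · exact hnab (h ▸ hac)

lemma ind_split {a b : V} {p : G.Walk a b} (hp : Ind G p) {y : V} (hy : y ∈ p.support) :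
    ∃ (p1 : G.Walk a y) (p2 : G.Walk y b), (∀ z, z ∈ p.support ↔ z ∈ p1.support ∨ z ∈ p2.support) ∧
      ∀ s ∈ p1.support, ∀ t ∈ p2.support, s ≠ y → t ≠ y → s ≠ t ∧ ¬ G.Adj s t := by
  induction p with
  | nil =>
    simp only [Walk.support_nil, List.mem_singleton] at hy
    subst hy
    exact ⟨.nil, .nil, by simp, by simp⟩
  | @cons x c d h p ih =>
    by_cases hyx : y = x
    · subst hyx
      refine ⟨.nil, .cons h p, by simp, ?_⟩
      intro s hs t ht hsy
      simp at hs; exact absurd hs hsy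
    · have hy' : y ∈ p.support := by simpa [hyx] using hy
      obtain ⟨h1, h2, h3⟩ := hp
      obtain ⟨p1, p2, hs, hst⟩ := ih h3 hy'
      refine ⟨.cons h p1, p2, ?_, ?_⟩
      · intro z
        simp [hs z, or_assoc]
      · intro s hs' t ht hsy hty
        simp only [Walk.support_cons, List.mem_cons] at hs'
        have htp : t ∈ p.support := (hs t).2 (.inr ht)
        rcases hs' with rfl | hs'
        · refine ⟨fun e => h1 (e ▸ htp), fun hadj => ?_⟩
          have hc := h2 t htp hadj
          by_cases hcy : c = y
          · exact hty (hc.trans hcy)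
          · exact (hst c (by simp) t ht hcy hty).1 hc.symm
        · exact hst s hs' t ht hsy hty

/-- No clique separates a hole. -/
lemma F7 {S T : Set V} {r y : V} (h : HS G S) (hTS : T ⊆ S) (hy : y ∈ T) (hr : r ∈ S)
    (hrT : r ∉ T) (hnr : ∀ t ∈ T, ¬ G.Adj r t) :
    ∃ p q, p ∈ S ∧ q ∈ S ∧ p ∉ T ∧ q ∉ T ∧ p ≠ q ∧ ¬ G.Adj p q ∧ (∃ t ∈ T, G.Adj p t) ∧
      ∃ t ∈ T, G.Adj q t := by
  obtain ⟨a, b, P, hP, hv, hva, hvb, hab, hnab, hN, rfl⟩ := h.at hr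
  have hyP : y ∈ P.support := by
    rcases hTS hy with h | h
    · exact absurd hy (h ▸ hrT)
    · exact h
  obtain ⟨p1, p2, hs, hst⟩ := ind_split hP hyP
  have haT : a ∉ T := fun h => hnr a h hva
  have hbT : b ∉ T := fun h => hnr b h hvb
  obtain ⟨s, p, hs1, hp1, hsp, hsT, hpT⟩ := (rch_support p1 (x := y) (by simp)).symm.bdry T hy haT
  obtain ⟨t, q, ht1, hq1, htq, htT, hqT⟩ := (rch_support p2 (x := b) (by simp)).bdry T hy hbT
  have := hst p hp1 q hq1 (fun e => hpT (e ▸ hy)) (fun e => hqT (e ▸ hy))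
  exact ⟨p, q, .inr ((hs p).2 (.inl hp1)), .inr ((hs q).2 (.inr hq1)), hpT, hqT, this.1, this.2,
    ⟨s, hsT, hsp.symm⟩, ⟨t, htT, htq.symm⟩⟩

lemma ind_no_hole {a b : V} {p : G.Walk a b} (hp : Ind G p) {S : Set V} (h : HS G S)
    (hS : ∀ z ∈ S, z ∈ p.support) : False := by
  induction p with
  | nil =>
    obtain ⟨x, w, hw, hSe⟩ := id h
    have hx : x ∈ S := by rw [hSe]; simp
    obtain ⟨a, b, ha, hb, hab, -⟩ := h.nbrs hx
    have := hS a ha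
    have := hS b hb
    simp_all
  | @cons x c d hh p ih =>
    obtain ⟨h1, h2, h3⟩ := hp
    by_cases hx : x ∈ S
    · obtain ⟨a, b, ha, hb, hab, hn, hxa, hxb⟩ := h.nbrs hx
      have ha' := hS a ha
      have hb' := hS b hb
      simp only [Walk.support_cons, List.mem_cons] at ha' hb'
      have ha'' := ha'.resolve_left hxa.ne'
      have hb'' := hb'.resolve_left hxb.ne'
      exact hab ((h2 a ha'' hxa).trans (h2 b hb'' hxb).symm)
    · refine ih h3 (fun z hz => ?_)
      have := hS z hz
      simp only [Walk.support_cons, List.mem_cons] at this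
      rcases this with h | h
      · exact absurd hz (h ▸ hx)
      · exact h

lemma F8 {S S' : Set V} {g : V} (h : HS G S) (h' : HS G S') (hs : S' ⊆ S) (hg : g ∈ S)
    (hg' : g ∉ S') : False := by
  obtain ⟨a, b, p, hp, hv, hva, hvb, hab, hnab, hN, rfl⟩ := h.at hg
  refine ind_no_hole hp h' (fun z hz => ?_)
  rcases hs hz with h | h
  · exact absurd hz (h ▸ hg')
  · exact h

/-- Set version of the NC property of a vertex. -/
def NCv (G : SimpleGraph V) (u : V) : Prop :=
  ∀ S1 S2, HS G S1 → HS G S2 → u ∈ S1 → u ∉ S2 → ∀ x y z, x ≠ z → x ∈ S1 → y ∈ S1 → z ∈ S1 →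
    x ∈ S2 → y ∈ S2 → z ∈ S2 → G.Adj x y → G.Adj y z → False

lemma P' {u : V} {S S' : Set V} (hu : NCv G u) (hS : HS G S) (huS : u ∉ S) (hS' : HS G S')
    (huS' : u ∈ S') (hs : ∀ z ∈ S', z = u ∨ z ∈ S) : False := by
  obtain ⟨y, hy, hyu, hny⟩ := hS'.nonnbr huS'
  obtain ⟨a, b, ha, hb, hab, hn, hya, hyb⟩ := hS'.nbrs hy
  have hau : a ≠ u := fun e => hny (e ▸ hya.symm)
  have hbu : b ≠ u := fun e => hny (e ▸ hyb.symm)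
  exact hu S' S hS' hS huS' huS a y b hab ha hy hb ((hs a ha).resolve_left hau)
    ((hs y hy).resolve_left hyu) ((hs b hb).resolve_left hbu) hya.symm hyb


lemma HL {u y : V} {S : Set V} (hu : NCv G u) (hS : HS G S) (huS : u ∉ S) (hy : y ∈ S)
    (hny : ¬ G.Adj u y) {a b : V} (ha : a ∈ S) (hb : b ∈ S) (hua : G.Adj u a) (hub : G.Adj u b)
    (hab : a ≠ b) : G.Adj a b := by
  by_contra hn
  set Y : Set V := {z | z ∈ S ∧ ¬ G.Adj u z} with hY
  set T : Set V := {z | Rch G Y y z} with hT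
  have hTY : ∀ t ∈ T, t ∈ Y := fun t ht => Rch.right ht
  have hyT : y ∈ T := Rch.refl ⟨hy, hny⟩
  have hmax : ∀ t ∈ T, ∀ z ∈ S, G.Adj z t → z ∉ T → G.Adj u z := by
    intro t ht z hz hzt hzT
    by_contra hc
    exact hzT (Rch.trans ht (Rch.adj (hTY t ht) ⟨hz, hc⟩ hzt.symm))
  have key : ∃ p q, p ∈ S ∧ q ∈ S ∧ p ≠ q ∧ ¬ G.Adj p q ∧ G.Adj u p ∧ G.Adj u q ∧
      (∃ t ∈ T, G.Adj p t) ∧ ∃ t ∈ T, G.Adj q t := by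
    have aux : ∀ r ∈ S, G.Adj u r → (∀ t ∈ T, ¬ G.Adj r t) → ∃ p q, p ∈ S ∧ q ∈ S ∧ p ≠ q ∧ ¬ G.Adj p q ∧ G.Adj u p ∧ G.Adj u q ∧
      (∃ t ∈ T, G.Adj p t) ∧ ∃ t ∈ T, G.Adj q t := by
      intro r hr hur hrT
      obtain ⟨p, q, hp, hq, hpT, hqT, hpq, hnpq, ⟨t, ht, hpt⟩, ⟨s, hs, hqs⟩⟩ :=
        F7 hS (fun t ht => (hTY t ht).1) hyT hr (fun h => (hTY r h).2 hur) hrT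
      exact ⟨p, q, hp, hq, hpq, hnpq, hmax t ht p hp hpt hpT, hmax s hs q hq hqs hqT,
        ⟨t, ht, hpt⟩, ⟨s, hs, hqs⟩⟩
    by_cases h1 : ∃ t ∈ T, G.Adj a t
    · by_cases h2 : ∃ t ∈ T, G.Adj b t
      · exact ⟨a, b, ha, hb, hab, hn, hua, hub, h1, h2⟩
      · push Not at h2
        exact aux b hb hub h2
    · push Not at h1
      exact aux a ha hua h1
  obtain ⟨p, q, hp, hq, hpq, hnpq, hup, huq, ⟨t, ht, hpt⟩, ⟨s, hs, hqs⟩⟩ := key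
  have hsub : ∀ z, (z ∈ T ∨ z = p ∨ z = q) → z ∈ S := by
    rintro z (h | rfl | rfl)
    · exact (hTY z h).1
    · exact hp
    · exact hq
  obtain ⟨S', h1, h2, h3, h4, h5⟩ := F4 (v := u) (U := {z | z ∈ T ∨ z = p ∨ z = q})
    (fun h => huS (hsub u h)) hpq hnpq hup huq (by
      rintro z (h | h | h) huz
      · exact absurd huz (hTY z h).2
      · exact .inl h
      · exact .inr h) (rch_ends (conn_comp Y y) ht hs hpt hqs)
  exact P' hu hS huS h1 h2 (fun z hz => (h5 z hz).imp id (hsub z))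

/-- The two arcs of a hole `Z` from `w` to the neighbours of `u`. -/
structure Arcs (G : SimpleGraph V) (Z : Set V) (u w : V) (A B : Set V) (a b : V) : Prop where
  connA : Conn G A
  connB : Conn G B
  subA : A ⊆ Z
  subB : B ⊆ Z
  uA : u ∉ A
  uB : u ∉ B
  wA : w ∈ A
  wB : w ∈ B
  aA : a ∈ A
  bB : b ∈ B
  ua : G.Adj u a
  ub : G.Adj u b
  ab : a ≠ b
  nab : ¬ G.Adj a b
  nA : ∀ z ∈ A, G.Adj u z → z = a
  nB : ∀ z ∈ B, G.Adj u z → z = b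
  cover : ∀ z ∈ Z, z = u ∨ z ∈ A ∨ z ∈ B
  disj : ∀ s ∈ A, ∀ t ∈ B, s ≠ w → t ≠ w → s ≠ t ∧ ¬ G.Adj s t

lemma Arcs.swap {Z A B : Set V} {u w a b : V} (h : Arcs G Z u w A B a b) :
    Arcs G Z u w B A b a :=
  ⟨h.connB, h.connA, h.subB, h.subA, h.uB, h.uA, h.wB, h.wA, h.bB, h.aA, h.ub, h.ua, h.ab.symm,
    fun e => h.nab e.symm, h.nB, h.nA, fun z hz => (h.cover z hz).imp id Or.symm,
    fun s hs t ht h1 h2 => ⟨(h.disj t ht s hs h2 h1).1.symm, fun e => (h.disj t ht s hs h2 h1).2 e.symm⟩⟩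

lemma exists_arcs {Z : Set V} {u w : V} (hZ : HS G Z) (hu : u ∈ Z) (hw : w ∈ Z) (hwu : w ≠ u)
    (hn : ¬ G.Adj u w) : ∃ A B a b, Arcs G Z u w A B a b := by
  obtain ⟨a, b, p, hp, hv, hva, hvb, hab, hnab, hN, rfl⟩ := hZ.at hu
  have hwp : w ∈ p.support := hw.resolve_left hwu
  obtain ⟨p1, p2, hs, hst⟩ := ind_split hp hwp
  have hwa : a ≠ w := fun e => hn (e ▸ hva)
  have hwb : b ≠ w := fun e => hn (e ▸ hvb)
  have hA : ∀ z ∈ p1.support, z ∈ p.support := fun z hz => (hs z).2 (.inl hz)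
  have hB : ∀ z ∈ p2.support, z ∈ p.support := fun z hz => (hs z).2 (.inr hz)
  refine ⟨{z | z ∈ p1.support}, {z | z ∈ p2.support}, a, b, conn_support p1, conn_support p2,
    fun z hz => .inr (hA z hz), fun z hz => .inr (hB z hz), fun h => hv (hA _ h),
    fun h => hv (hB _ h), by simp, by simp, by simp, by simp, hva, hvb, hab, hnab, ?_, ?_, ?_, hst⟩
  · intro z hz huz
    rcases hN z (hA z hz) huz with h | h
    · exact h
    · subst h
      exact absurd rfl (hst z hz z (by simp) hwb hwb).1
  · intro z hz huz
    rcases hN z (hB z hz) huz with h | h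
    · subst h
      exact absurd rfl (hst z (by simp) z hz hwa hwa).1
    · exact h
  · intro z hz
    exact hz.imp id (hs z).1

lemma K_aux {Z A B : Set V} {u w a b g : V} (hu : u ∈ Z) (hZ : HS G Z) (h : Arcs G Z u w A B a b)
    (hg : g ∈ B) (hgw : g ≠ w) (T : Set V) (hT : Conn G T)
    (hgT : g ∉ T) (hwT : w ∈ T) (hTZ : T ⊆ Z) (huT : u ∉ T) : b ∉ T := by
  intro hbT
  obtain ⟨S, h1, h2, h3, h4, h5⟩ := F4 (v := u) (U := T ∪ A) (x := a) (y := b)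
    (by simp [huT, h.uA]) h.ab h.nab h.ua h.ub (by
      intro z hz huz
      have hzZ : z ∈ Z := hz.elim (fun h => hTZ h) (fun h' => h.subA h')
      rcases h.cover z hzZ with e | e | e
      · exact absurd (e ▸ huz) G.irrefl
      · exact .inl (h.nA z e huz)
      · exact .inr (h.nB z e huz))
    (Rch.trans (y := w) (Rch.mono (h.connA a h.aA w h.wA) Set.subset_union_right)
      (Rch.mono (hT w hwT b hbT) Set.subset_union_left))
  refine F8 hZ h1 (fun z hz => ?_) (h.subB hg) (fun hgS => ?_)
  · rcases h5 z hz with e | e | e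
    · exact e ▸ hu
    · exact hTZ e
    · exact h.subA e
  · rcases h5 g hgS with e | e | e
    · exact h.uB (e ▸ hg)
    · exact hgT e
    · exact (h.disj g e g hg hgw hgw).1 rfl

/-- `g` belongs to `R` or has a neighbour in `R`. -/
def Tch (G : SimpleGraph V) (R : Set V) (g : V) : Prop := g ∈ R ∨ ∃ r ∈ R, G.Adj g r

lemma lemK {Z A B R : Set V} {u w a b g1 g2 : V} (hu : NCv G u) (hZ : HS G Z) (huZ : u ∈ Z)
    (h : Arcs G Z u w A B a b) (hR : Conn G R) (huR : u ∉ R) (hw : ¬ Tch G R w)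
    (hg1 : g1 ∈ A) (hg1R : Tch G R g1) (hg2 : g2 ∈ B) (hg2R : Tch G R g2) : False := by
  set Y : Set V := {z | z ∈ Z ∧ z ≠ u ∧ ¬ Tch G R z} with hY
  set T : Set V := {z | Rch G Y w z} with hT
  have hTY : ∀ t ∈ T, t ∈ Y := fun t ht => Rch.right ht
  have hwu : w ≠ u := fun e => h.uA (e ▸ h.wA)
  have hwT : w ∈ T := Rch.refl ⟨h.subA h.wA, hwu, hw⟩
  have huT : u ∉ T := fun e => (hTY u e).2.1 rfl
  have hTZ : T ⊆ Z := fun t ht => (hTY t ht).1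
  have hTc : Conn G T := conn_comp Y w
  have hb : b ∉ T := K_aux huZ hZ h hg2 (fun e => hw (e ▸ hg2R)) T hTc
    (fun e => (hTY g2 e).2.2 hg2R) hwT hTZ huT
  have ha : a ∉ T := K_aux huZ hZ h.swap hg1 (fun e => hw (e ▸ hg1R)) T hTc
    (fun e => (hTY g1 e).2.2 hg1R) hwT hTZ huT
  have hnu : ∀ t ∈ T, ¬ G.Adj u t := by
    intro t ht hut
    rcases h.cover t (hTZ ht) with e | e | e
    · exact huT (e ▸ ht)
    · exact ha (h.nA t e hut ▸ ht)
    · exact hb (h.nB t e hut ▸ ht)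
  obtain ⟨p, q, hp, hq, hpT, hqT, hpq, hnpq, ⟨t, ht, hpt⟩, ⟨s, hs, hqs⟩⟩ :=
    F7 hZ hTZ hwT huZ huT hnu
  have aux : ∀ z ∈ Z, z ∉ T → ∀ t ∈ T, G.Adj z t → z ≠ u ∧ ∃ r ∈ R, G.Adj z r := by
    intro z hz hzT t ht hzt
    have hzu : z ≠ u := fun e => hnu t ht (e ▸ hzt)
    refine ⟨hzu, ?_⟩
    have : Tch G R z := by
      by_contra hc
      exact hzT (Rch.trans ht (Rch.adj (hTY t ht) ⟨hz, hzu, hc⟩ hzt.symm))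
    rcases this with h | h
    · exact absurd (.inr ⟨z, h, hzt.symm⟩) (hTY t ht).2.2
    · exact h
  obtain ⟨hpu, r, hr, hpr⟩ := aux p hp hpT t ht hpt
  obtain ⟨hqu, r', hr', hqr⟩ := aux q hq hqT s hs hqs
  obtain ⟨S, h1, h2, ⟨x, hxS, hxT⟩, h4, h5⟩ := F4' (T := T) (R := R) hpq hnpq
    (fun t ht r hr => ⟨fun e => (hTY t ht).2.2 (.inl (e ▸ hr)), fun e => (hTY t ht).2.2 (.inr ⟨r, hr, e⟩)⟩)
    (rch_ends hTc ht hs hpt hqs) (rch_ends hR hr hr' hpr hqr)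
  have huS : u ∉ S := by
    intro e
    rcases h5 u e with e | e | e | e
    · exact huT e
    · exact huR e
    · exact hpu e.symm
    · exact hqu e.symm
  obtain ⟨c, d, hc, hd, hcd, -, hxc, hxd⟩ := h1.nbrs hxS
  have hin : ∀ c ∈ S, G.Adj x c → c ∈ Z := by
    intro c hc hxc
    rcases h5 c hc with e | e | e | e
    · exact hTZ e
    · exact absurd (.inr ⟨c, e, hxc⟩) (hTY x hxT).2.2
    · exact e ▸ hp
    · exact e ▸ hq
  exact hu Z S hZ h1 huZ huS c x d hcd (hin c hc hxc) (hTZ hxT) (hin d hd hxd) hc hxS hd hxc.symm hxd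

/-- Adjacent to `u`, or on a common hole with `u`. -/
def Dn (G : SimpleGraph V) (u y : V) : Prop := G.Adj u y ∨ ∃ S, HS G S ∧ u ∈ S ∧ y ∈ S

/-- A connected set containing `z` with a unique neighbour `a` of `u`. -/
structure Leg (G : SimpleGraph V) (u z : V) (R : Set V) (a : V) : Prop where
  conn : Conn G R
  zR : z ∈ R
  uR : u ∉ R
  aR : a ∈ R
  ua : G.Adj u a
  nR : ∀ y ∈ R, G.Adj u y → y = a

lemma Leg.single {u z : V} (h : G.Adj u z) : Leg G u z {z} z :=
  ⟨conn_singleton z, rfl, h.ne, rfl, h, fun _ hy _ => hy⟩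

lemma Arcs.legA {Z A B : Set V} {u w a b : V} (h : Arcs G Z u w A B a b) : Leg G u w A a :=
  ⟨h.connA, h.wA, h.uA, h.aA, h.ua, h.nA⟩

lemma touch {u w z a b : V} {Q B R : Set V} (hQ : Conn G Q) (huQ : u ∉ Q) (hwQ : w ∈ Q)
    (hzQ : z ∈ Q) (hint : ∀ y ∈ Q, Dn G u y → y = w ∨ y = z)
    (hB : Leg G u w B b) (hR : Leg G u z R a) : ∃ g ∈ B, Tch G R g := by
  by_contra hc
  push Not at hc
  have hba : b ≠ a := fun e => hc b hB.aR (.inl (e ▸ hR.aR))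
  have hnba : ¬ G.Adj b a := fun e => hc b hB.aR (.inr ⟨a, hR.aR, e⟩)
  have hQ' : ∀ y ∈ Q, Dn G u y → y ∈ B ∨ y ∈ R := by
    intro y hy hD
    rcases hint y hy hD with rfl | rfl
    · exact .inl hB.zR
    · exact .inr hR.zR
  have hU1 : B ⊆ {y | y ∈ B ∨ y ∈ Q ∨ y ∈ R} := fun y hy => .inl hy
  have hU2 : Q ⊆ {y | y ∈ B ∨ y ∈ Q ∨ y ∈ R} := fun y hy => .inr (.inl hy)
  have hU3 : R ⊆ {y | y ∈ B ∨ y ∈ Q ∨ y ∈ R} := fun y hy => .inr (.inr hy)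
  obtain ⟨S, h1, h2, h3, h4, h5⟩ := F4 (v := u) (U := {y | y ∈ B ∨ y ∈ Q ∨ y ∈ R}) (x := b) (y := a)
    (by rintro (h | h | h); exacts [hB.uR h, huQ h, hR.uR h]) hba hnba hB.ua hR.ua (by
      have hBR : ∀ y, y ∈ B ∨ y ∈ R → G.Adj u y → y = b ∨ y = a := by
        rintro y (hy | hy) huy
        · exact .inl (hB.nR y hy huy)
        · exact .inr (hR.nR y hy huy)
      rintro y (hy | hy | hy) huy
      · exact hBR y (.inl hy) huy
      · exact hBR y (hQ' y hy (.inl huy)) huy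
      · exact hBR y (.inr hy) huy)
    ((Rch.mono (hB.conn b hB.aR w hB.zR) hU1).trans
      ((Rch.mono (hQ w hwQ z hzQ) hU2).trans (Rch.mono (hR.conn z hR.zR a hR.aR) hU3)))
  have hS : ∀ y ∈ S, y ≠ u → y ∈ B ∨ y ∈ R := by
    intro y hy hyu
    rcases (h5 y hy).resolve_left hyu with h | h | h
    · exact .inl h
    · exact hQ' y h (.inr ⟨S, h1, h2, hy⟩)
    · exact .inr h
  obtain ⟨a0, b0, p, hp, hv, hva, hvb, hab, hnab, hN, rfl⟩ := h1.at h2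
  have hbp : b ∈ p.support := h3.resolve_left hB.ua.ne'
  have hap : a ∈ p.support := h4.resolve_left hR.ua.ne'
  have haB : a ∉ B := fun e => hc a e (.inl hR.aR)
  obtain ⟨c, d, hc1, hd1, hcd, hcB, hdB⟩ := Rch.bdry (conn_support p b hbp a hap) B hB.aR haB
  have hdu : d ≠ u := fun e => hv (e ▸ hd1)
  exact hc c hcB (.inr ⟨d, (hS d (.inr hd1) hdu).resolve_left hdB, hcd⟩)

lemma core' {u w z : V} {Q : Set V} (hu : NCv G u) (hQ : Conn G Q) (huQ : u ∉ Q) (hwQ : w ∈ Q)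
    (hzQ : z ∈ Q) (hwz : w ≠ z) (hn : ¬ G.Adj w z) (hw : Dn G u w) (hz : Dn G u z)
    (hint : ∀ y ∈ Q, Dn G u y → y = w ∨ y = z) (hnw : ¬ G.Adj u w) : False := by
  have hwu : w ≠ u := fun e => huQ (e ▸ hwQ)
  have hzu : z ≠ u := fun e => huQ (e ▸ hzQ)
  obtain ⟨Z, hZ, huZ, hwZ⟩ := hw.resolve_left hnw
  obtain ⟨A, B, a, b, hAB⟩ := exists_arcs hZ huZ hwZ hwu hnw
  have hleg : ∃ R a', Leg G u z R a' ∧ ¬ Tch G R w := by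
    by_cases huz : G.Adj u z
    · refine ⟨{z}, z, Leg.single huz, ?_⟩
      rintro (h | ⟨r, hr, h⟩)
      · exact hwz h
      · exact hn (Set.mem_singleton_iff.1 hr ▸ h)
    · obtain ⟨Z', hZ', huZ', hzZ'⟩ := hz.resolve_left huz
      obtain ⟨A', B', a', b', hAB'⟩ := exists_arcs hZ' huZ' hzZ' hzu huz
      by_cases h1 : Tch G A' w
      · by_cases h2 : Tch G B' w
        · exfalso
          have aux : ∀ X : Set V, Tch G X w → ∃ g ∈ X, Tch G {w} g := by
            rintro X (h | ⟨r, hr, h⟩)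
            · exact ⟨w, h, .inl rfl⟩
            · exact ⟨r, hr, .inr ⟨w, rfl, h.symm⟩⟩
          obtain ⟨g1, hg1, hg1'⟩ := aux A' h1
          obtain ⟨g2, hg2, hg2'⟩ := aux B' h2
          refine lemK hu hZ' huZ' hAB' (conn_singleton w) hwu.symm ?_ hg1 hg1' hg2 hg2'
          rintro (h | ⟨r, hr, h⟩)
          · exact hwz h.symm
          · exact hn (Set.mem_singleton_iff.1 hr ▸ h.symm)
        · exact ⟨B', b', hAB'.swap.legA, h2⟩
      · exact ⟨A', a', hAB'.legA, h1⟩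
  obtain ⟨R, a', hR, hRw⟩ := hleg
  obtain ⟨g1, hg1, hg1'⟩ := touch hQ huQ hwQ hzQ hint hAB.legA hR
  obtain ⟨g2, hg2, hg2'⟩ := touch hQ huQ hwQ hzQ hint hAB.swap.legA hR
  exact lemK hu hZ huZ hAB hR.conn hR.uR hRw hg1 hg1' hg2 hg2'

lemma core {u w z : V} {Q : Set V} (hu : NCv G u) (hQ : Conn G Q) (huQ : u ∉ Q) (hwQ : w ∈ Q)
    (hzQ : z ∈ Q) (hwz : w ≠ z) (hn : ¬ G.Adj w z) (hw : Dn G u w) (hz : Dn G u z)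
    (hint : ∀ y ∈ Q, Dn G u y → y = w ∨ y = z) : False := by
  by_cases h1 : G.Adj u w
  · by_cases h2 : G.Adj u z
    · obtain ⟨g, hg, hg'⟩ := touch hQ huQ hwQ hzQ hint (Leg.single h1) (Leg.single h2)
      rw [Set.mem_singleton_iff] at hg
      subst hg
      rcases hg' with h | ⟨r, hr, h⟩
      · exact hwz h
      · exact hn (Set.mem_singleton_iff.1 hr ▸ h)
    · exact core' hu hQ huQ hzQ hwQ hwz.symm (fun e => hn e.symm) hz hw
        (fun y hy hD => (hint y hy hD).symm) h2
  · exact core' hu hQ huQ hwQ hzQ hwz hn hw hz hint h1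

lemma ind_transfer {H : SimpleGraph V} {a b : V} (p : G.Walk a b) (hp : Ind G p)
    (h : ∀ x ∈ p.support, ∀ y ∈ p.support, G.Adj x y ↔ H.Adj x y) :
    ∃ q : H.Walk a b, Ind H q ∧ q.support = p.support := by
  induction p with
  | nil => exact ⟨.nil, trivial, rfl⟩
  | @cons x c d hh p ih =>
    obtain ⟨h1, h2, h3⟩ := hp
    obtain ⟨q, hq, hs⟩ := ih h3 (fun x hx y hy => h x (by simp [hx]) y (by simp [hy]))
    have hxc : H.Adj x c := (h x (by simp) c (by simp)).1 hh
    have key : x ∉ q.support ∧ (∀ z ∈ q.support, H.Adj x z → z = c) ∧ Ind H q := by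
      refine ⟨by rwa [hs], ?_, hq⟩
      intro z hz hxz
      rw [hs] at hz
      exact h2 z hz ((h x (by simp) z (by simp [hz])).2 hxz)
    exact ⟨.cons hxc q, key, by simp [hs]⟩

lemma HS.nonempty {S : Set V} (h : HS G S) : ∃ v, v ∈ S := by
  obtain ⟨a, w, -, rfl⟩ := h
  exact ⟨a, by simp⟩

lemma HS.transfer {H : SimpleGraph V} {S : Set V} (hS : HS G S)
    (h : ∀ x ∈ S, ∀ y ∈ S, G.Adj x y ↔ H.Adj x y) : HS H S := by
  obtain ⟨v, hv⟩ := hS.nonempty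
  obtain ⟨a, b, p, hp, hv', hva, hvb, hab, hnab, hN, rfl⟩ := hS.at hv
  have hps : ∀ x ∈ p.support, x ∈ {x | x = v ∨ x ∈ p.support} := fun x hx => .inr hx
  obtain ⟨q, hq, hs⟩ := ind_transfer (H := H) p hp (fun x hx y hy => h x (hps x hx) y (hps y hy))
  have ha := hps a (by simp)
  have hb := hps b (by simp)
  refine HSat.HS (v := v) ⟨a, b, q, hq, by rwa [hs], (h v hv a ha).1 hva, (h v hv b hb).1 hvb, hab,
    fun e => hnab ((h a ha b hb).2 e), ?_, by simp [hs]⟩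
  intro z hz hvz
  rw [hs] at hz
  exact hN z hz ((h v hv z (hps z hz)).2 hvz)

/-- Local chordalization at `u`, in terms of vertex sets of holes. -/
def LC (G : SimpleGraph V) (u : V) : SimpleGraph V where
  Adj x y := G.Adj x y ∨ (x ≠ y ∧ ∃ S, HS G S ∧ u ∈ S ∧ x ∈ S ∧ y ∈ S ∧ (x = u ∨ y = u))
  symm := ⟨by
    rintro x y (h | ⟨h, S, h1, h2, h3, h4, h5⟩)
    · exact .inl h.symm
    · exact .inr ⟨h.symm, S, h1, h2, h4, h3, h5.symm⟩⟩
  loopless := ⟨by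
    rintro x (h | ⟨h, -⟩)
    · exact G.irrefl h
    · exact h rfl⟩

lemma LC_off {u x y : V} (hx : x ≠ u) (hy : y ≠ u) : (LC G u).Adj x y ↔ G.Adj x y := by
  constructor
  · rintro (h | ⟨h, S, h1, h2, h3, h4, h5⟩)
    · exact h
    · exact absurd h5 (by simp [hx, hy])
  · exact Or.inl

lemma LC_at {u y : V} (hy : y ≠ u) : (LC G u).Adj u y ↔ Dn G u y := by
  constructor
  · rintro (h | ⟨h, S, h1, h2, h3, h4, h5⟩)
    · exact .inl h
    · exact .inr ⟨S, h1, h2, h4⟩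
  · rintro (h | ⟨S, h1, h2, h3⟩)
    · exact .inl h
    · exact .inr ⟨hy.symm, S, h1, h2, h2, h3, .inl rfl⟩

lemma lem1 {u : V} {S : Set V} (hu : NCv G u) (hS : HS (LC G u) S) : u ∉ S ∧ HS G S := by
  have huS : u ∉ S := by
    intro huS
    obtain ⟨a, b, p, hp, hv', hva, hvb, hab, hnab, hN, rfl⟩ := hS.at huS
    have hpu : ∀ z ∈ p.support, z ≠ u := fun z hz e => hv' (e ▸ hz)
    obtain ⟨q, hq, hs⟩ := ind_transfer (H := G) p hp (fun x hx y hy => LC_off (hpu x hx) (hpu y hy))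
    have hau := hpu a (by simp)
    have hbu := hpu b (by simp)
    refine core (Q := {z | z ∈ q.support}) hu (conn_support q) (by simpa [hs] using hv')
      (w := a) (z := b) (by simp) (by simp) hab (fun e => hnab ((LC_off hau hbu).2 e))
      ((LC_at hau).1 hva) ((LC_at hbu).1 hvb) ?_
    intro y hy hD
    have hy' : y ∈ p.support := by rw [← hs]; exact hy
    exact hN y hy' ((LC_at (hpu y hy')).2 hD)
  exact ⟨huS, hS.transfer (fun x hx y hy =>
    LC_off (fun e => huS (e ▸ hx)) (fun e => huS (e ▸ hy)))⟩

/-- Set version of a hole cover with the NC property. -/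
structure NCset (G : SimpleGraph V) (C : Set V) : Prop where
  cover : ∀ S, HS G S → ∃ u ∈ C, u ∈ S
  uniq : ∀ S, HS G S → ∀ u ∈ C, ∀ v ∈ C, u ∈ S → v ∈ S → u = v
  nc : ∀ u ∈ C, NCv G u

lemma NCset.step {C : Set V} {u : V} (h : NCset G C) (hu : u ∈ C) : NCset (LC G u) (C \ {u}) := by
  have hnc := h.nc u hu
  refine ⟨?_, ?_, ?_⟩
  · intro S hS
    obtain ⟨h1, h2⟩ := lem1 hnc hS
    obtain ⟨v, hv, hvS⟩ := h.cover S h2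
    exact ⟨v, ⟨hv, fun e => h1 (Set.mem_singleton_iff.1 e ▸ hvS)⟩, hvS⟩
  · intro S hS v hv w hw
    exact h.uniq S (lem1 hnc hS).2 v hv.1 w hw.1
  · intro v hv S1 S2 hS1 hS2 hv1 hv2 x y z hxz hx hy hz hx2 hy2 hz2 hxy hyz
    obtain ⟨h1, h1'⟩ := lem1 hnc hS1
    obtain ⟨h2, h2'⟩ := lem1 hnc hS2
    have hne : ∀ t ∈ S1, t ≠ u := fun t ht e => h1 (e ▸ ht)
    exact h.nc v hv.1 S1 S2 h1' h2' hv1 hv2 x y z hxz hx hy hz hx2 hy2 hz2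
      ((LC_off (hne x hx) (hne y hy)).1 hxy) ((LC_off (hne y hy) (hne z hz)).1 hyz)

lemma NCset.chordalize (C : Finset V) : ∀ {G : SimpleGraph V}, NCset G (C : Set V) →
    ∃ G' : SimpleGraph V, (∀ x y, G.Adj x y → G'.Adj x y) ∧ (∀ S, ¬ HS G' S) ∧
      ∀ x y, G'.Adj x y → G.Adj x y ∨ ∃ S, HS G S ∧ x ∈ S ∧ y ∈ S ∧ (x ∈ C ∨ y ∈ C) := by
  classical
  induction C using Finset.induction_on with
  | empty =>
    intro G h
    refine ⟨G, fun _ _ h => h, fun S hS => ?_, fun _ _ h => .inl h⟩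
    obtain ⟨u, hu, -⟩ := h.cover S hS
    simp at hu
  | insert u C huC ih =>
    intro G h
    have hu : u ∈ ((insert u C : Finset V) : Set V) := by simp
    have hnc := h.nc u hu
    have hs := h.step hu
    have he : ((insert u C : Finset V) : Set V) \ {u} = (C : Set V) := by
      ext x
      simp only [Finset.coe_insert, Set.mem_sdiff, Set.mem_insert_iff, Finset.mem_coe,
        Set.mem_singleton_iff]
      constructor
      · rintro ⟨h1 | h1, h2⟩
        · exact absurd h1 h2
        · exact h1
      · intro h
        exact ⟨.inr h, fun e => huC (e ▸ h)⟩
    rw [he] at hs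
    obtain ⟨G', h1, h2, h3⟩ := ih hs
    refine ⟨G', fun x y hxy => h1 x y (.inl hxy), h2, fun x y hxy => ?_⟩
    rcases h3 x y hxy with (h | ⟨hne, S, hS, huS, hxS, hyS, hor⟩) | ⟨S, hS, hxS, hyS, hor⟩
    · exact .inl h
    · refine .inr ⟨S, hS, hxS, hyS, ?_⟩
      rcases hor with rfl | rfl <;> simp
    · refine .inr ⟨S, (lem1 hnc hS).2, hxS, hyS, ?_⟩
      rcases hor with h | h <;> simp [h]

lemma conn_insert {B : Set V} {x r : V} (hB : Conn G B) (hr : r ∈ B) (hx : G.Adj x r) :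
    Conn G (insert x B) := by
  have key : ∀ y ∈ insert x B, Rch G (insert x B) y r := by
    rintro y (rfl | hy)
    · exact Rch.adj (by simp) (by simp [hr]) hx
    · exact Rch.mono (hB y hy r hr) (Set.subset_insert _ _)
  intro y hy z hz
  exact (key y hy).trans (key z hz).symm

/-- Dirac: a chordal graph has simplicial vertices. -/
lemma dirac (hG : ∀ S, ¬ HS G S) (M : Finset V) : M.Nonempty →
    ∃ v ∈ M, ∀ x ∈ M, ∀ y ∈ M, G.Adj v x → G.Adj v y → x ≠ y → G.Adj x y := by
  classical
  induction M using Finset.strongInduction with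
  | H M ih =>
  intro hM
  by_cases hcl : ∀ x ∈ M, ∀ y ∈ M, x ≠ y → G.Adj x y
  · obtain ⟨v, hv⟩ := hM
    exact ⟨v, hv, fun x hx y hy _ _ hxy => hcl x hx y hy hxy⟩
  push Not at hcl
  obtain ⟨x0, hx0, y0, hy0, hxy0, hn0⟩ := hcl
  set F := M.powerset.filter (fun B : Finset V => B.Nonempty ∧ Conn G (B : Set V) ∧ ∃ m ∈ M, ¬ Tch G (B : Set V) m) with hF
  have hFne : F.Nonempty := by
    refine ⟨{x0}, ?_⟩
    rw [hF, Finset.mem_filter]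
    refine ⟨by simpa using hx0, by simp, by simpa using conn_singleton x0, y0, hy0, ?_⟩
    rintro (h | ⟨r, hr, h⟩)
    · simp at h; exact hxy0 h.symm
    · simp at hr; subst hr; exact hn0 h.symm
  obtain ⟨B, hB, hmax⟩ := Finset.exists_max_image F Finset.card hFne
  rw [hF, Finset.mem_filter, Finset.mem_powerset] at hB
  obtain ⟨hBM, ⟨b0, hb0⟩, hBc, m0, hm0, hm0'⟩ := hB
  set M' := M.filter (fun m => ¬ Tch G (B : Set V) m) with hM'
  have hmem : ∀ m, m ∈ M' ↔ m ∈ M ∧ ¬ Tch G (B : Set V) m := fun m => by rw [hM', Finset.mem_filter]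
  have hss : M' ⊂ M := by
    rw [Finset.ssubset_iff_of_subset (Finset.filter_subset _ _)]
    exact ⟨b0, hBM hb0, fun h => ((hmem b0).1 h).2 (.inl hb0)⟩
  obtain ⟨v, hv, hvs⟩ := ih M' hss ⟨m0, (hmem m0).2 ⟨hm0, hm0'⟩⟩
  have hv' := (hmem v).1 hv
  have hX : ∀ x ∈ M, G.Adj v x → x ∉ M' → x ∉ B ∧ ∃ r ∈ B, G.Adj x r := by
    intro x hx hvx hxM'
    have hT : Tch G (B : Set V) x := by
      by_contra hc; exact hxM' ((hmem x).2 ⟨hx, hc⟩)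
    have hxB : x ∉ B := fun h => hv'.2 (.inr ⟨x, h, hvx⟩)
    exact ⟨hxB, hT.resolve_left hxB⟩
  have hcomp : ∀ x ∈ M, G.Adj v x → x ∉ M' → ∀ m ∈ M', G.Adj x m := by
    intro x hx hvx hxM' m hm
    obtain ⟨hxB, r, hr, hxr⟩ := hX x hx hvx hxM'
    by_contra hc
    have hm' := (hmem m).1 hm
    have hin : insert x B ∈ F := by
      rw [hF, Finset.mem_filter, Finset.mem_powerset]
      refine ⟨Finset.insert_subset hx hBM, ⟨x, by simp⟩, ?_, m, hm'.1, ?_⟩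
      · rw [Finset.coe_insert]; exact conn_insert hBc hr hxr
      · rintro (h | ⟨s, hs, h⟩)
        · simp only [Finset.coe_insert, Set.mem_insert_iff] at h
          rcases h with rfl | h
          · exact hxM' hm
          · exact hm'.2 (.inl h)
        · simp only [Finset.coe_insert, Set.mem_insert_iff] at hs
          rcases hs with rfl | hs
          · exact hc h.symm
          · exact hm'.2 (.inr ⟨s, hs, h⟩)
    have := hmax _ hin
    rw [Finset.card_insert_of_notMem hxB] at this
    omega
  refine ⟨v, hv'.1, fun x hx y hy hvx hvy hxy => ?_⟩
  by_cases hxM : x ∈ M'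
  · by_cases hyM : y ∈ M'
    · exact hvs x hxM y hyM hvx hvy hxy
    · exact (hcomp y hy hvy hyM x hxM).symm
  · by_cases hyM : y ∈ M'
    · exact hcomp x hx hvx hxM y hyM
    · by_contra hn
      obtain ⟨hxB, r, hr, hxr⟩ := hX x hx hvx hxM
      obtain ⟨hyB, s, hs, hys⟩ := hX y hy hvy hyM
      obtain ⟨S, hS, -⟩ := F4' (T := (B : Set V)) (R := {v}) hxy hn (by
        intro t ht r hr
        rw [Set.mem_singleton_iff] at hr
        subst hr
        exact ⟨fun e => hv'.2 (.inl (e ▸ ht)), fun e => hv'.2 (.inr ⟨t, ht, e.symm⟩)⟩)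
        (rch_ends hBc hr hs hxr hys)
        (rch_ends (conn_singleton v) rfl rfl hvx.symm hvy.symm)
      exact hG S hS

lemma pick_leg {C Z : Set V} {u u' w : V} (hC : NCset G C) (hu : u ∈ C) (hu' : u' ∈ C) (hne : u ≠ u')
    (hZ : HS G Z) (huZ : u ∈ Z) (hwZ : w ∈ Z) (hnw : ¬ G.Adj u w) (hnw' : ¬ G.Adj u' w) (hwu : w ≠ u) :
    ∃ B b, Leg G u w B b ∧ B ⊆ Z ∧ ¬ G.Adj b u' := by
  have hu'Z : u' ∉ Z := fun h => hne (hC.uniq Z hZ u hu u' hu' huZ h)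
  obtain ⟨A, B, a, b, h⟩ := exists_arcs hZ huZ hwZ hwu hnw
  by_cases h1 : G.Adj a u'
  · by_cases h2 : G.Adj b u'
    · exact absurd (HL (hC.nc u' hu') hZ hu'Z hwZ hnw' (h.subA h.aA) (h.subB h.bB) h1.symm h2.symm h.ab) h.nab
    · exact ⟨B, b, h.swap.legA, h.subB, h2⟩
  · exact ⟨A, a, h.legA, h.subA, h1⟩

lemma clique1 {C Z Z' : Set V} {u u' w : V} (hC : NCset G C) (hu : u ∈ C) (hu' : u' ∈ C)
    (huu : G.Adj u u') (hZ : HS G Z) (huZ : u ∈ Z) (hwZ : w ∈ Z) (hZ' : HS G Z') (huZ' : u' ∈ Z')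
    (hwZ' : w ∈ Z') (hnw : ¬ G.Adj u w) (hnw' : ¬ G.Adj u' w) (hwu : w ≠ u) (hwu' : w ≠ u') :
    False := by
  have hne := huu.ne
  have h1 : u' ∉ Z := fun h => hne (hC.uniq Z hZ u hu u' hu' huZ h)
  have h2 : u ∉ Z' := fun h => hne (hC.uniq Z' hZ' u hu u' hu' h huZ')
  obtain ⟨B, b, hB, hBZ, hb⟩ := pick_leg hC hu hu' hne hZ huZ hwZ hnw hnw' hwu
  obtain ⟨B', b', hB', hBZ', hb'⟩ := pick_leg hC hu' hu hne.symm hZ' huZ' hwZ' hnw' hnw hwu'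
  have hU1 : B ⊆ {y | y ∈ B ∨ y ∈ B' ∨ y = u'} := fun y hy => .inl hy
  have hU2 : B' ⊆ {y | y ∈ B ∨ y ∈ B' ∨ y = u'} := fun y hy => .inr (.inl hy)
  obtain ⟨S, hS, huS, -, hu'S, -⟩ := F4 (v := u) (x := b) (y := u') (U := {y | y ∈ B ∨ y ∈ B' ∨ y = u'})
    (by rintro (h | h | h); exacts [hB.uR h, h2 (hBZ' h), hne h])
    (fun e => h1 (e ▸ hBZ hB.aR)) hb hB.ua huu (by
      rintro z (hz | hz | hz) huz
      · exact .inl (hB.nR z hz huz)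
      · exfalso
        have hzu' : z ≠ u' := fun e => hB'.uR (e ▸ hz)
        have := HL (hC.nc u hu) hZ' h2 hwZ' hnw (hBZ' hz) huZ' huz huu hzu'
        have := hB'.nR z hz this.symm
        subst this
        exact hb' huz.symm
      · exact .inr hz)
    ((Rch.mono (hB.conn b hB.aR w hB.zR) hU1).trans
      ((Rch.mono (hB'.conn w hB'.zR b' hB'.aR) hU2).trans
        (Rch.adj (hU2 hB'.aR) (.inr (.inr rfl)) hB'.ua.symm)))
  exact hne (hC.uniq S hS u hu u' hu' huS hu'S)

lemma deg [Finite V] [Nonempty V] {C : Set V} (hC : NCset G C) :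
    ∃ v u : V, ∀ x y, (x = v ∨ G.Adj v x) → (y = v ∨ G.Adj v y) → x ≠ u → y ≠ u → x ≠ y →
      G.Adj x y := by
  classical
  have := Fintype.ofFinite V
  have hCf : ((C.toFinite.toFinset : Finset V) : Set V) = C := by simp
  obtain ⟨G', h1, h2, h3⟩ := NCset.chordalize (G := G) C.toFinite.toFinset (by rwa [hCf])
  obtain ⟨v, -, hv⟩ := dirac h2 Finset.univ Finset.univ_nonempty
  have hcl : ∀ x y, (x = v ∨ G'.Adj v x) → (y = v ∨ G'.Adj v y) → x ≠ y → G'.Adj x y := by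
    rintro x y (rfl | hx) (rfl | hy) hxy
    · exact absurd rfl hxy
    · exact hy
    · exact hx.symm
    · exact hv x (by simp) y (by simp) hx hy hxy
  have h3' : ∀ x y, G'.Adj x y → ¬ G.Adj x y → ∃ S, HS G S ∧ x ∈ S ∧ y ∈ S ∧ (x ∈ C ∨ y ∈ C) := by
    intro x y h hn
    have := (h3 x y h).resolve_left hn
    simpa using this
  have main : ∀ u w u' w', (u = v ∨ G'.Adj v u) → (w = v ∨ G'.Adj v w) → (u' = v ∨ G'.Adj v u') →
      (w' = v ∨ G'.Adj v w') → u ≠ w → u' ≠ w' → u ∈ C → u' ∈ C → ¬ G.Adj u w → ¬ G.Adj u' w' →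
      u = u' := by
    intro u w u' w' ku kw ku' kw' huw huw' hu hu' hn hn'
    by_contra hne
    obtain ⟨Z, hZ, huZ, hwZ, -⟩ := h3' u w (hcl u w ku kw huw) hn
    obtain ⟨Z', hZ', huZ', hwZ', -⟩ := h3' u' w' (hcl u' w' ku' kw' huw') hn'
    have hwC : w ∉ C := fun h => huw (hC.uniq Z hZ u hu w h huZ hwZ)
    have hwC' : w' ∉ C := fun h => huw' (hC.uniq Z' hZ' u' hu' w' h huZ' hwZ')
    have huu : G.Adj u u' := by
      by_contra hc
      obtain ⟨S, hS, hx, hy, -⟩ := h3' u u' (hcl u u' ku ku' hne) hc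
      exact hne (hC.uniq S hS u hu u' hu' hx hy)
    have e1 : u ≠ w' := fun e => hwC' (e ▸ hu)
    have e2 : u' ≠ w := fun e => hwC (e ▸ hu')
    by_cases hww : w = w'
    · subst hww
      exact clique1 hC hu hu' huu hZ huZ hwZ hZ' huZ' hwZ' hn hn' huw.symm huw'.symm
    have a1 : G.Adj w w' := by
      by_contra hc
      obtain ⟨S, hS, hx, hy, h | h⟩ := h3' w w' (hcl w w' kw kw' hww) hc
      · exact hwC h
      · exact hwC' h
    have a2 : G.Adj u w' := by
      by_contra hc
      obtain ⟨S, hS, hx, hy, -⟩ := h3' u w' (hcl u w' ku kw' e1) hc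
      exact clique1 hC hu hu' huu hS hx hy hZ' huZ' hwZ' hc hn' e1.symm huw'.symm
    have a3 : G.Adj u' w := by
      by_contra hc
      obtain ⟨S, hS, hx, hy, -⟩ := h3' u' w (hcl u' w ku' kw e2) hc
      exact clique1 hC hu hu' huu hZ huZ hwZ hS hx hy hn hc huw.symm e2.symm
    obtain ⟨S, hS, huS, hu'S, -⟩ := F4 (v := u) (x := u') (y := w') (U := {u', w, w'})
      (by simp [hne, huw, e1]) huw' hn' huu a2 (by
        intro z hz huz
        simp only [Set.mem_insert_iff, Set.mem_singleton_iff] at hz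
        rcases hz with h | h | h
        · exact .inl h
        · exact absurd (h ▸ huz) hn
        · exact .inr h)
      ((Rch.adj (by simp) (by simp) a3).trans (Rch.adj (by simp) (by simp) a1))
    exact hne (hC.uniq S hS u hu u' hu' huS hu'S)
  have up : ∀ x, (x = v ∨ G.Adj v x) → (x = v ∨ G'.Adj v x) := fun x hx => hx.imp id (h1 v x)
  by_cases hex : ∃ u w, (u = v ∨ G'.Adj v u) ∧ (w = v ∨ G'.Adj v w) ∧ u ≠ w ∧ u ∈ C ∧ ¬ G.Adj u w
  · obtain ⟨u, w, ku, kw, huw, huC, hn⟩ := hex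
    refine ⟨v, u, fun x y hx hy hxu hyu hxy => ?_⟩
    by_contra hc
    obtain ⟨S, hS, hxS, hyS, h | h⟩ := h3' x y (hcl x y (up x hx) (up y hy) hxy) hc
    · exact hxu (main x y u w (up x hx) (up y hy) ku kw hxy huw h huC hc hn)
    · exact hyu (main y x u w (up y hy) (up x hx) ku kw hxy.symm huw h huC (fun e => hc e.symm) hn)
  · push Not at hex
    refine ⟨v, v, fun x y hx hy hxu hyu hxy => ?_⟩
    by_contra hc
    obtain ⟨S, hS, hxS, hyS, h | h⟩ := h3' x y (hcl x y (up x hx) (up y hy) hxy) hc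
    · exact hc (hex x y (up x hx) (up y hy) hxy h)
    · exact hc (hex y x (up y hy) (up x hx) hxy.symm h).symm

lemma meet {P L : Type*} [Fintype P] [Fintype L] (I : P → L → Prop) [Nonempty L]
    (hc : Fintype.card P = Fintype.card L) (h1 : ∀ l, ∃ p, ¬ I p l)
    (h2 : ∀ p q l m, I p l → I q l → I p m → I q m → p = q ∨ l = m)
    (h3 : ∀ p q, p ≠ q → ∃ l, I p l ∧ I q l) (l m : L) (hlm : l ≠ m) : ∃ p, I p l ∧ I p m := by
  classical
  letI : Membership P L := ⟨fun l p => I p l⟩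
  choose f hf using h3
  letI : Configuration.HasLines P L :=
    { exists_point := h1
      exists_line := by
        intro p
        by_contra hcon
        push Not at hcon
        have hcon' : ∀ l, I p l := hcon
        obtain ⟨l0⟩ := ‹Nonempty L›
        obtain ⟨q, hq⟩ := h1 l0
        have hpq : p ≠ q := fun e => hq (e ▸ hcon' l0)
        obtain ⟨r, hr⟩ := h1 (f p q hpq)
        have hqr : q ≠ r := fun e => hr (e ▸ (hf p q hpq).2)
        rcases h2 p q _ _ (hf p q hpq).1 (hf p q hpq).2 (hcon' (f q r hqr)) (hf q r hqr).1 with e | e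
        · exact hpq e
        · exact hr (e ▸ (hf q r hqr).2)
      eq_or_eq := fun {p q l m} a b c d => h2 p q l m a b c d
      mkLine := fun {p q} h => f p q h
      mkLine_ax := fun {p q} h => hf p q h }
  letI := Configuration.HasLines.hasPoints (P := P) (L := L) hc
  exact ⟨Configuration.HasPoints.mkPoint hlm, Configuration.HasPoints.mkPoint_ax hlm⟩

lemma ncset_of (h : HasNCProperty G) : ∃ C, NCset G C := by
  obtain ⟨C, ⟨-, hcov⟩, hnc, huniq⟩ := h
  refine ⟨C, ?_, ?_, ?_⟩
  · rintro S ⟨a, w, hw, rfl⟩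
    exact hcov a w hw
  · rintro S ⟨a, w, hw, rfl⟩ u hu v hv h1 h2
    exact huniq a w hw u hu v hv h1 h2
  · rintro u hu S1 S2 ⟨a, w, hw, rfl⟩ ⟨b, w', hw', rfl⟩ hu1 hu2 x y z hxz hx hy hz hx2 hy2 hz2 hxy hyz
    exact hnc u hu a b w w' hw hw' hu1 hu2 ⟨x, y, z, hxz, hw.2.2 x y hx hy hxy,
      hw.2.2 y z hy hz hyz, hw'.2.2 x y hx2 hy2 hxy, hw'.2.2 y z hy2 hz2 hyz⟩

lemma ind_map {W : Type*} {H : SimpleGraph W} (f : H ↪g G) {a b : W} (p : H.Walk a b)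
    (hp : Ind H p) : Ind G (p.map f.toHom) := by
  induction p with
  | nil => trivial
  | @cons x c d hh p ih =>
    obtain ⟨h1, h2, h3⟩ := hp
    have hs : ∀ z, z ∈ (p.map f.toHom).support ↔ ∃ t ∈ p.support, f t = z := by
      intro z; rw [Walk.support_map, List.mem_map]; rfl
    have key : f x ∉ (p.map f.toHom).support ∧
        (∀ z ∈ (p.map f.toHom).support, G.Adj (f x) z → z = f c) ∧ Ind G (p.map f.toHom) := by
      refine ⟨?_, ?_, ih h3⟩
      · intro h
        obtain ⟨t, ht, e⟩ := (hs _).1 h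
        exact h1 (f.injective e ▸ ht)
      · intro z hz hxz
        obtain ⟨t, ht, rfl⟩ := (hs _).1 hz
        rw [h2 t ht (f.map_adj_iff.1 hxz)]
    exact key

lemma HS.map {W : Type*} {H : SimpleGraph W} (f : H ↪g G) {S : Set W} (hS : HS H S) :
    HS G (f '' S) := by
  obtain ⟨v, hv⟩ := hS.nonempty
  obtain ⟨a, b, p, hp, hv', hva, hvb, hab, hnab, hN, rfl⟩ := hS.at hv
  have hs : ∀ z, z ∈ (p.map f.toHom).support ↔ ∃ t ∈ p.support, f t = z := by
    intro z; rw [Walk.support_map, List.mem_map]; rfl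
  refine HSat.HS (v := f v) ⟨f a, f b, p.map f.toHom, ind_map f p hp, ?_, f.map_adj_iff.2 hva,
    f.map_adj_iff.2 hvb, fun e => hab (f.injective e), fun e => hnab (f.map_adj_iff.1 e), ?_, ?_⟩
  · intro h
    obtain ⟨t, ht, e⟩ := (hs _).1 h
    exact hv' (f.injective e ▸ ht)
  · intro z hz hxz
    obtain ⟨t, ht, rfl⟩ := (hs _).1 hz
    rcases hN t ht (f.map_adj_iff.1 hxz) with h | h
    · exact .inl (by rw [h])
    · exact .inr (by rw [h])
  · ext z
    simp only [Set.mem_image, Set.mem_ofPred_eq]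
    constructor
    · rintro ⟨t, rfl | ht, rfl⟩
      · exact .inl rfl
      · exact .inr ((hs _).2 ⟨t, ht, rfl⟩)
    · rintro (rfl | hz)
      · exact ⟨v, .inl rfl, rfl⟩
      · obtain ⟨t, ht, rfl⟩ := (hs _).1 hz
        exact ⟨t, .inr ht, rfl⟩

lemma NCset.comap {W : Type*} {H : SimpleGraph W} (f : H ↪g G) {C : Set V} (h : NCset G C) :
    NCset H (f ⁻¹' C) := by
  have himg : ∀ {S : Set W} {x : W}, f x ∈ f '' S → x ∈ S := by
    rintro S x ⟨y, hy, e⟩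
    exact f.injective e ▸ hy
  refine ⟨?_, ?_, ?_⟩
  · intro S hS
    obtain ⟨u, hu, s, hs, rfl⟩ := h.cover _ (hS.map f)
    exact ⟨s, hu, hs⟩
  · intro S hS u hu v hv hus hvs
    exact f.injective (h.uniq _ (hS.map f) (f u) hu (f v) hv ⟨u, hus, rfl⟩ ⟨v, hvs, rfl⟩)
  · intro u hu S1 S2 hS1 hS2 hu1 hu2 x y z hxz hx hy hz hx2 hy2 hz2 hxy hyz
    exact h.nc (f u) hu _ _ (hS1.map f) (hS2.map f) ⟨u, hu1, rfl⟩ (fun e => hu2 (himg e))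
      (f x) (f y) (f z) (fun e => hxz (f.injective e)) ⟨x, hx, rfl⟩ ⟨y, hy, rfl⟩ ⟨z, hz, rfl⟩
      ⟨x, hx2, rfl⟩ ⟨y, hy2, rfl⟩ ⟨z, hz2, rfl⟩ (f.map_adj_iff.2 hxy) (f.map_adj_iff.2 hyz)

open Classical in
lemma degenerate [Fintype V] {k : ℕ} (hk : 0 < k) {𝒦 : Fin k → Finset V}
    (hU : IsEdgeDisjointUnionOfKk G k 𝒦) {C : Set V} (hC : NCset G C) (S : Finset V)
    (hS : S.Nonempty) : ∃ v ∈ S, (S.filter (fun x => G.Adj v x)).card < k := by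
  by_contra hcon
  push Not at hcon
  obtain ⟨hcl, hdis, hcov, hedge⟩ := hU
  have two : ∀ x ∈ S, ∀ i, x ∈ 𝒦 i → ∃ j, j ≠ i ∧ x ∈ 𝒦 j := by
    intro x hx i hi
    by_contra hc
    push Not at hc
    have hsub : S.filter (fun y => G.Adj x y) ⊆ (𝒦 i).erase x := by
      intro y hy
      rw [Finset.mem_filter] at hy
      obtain ⟨j, hxj, hyj⟩ := hedge x y hy.2
      have hji : j = i := by
        by_contra hne
        exact hc j hne hxj
      rw [Finset.mem_erase]
      exact ⟨hy.2.ne', hji ▸ hyj⟩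
    have := Finset.card_le_card hsub
    rw [Finset.card_erase_of_mem hi, (hcl i).card_eq] at this
    have := hcon x hx
    omega
  have hne : Nonempty (S : Set V) := by
    obtain ⟨x, hx⟩ := hS
    exact ⟨⟨x, hx⟩⟩
  obtain ⟨v, u, hvu⟩ := deg (hC.comap (SimpleGraph.Embedding.induce (G := G) (S : Set V)))
  have hvS : (v : V) ∈ S := v.2
  set Q0 := (insert (v : V) (S.filter (fun x => G.Adj v x))).erase (u : V) with hQ0
  have hQ0S : Q0 ⊆ S := by
    intro x hx
    rw [hQ0, Finset.mem_erase, Finset.mem_insert, Finset.mem_filter] at hx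
    rcases hx with ⟨-, h | h⟩
    · rw [h]; exact hvS
    · exact h.1
  have hQ0c : k ≤ Q0.card := by
    have h1 : k + 1 ≤ (insert (v : V) (S.filter (fun x => G.Adj v x))).card := by
      rw [Finset.card_insert_of_notMem (by simp)]
      have := hcon v hvS
      omega
    have := Finset.pred_card_le_card_erase (a := (u : V)) (s := insert (v : V) (S.filter (fun x => G.Adj v x)))
    rw [← hQ0] at this
    omega
  have hQ0cl : ∀ x ∈ Q0, ∀ y ∈ Q0, x ≠ y → G.Adj x y := by
    intro x hx y hy hxy
    have hxS := hQ0S hx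
    have hyS := hQ0S hy
    rw [hQ0, Finset.mem_erase, Finset.mem_insert, Finset.mem_filter] at hx hy
    have := hvu ⟨x, hxS⟩ ⟨y, hyS⟩ (hx.2.imp (fun h => Subtype.ext h) (fun h => h.2))
      (hy.2.imp (fun h => Subtype.ext h) (fun h => h.2)) (fun e => hx.1 (congrArg Subtype.val e))
      (fun e => hy.1 (congrArg Subtype.val e)) (fun e => hxy (congrArg Subtype.val e))
    exact this
  obtain ⟨Q, hQ, hQk⟩ := Finset.exists_subset_card_eq hQ0c
  haveI : Nonempty (Fin k) := ⟨⟨0, hk⟩⟩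
  have hline : ∀ i, ∃ x ∈ Q, x ∉ 𝒦 i := by
    intro i
    by_contra hc
    push Not at hc
    have h2 : ∀ x ∈ Q, ∃ j, j ≠ i ∧ x ∈ 𝒦 j := fun x hx => two x (hQ0S (hQ hx)) i (hc x hx)
    choose! g hg using h2
    have hle : Q.card ≤ (Finset.univ.erase i).card := by
      refine Finset.card_le_card_of_injOn g (fun x hx => by simp [(hg x hx).1]) ?_
      intro x hx y hy hxy
      exact hdis (g x) i (hg x hx).1 x y (hg x hx).2 (by rw [hxy]; exact (hg y hy).2) (hc x hx) (hc y hy)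
    rw [hQk, Finset.card_erase_of_mem (Finset.mem_univ i), Finset.card_univ, Fintype.card_fin] at hle
    omega
  have hmeet := meet (P := Q) (L := Fin k) (fun x i => (x : V) ∈ 𝒦 i) (by simp [hQk])
    (fun i => by
      obtain ⟨x, hx, hxi⟩ := hline i
      exact ⟨⟨x, hx⟩, hxi⟩)
    (fun p q l m h1 h2 h3 h4 => by
      by_cases hlm : l = m
      · exact .inr hlm
      · exact .inl (Subtype.ext (hdis l m hlm p q h1 h2 h3 h4)))
    (fun p q hpq => hedge p q (hQ0cl p (hQ p.2) q (hQ q.2) (fun e => hpq (Subtype.ext e))))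
  have hSQ : S ⊆ Q := by
    intro x hx
    obtain ⟨i, hi⟩ := hcov x
    obtain ⟨j, hji, hj⟩ := two x hx i hi
    obtain ⟨p, hp1, hp2⟩ := hmeet j i hji
    rw [hdis j i hji x p hj hp1 hi hp2]
    exact p.2
  have hsub : S.filter (fun x => G.Adj v x) ⊆ Q.erase v := by
    intro y hy
    rw [Finset.mem_filter] at hy
    rw [Finset.mem_erase]
    exact ⟨hy.2.ne', hSQ hy.1⟩
  have h1 := Finset.card_le_card hsub
  rw [Finset.card_erase_of_mem (hSQ hvS), hQk] at h1
  have := hcon v hvS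
  omega

open Classical in
lemma greedy [Fintype V] {k : ℕ} (hk : 0 < k)
    (hd : ∀ S : Finset V, S.Nonempty → ∃ v ∈ S, (S.filter (fun x => G.Adj v x)).card < k) :
    DPColorable G k := by
  intro H hH
  obtain ⟨-, hH2, hH3⟩ := hH
  have main : ∀ S : Finset V, ∃ f : V → Fin k, ∀ u ∈ S, ∀ v ∈ S, ¬ H.Adj (u, f u) (v, f v) := by
    intro S
    induction S using Finset.strongInduction with
    | H S ih =>
    by_cases hS : S.Nonempty
    · obtain ⟨v, hv, hlt⟩ := hd S hS
      obtain ⟨f, hf⟩ := ih (S.erase v) (Finset.erase_ssubset hv)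
      set Fb := Finset.univ.filter (fun j : Fin k => ∃ u ∈ S.erase v, H.Adj (u, f u) (v, j)) with hFb
      have hFbm : ∀ j, j ∈ Fb ↔ ∃ u ∈ S.erase v, H.Adj (u, f u) (v, j) := by
        intro j; rw [hFb, Finset.mem_filter]; simp
      have hcard : Fb.card < k := by
        have h2 : ∀ j ∈ Fb, ∃ u, u ∈ S.erase v ∧ H.Adj (u, f u) (v, j) := fun j hj => (hFbm j).1 hj
        haveI : Nonempty V := ⟨v⟩
        choose! g hg using h2
        refine lt_of_le_of_lt (Finset.card_le_card_of_injOn g (t := S.filter (fun x => G.Adj v x)) ?_ ?_) hlt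
        · intro j hj
          obtain ⟨h1, h2⟩ := hg j hj
          rw [Finset.mem_erase] at h1
          rw [Finset.mem_coe, Finset.mem_filter]
          exact ⟨h1.2, (hH2 _ _ _ _ h1.1 h2).symm⟩
        · intro j hj j' hj' e
          obtain ⟨h1, h2⟩ := hg j hj
          obtain ⟨h1', h2'⟩ := hg j' hj'
          rw [← e] at h2'
          exact hH3 _ _ _ _ _ (Finset.mem_erase.1 h1).1 h2 h2'
      have : ∃ j, j ∉ Fb := by
        by_contra hc
        push Not at hc
        have : Fb = Finset.univ := Finset.eq_univ_iff_forall.2 hc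
        rw [this] at hcard
        simp at hcard
      obtain ⟨j, hj⟩ := this
      have hj' : ∀ u ∈ S, u ≠ v → ¬ H.Adj (u, f u) (v, j) := by
        intro u hu huv h
        exact hj ((hFbm j).2 ⟨u, Finset.mem_erase.2 ⟨huv, hu⟩, h⟩)
      refine ⟨Function.update f v j, fun x hx y hy h => ?_⟩
      by_cases hxv : x = v
      · by_cases hyv : y = v
        · rw [hxv, hyv] at h
          exact H.irrefl h
        · rw [hxv, Function.update_self, Function.update_of_ne hyv] at h
          exact hj' y hy hyv h.symm
      · by_cases hyv : y = v
        · rw [hyv, Function.update_self, Function.update_of_ne hxv] at h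
          exact hj' x hx hxv h
        · rw [Function.update_of_ne hxv, Function.update_of_ne hyv] at h
          exact hf x (Finset.mem_erase.2 ⟨hxv, hx⟩) y (Finset.mem_erase.2 ⟨hyv, hy⟩) h
    · rw [Finset.not_nonempty_iff_eq_empty] at hS
      subst hS
      exact ⟨fun _ => ⟨0, hk⟩, by simp⟩
  obtain ⟨f, hf⟩ := main Finset.univ
  exact ⟨f, fun u v => hf u (by simp) v (by simp)⟩

lemma lower {k m : ℕ} {K : Finset V} (hK : G.IsNClique k K) (h : DPColorable G m) : k ≤ m := by
  let H : SimpleGraph (V × Fin m) :=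
    { Adj := fun a b => (a.1 = b.1 ∧ a.2 ≠ b.2) ∨ (G.Adj a.1 b.1 ∧ a.2 = b.2)
      symm := ⟨by
        rintro a b (⟨h1, h2⟩ | ⟨h1, h2⟩)
        · exact .inl ⟨h1.symm, h2.symm⟩
        · exact .inr ⟨h1.symm, h2.symm⟩⟩
      loopless := ⟨by
        rintro a (⟨h1, h2⟩ | ⟨h1, h2⟩)
        · exact h2 rfl
        · exact G.irrefl h1⟩ }
  have hH : IsDPCover G m H := by
    refine ⟨fun v i j hij => .inl ⟨rfl, hij⟩, ?_, ?_⟩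
    · rintro u v i j huv (⟨h1, h2⟩ | ⟨h1, h2⟩)
      · exact absurd h1 huv
      · exact h1
    · rintro u v i j j' huv (⟨h1, h2⟩ | ⟨h1, h2⟩) (⟨h3, h4⟩ | ⟨h3, h4⟩)
      · exact absurd h1 huv
      · exact absurd h1 huv
      · exact absurd h3 huv
      · exact h2.symm.trans h4
  obtain ⟨f, hf⟩ := h H hH
  have hle : K.card ≤ (Finset.univ : Finset (Fin m)).card := by
    refine Finset.card_le_card_of_injOn f (fun _ _ => by simp) ?_
    intro x hx y hy hxy
    by_contra hne
    exact hf x y (.inr ⟨hK.isClique hx hy hne, hxy⟩)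
  rw [hK.card_eq] at hle
  simpa using hle

end NCP

/-- if `G` satisfies the NC property and is the union of `k`
edge-disjoint copies of `K_k`, then `χ_DP(G) = k`. -/
theorem stmt13 {V : Type*} [Fintype V] [DecidableEq V] (G : SimpleGraph V)
    (k : ℕ) (hk : 0 < k) (𝒦 : Fin k → Finset V)
    (hU : IsEdgeDisjointUnionOfKk G k 𝒦) (hNC : HasNCProperty G) :
    dpChromaticNumber G = k := by
  obtain ⟨C, hC⟩ := NCP.ncset_of hNC
  have h1 : DPColorable G k := NCP.greedy hk (fun S hS => NCP.degenerate hk hU hC S hS)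
  exact le_antisymm (Nat.sInf_le h1)
    (le_csInf ⟨k, h1⟩ (fun m hm => NCP.lower (hU.1 ⟨0, hk⟩) hm))
end

section
/- Let G be a finite simple graph, let (C_1, …, C_ℓ) be a local chordalization partition of a hole cover C of G, and let G* be the last graph of the corresponding chordalization chain. Then G* is a minimal chordal completion of G: G* is a chordal spanning supergraph of G, and no spanning supergraph of G that is a proper subgraph of G* is chordal. -/
open SimpleGraph

variable {V : Type*}

namespace LC

theorem reach_seg (G : SimpleGraph V) (S : Set V) (f : ℕ → V) (i j : ℕ) (hij : i ≤ j)
    (hS : ∀ m, i ≤ m → m ≤ j → f m ∈ S) (hadj : ∀ m, i ≤ m → m < j → G.Adj (f m) (f (m+1))) :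
    (removeVerts G Sᶜ).Reachable (f i) (f j) := by
  induction j, hij using Nat.le_induction with
  | base => exact Reachable.refl _
  | succ j hij ih =>
    refine (ih (fun m h1 h2 => hS m h1 (by omega)) (fun m h1 h2 => hadj m h1 (by omega))).trans ?_
    apply Adj.reachable
    exact ⟨hadj j hij (by omega), by simpa using hS j hij (by omega), by simpa using hS (j+1) (by omega) (by omega)⟩

theorem removeVerts_le (G : SimpleGraph V) (A : Set V) : removeVerts G A ≤ G := fun _ _ h => h.1

theorem reach_mono {G : SimpleGraph V} {S T : Set V} (h : S ⊆ T) {a b : V}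
    (hr : (removeVerts G Sᶜ).Reachable a b) : (removeVerts G Tᶜ).Reachable a b := by
  refine hr.mono ?_
  intro x y hxy
  exact ⟨hxy.1, by have := hxy.2.1; simp at this ⊢; exact h this,
    by have := hxy.2.2; simp at this ⊢; exact h this⟩

theorem walk_supp {G : SimpleGraph V} {T : Set V} {a b : V} (w : (removeVerts G Tᶜ).Walk a b)
    (ha : a ∈ T) : ∀ v ∈ w.support, v ∈ T := by
  induction w with
  | nil => simpa using ha
  | cons h p ih =>
    intro v hv
    rcases List.mem_cons.1 hv with rfl | hv
    · exact ha
    · exact ih (by simpa using h.2.2) v hv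

/-- Construct a hole through a center vertex `u`. -/
theorem hole_of_center (G : SimpleGraph V) (u p q : V) (T : Set V) (huT : u ∉ T) (hpT : p ∈ T)
    (hup : G.Adj u p) (huq : G.Adj u q) (hpq : p ≠ q) (hnpq : ¬ G.Adj p q)
    (hT : ∀ v ∈ T, G.Adj u v → v = p ∨ v = q)
    (hr : (removeVerts G Tᶜ).Reachable p q) :
    ∃ (π : G.Walk p q) (w : G.Walk u u), IsHole G w ∧
      (∀ v, v ∈ w.support ↔ v = u ∨ v ∈ π.support) ∧ ∀ v ∈ π.support, v ∈ T := by
  obtain ⟨π₀, hπ₀⟩ := hr.exists_walk_length_eq_dist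
  have hpath₀ := π₀.isPath_of_length_eq_dist hπ₀
  have hind : ∀ i j, i < j → j ≤ π₀.length →
      (removeVerts G Tᶜ).Adj (π₀.getVert i) (π₀.getVert j) → j = i + 1 := by
    intro i j hij hj hadj
    have := dist_le (((π₀.take i).concat hadj).append (π₀.drop j))
    simp only [Walk.length_append, Walk.length_concat, Walk.take_length, Walk.drop_length] at this
    omega
  have hsT := walk_supp π₀ hpT
  have huπ₀ : u ∉ π₀.support := fun h => huT (hsT u h)
  let π : G.Walk p q := π₀.mapLe (removeVerts_le G Tᶜ)
  have hsupp : π.support = π₀.support := by simp [π]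
  have hlen : π.length = π₀.length := by simp [π]
  have hedges : π.edges = π₀.edges := by simp [π]
  have hpath : π.IsPath := by simpa [π] using hpath₀
  have huπ : u ∉ π.support := by rw [hsupp]; exact huπ₀
  have hlen2 : 2 ≤ π₀.length := by
    by_contra hlt
    have h0 : π₀.length = 0 ∨ π₀.length = 1 := by omega
    rcases h0 with h0 | h0
    · exact hpq (Walk.eq_of_length_eq_zero h0)
    · exact hnpq (Walk.adj_of_length_eq_one h0).1
  refine ⟨π, Walk.cons hup (π.concat huq.symm), ⟨?_, ?_, ?_⟩, ?_, ?_⟩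
  · rw [Walk.cons_isCycle_iff]
    refine ⟨(Walk.concat_isPath_iff _).2 ⟨hpath, huπ⟩, ?_⟩
    rw [Walk.edges_concat]
    intro h
    simp only [List.concat_eq_append, List.mem_append, List.mem_singleton] at h
    rcases h with h | h
    · exact huπ (Walk.fst_mem_support_of_mem_edges _ h)
    · have := Sym2.eq_iff.1 h
      rcases this with ⟨h1, h2⟩ | ⟨h1, h2⟩
      · exact huq.ne h1
      · exact hpq h2
  · simp only [Walk.length_cons, Walk.length_concat, hlen]; omega
  · have key : ∀ x ∈ π.support, ∀ y ∈ π.support, G.Adj x y → s(x, y) ∈ π.edges := by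
      intro x hx y hy hxy
      rw [hsupp] at hx hy
      have hadj : (removeVerts G Tᶜ).Adj x y :=
        ⟨hxy, by simpa using hsT x hx, by simpa using hsT y hy⟩
      rw [hedges]
      obtain ⟨i, rfl, hi⟩ := Walk.mem_support_iff_exists_getVert.1 hx
      obtain ⟨j, rfl, hj⟩ := Walk.mem_support_iff_exists_getVert.1 hy
      rcases lt_trichotomy i j with h | h | h
      · have := hind i j h hj hadj
        subst this
        exact (Walk.mk_mem_edges_iff_exists _).2 ⟨i, by omega, rfl⟩
      · subst h; exact absurd hxy (G.loopless.irrefl _)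
      · have := hind j i h hi hadj.symm
        subst this
        exact (Walk.mk_mem_edges_iff_exists _).2 ⟨j, by omega, Sym2.eq_swap⟩
    have keyu : ∀ y ∈ π.support, G.Adj u y →
        s(u, y) ∈ (Walk.cons hup (π.concat huq.symm)).edges := by
      intro y hy huy
      rcases hT y (hsT y (hsupp ▸ hy)) huy with rfl | rfl
      · simp
      · simp [Walk.edges_concat, Sym2.eq_swap]
    intro x y hx hy hxy
    have hm : ∀ v, v ∈ (Walk.cons hup (π.concat huq.symm)).support → v = u ∨ v ∈ π.support := by
      intro v hv
      simp [Walk.support_concat] at hv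
      tauto
    rcases hm x hx with rfl | hx' <;> rcases hm y hy with rfl | hy'
    · exact absurd hxy (G.loopless.irrefl _)
    · exact keyu y hy' hxy
    · rw [Sym2.eq_swap]; exact keyu x hx' hxy.symm
    · have := key x hx' y hy' hxy
      simp [Walk.edges_concat, this]
  · intro v
    simp [Walk.support_concat]
    tauto
  · intro v hv
    exact hsT v (hsupp ▸ hv)

/-- Nat-indexed description of a hole starting at `u`. -/
theorem hole_fun {G : SimpleGraph V} {a u : V} {w : G.Walk a a} (hw : IsHole G w)
    (hu : u ∈ w.support) :
    ∃ (n : ℕ) (f : ℕ → V), 4 ≤ n ∧ f 0 = u ∧ f n = u ∧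
      (∀ i j, i < n → j < n → f i = f j → i = j) ∧
      (∀ i, i < n → G.Adj (f i) (f (i+1))) ∧
      (∀ i j, i < j → j < n → G.Adj (f i) (f j) → j = i + 1 ∨ (i = 0 ∧ j = n - 1)) ∧
      ∀ v, v ∈ w.support ↔ ∃ i, i < n ∧ f i = v := by
  classical
  obtain ⟨hc, hl, hch⟩ := hw
  let w' := w.rotate u hu
  have hc' : w'.IsCycle := (Walk.isCycle_rotate hu).2 hc
  have hl' : w'.length = w.length := Walk.length_rotate w u hu
  have hmem : ∀ v, v ∈ w'.support ↔ v ∈ w.support := fun v => Walk.mem_support_rotate_iff w u hu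
  have hed : ∀ e, e ∈ w'.edges ↔ e ∈ w.edges := fun e => (Walk.rotate_edges w u hu).mem_iff
  have hinj : ∀ i j, i < w'.length → j < w'.length → w'.getVert i = w'.getVert j → i = j := by
    intro i j hi hj h
    exact hc'.getVert_injOn' (by simp; omega) (by simp; omega) h
  have hwrap : ∀ i, i ≤ w'.length → ∃ j, j < w'.length ∧ w'.getVert j = w'.getVert i ∧ (j = i ∨ (j = 0 ∧ i = w'.length)) := by
    intro i hi
    rcases hi.lt_or_eq with h | h
    · exact ⟨i, h, rfl, Or.inl rfl⟩
    · exact ⟨0, by omega, by rw [h]; simp, Or.inr ⟨rfl, h⟩⟩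
  refine ⟨w'.length, w'.getVert, by omega, by simp, by simp, hinj, ?_, ?_, ?_⟩
  · intro i hi; exact w'.adj_getVert_succ hi
  · intro i j hij hj hadj
    have he : s(w'.getVert i, w'.getVert j) ∈ w'.edges :=
      (hed _).2 (hch _ _ ((hmem _).1 (w'.getVert_mem_support i))
        ((hmem _).1 (w'.getVert_mem_support j)) hadj)
    obtain ⟨m, hm, h⟩ := (Walk.mk_mem_edges_iff_exists _).1 he
    obtain ⟨m', hm', hmm', hc⟩ := hwrap (m+1) (by omega)
    rw [← hmm'] at h
    rcases Sym2.eq_iff.1 h with ⟨h1, h2⟩ | ⟨h1, h2⟩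
    · have e1 := hinj _ _ (by omega) (by omega) h1
      have e2 := hinj _ _ (by omega) (by omega) h2
      omega
    · have e1 := hinj _ _ (by omega) (by omega) h1
      have e2 := hinj _ _ (by omega) (by omega) h2
      omega
  · intro v
    rw [← hmem]
    constructor
    · intro hv
      obtain ⟨i, rfl, hi⟩ := Walk.mem_support_iff_exists_getVert.1 hv
      obtain ⟨j, hj, e, -⟩ := hwrap i hi
      exact ⟨j, hj, e⟩
    · rintro ⟨i, hi, rfl⟩
      exact w'.getVert_mem_support i

/-- vertices reachable from `y` avoiding `u` and the closed neighbourhood of `x` -/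
def farComp (G : SimpleGraph V) (u x y : V) : Set V :=
  {v | (removeVerts G {v | v = u ∨ v = x ∨ G.Adj x v}).Reachable y v}

theorem farComp_avoid {G : SimpleGraph V} {u x y : V} (hyu : y ≠ u) (hyx : y ≠ x)
    (hxy : ¬ G.Adj x y) {v : V} (hv : v ∈ farComp G u x y) :
    v ≠ u ∧ v ≠ x ∧ ¬ G.Adj x v := by
  have hv' : (removeVerts G ({v | v ≠ u ∧ v ≠ x ∧ ¬ G.Adj x v}ᶜ)).Reachable y v := by
    refine Reachable.mono ?_ hv
    intro a b hab
    obtain ⟨h1, h2, h3⟩ := hab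
    refine ⟨h1, ?_, ?_⟩ <;> simp at h2 h3 ⊢ <;> tauto
  obtain ⟨w⟩ := hv'
  exact walk_supp w ⟨hyu, hyx, hxy⟩ v w.end_mem_support

theorem side_lemma {G : SimpleGraph V} {u x y : V} (hNC : VertexNC G u)
    (hxu : x ≠ u) (hyu : y ≠ u) (hyx : y ≠ x) (hxy : ¬ G.Adj x y)
    (hx : G.Adj u x ∨ ∃ (a : V) (w : G.Walk a a), IsHole G w ∧ u ∈ w.support ∧ x ∈ w.support) :
    ∃ (A : Set V) (p : V), p ∈ insert x A ∧ G.Adj u p ∧ u ∉ A ∧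
      (∀ v ∈ insert x A, G.Adj u v → v = p) ∧
      (∀ v ∈ insert x A, (removeVerts G (insert x A)ᶜ).Reachable x v) ∧
      (∀ v ∈ A, ∀ y' ∈ farComp G u x y, v ≠ y' ∧ ¬ G.Adj v y') := by
  by_cases hux : G.Adj u x
  · refine ⟨∅, x, by simp, hux, by simp, by simp, ?_, by simp⟩
    intro v hv
    simp at hv
    subst hv
    exact Reachable.refl _
  obtain ⟨a, w, hw, huw, hxw⟩ := hx.resolve_left hux
  obtain ⟨n, f, hn, hf0, hfn, hinj, hadj, hch, hsup⟩ := hole_fun hw huw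
  obtain ⟨s, hs, rfl⟩ := (hsup x).1 hxw
  have hs0 : s ≠ 0 := by rintro rfl; exact hxu hf0
  have hs1 : s ≠ 1 := by
    rintro rfl
    exact hux (hf0 ▸ hadj 0 (by omega))
  have hsn : s ≠ n - 1 := by
    rintro rfl
    have := hadj (n-1) (by omega)
    rw [show n - 1 + 1 = n by omega, hfn] at this
    exact hux this.symm
  have hne : ∀ i, 0 < i → i < n → f i ≠ u := by
    intro i hi hi' h
    have := hinj i 0 hi' (by omega) (h.trans hf0.symm)
    omega
  have hua : ∀ i, 0 < i → i < n → G.Adj u (f i) → i = 1 ∨ i = n - 1 := by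
    intro i hi hi' h
    rw [← hf0] at h
    have := hch 0 i hi hi' h
    omega
  have hsa : ∀ i, 0 < i → i < n → G.Adj (f s) (f i) → i = s - 1 ∨ i = s + 1 := by
    intro i hi hi' h
    rcases lt_trichotomy i s with h' | h' | h'
    · have := hch i s h' hs h.symm
      omega
    · subst h'; exact absurd h (G.loopless.irrefl _)
    · have := hch s i h' hi' h
      omega
  by_cases h1 : ∀ i, 0 < i → i < s → ∀ y' ∈ farComp G u (f s) y, f i ≠ y' ∧ ¬ G.Adj (f i) y'
  · refine ⟨{v | ∃ i, 0 < i ∧ i < s ∧ f i = v}, f 1, ?_, ?_, ?_, ?_, ?_, ?_⟩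
    · exact Or.inr ⟨1, by omega, by omega, rfl⟩
    · exact hf0 ▸ hadj 0 (by omega)
    · rintro ⟨i, hi, hi', h⟩
      exact hne i hi (by omega) h
    · rintro v (rfl | ⟨i, hi, hi', rfl⟩) h
      · exact absurd h hux
      · have := hua i hi (by omega) h
        have : i = 1 := by omega
        rw [this]
    · have : ∀ i, 0 < i → i ≤ s → (removeVerts G (insert (f s) {v | ∃ i, 0 < i ∧ i < s ∧ f i = v})ᶜ).Reachable (f s) (f i) := by
        intro i hi hi'
        refine (reach_seg G _ f i s hi' ?_ ?_).symm
        · intro m hm hm'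
          rcases hm'.lt_or_eq with h | h
          · exact Or.inr ⟨m, by omega, h, rfl⟩
          · exact Or.inl (by rw [h])
        · intro m hm hm'
          exact hadj m (by omega)
      rintro v (rfl | ⟨i, hi, hi', rfl⟩)
      · exact Reachable.refl _
      · exact this i hi hi'.le
    · rintro v ⟨i, hi, hi', rfl⟩
      exact h1 i hi hi'
  by_cases h2 : ∀ i, s < i → i < n → ∀ y' ∈ farComp G u (f s) y, f i ≠ y' ∧ ¬ G.Adj (f i) y'
  · refine ⟨{v | ∃ i, s < i ∧ i < n ∧ f i = v}, f (n-1), ?_, ?_, ?_, ?_, ?_, ?_⟩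
    · exact Or.inr ⟨n-1, by omega, by omega, rfl⟩
    · have := hadj (n-1) (by omega)
      rw [show n - 1 + 1 = n by omega, hfn] at this
      exact this.symm
    · rintro ⟨i, hi, hi', h⟩
      exact hne i (by omega) (by omega) h
    · rintro v (rfl | ⟨i, hi, hi', rfl⟩) h
      · exact absurd h hux
      · have := hua i (by omega) (by omega) h
        have : i = n - 1 := by omega
        rw [this]
    · rintro v (rfl | ⟨i, hi, hi', rfl⟩)
      · exact Reachable.refl _
      · refine (reach_seg G _ f s i hi.le ?_ ?_)
        · intro m hm hm'
          rcases hm.lt_or_eq with h | h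
          · exact Or.inr ⟨m, by omega, by omega, rfl⟩
          · exact Or.inl (by rw [h])
        · intro m hm hm'
          exact hadj m (by omega)
    · rintro v ⟨i, hi, hi', rfl⟩
      exact h2 i hi hi'
  exfalso
  push Not at h1 h2
  obtain ⟨i, hi, hi', y1, hy1, h1⟩ := h1
  obtain ⟨j, hj, hj', y2, hy2, h2⟩ := h2
  let T : Set V := {v | v ≠ u ∧ v ≠ f s ∧ (G.Adj (f s) v → v = f (s-1) ∨ v = f (s+1))}
  have hYT : ∀ v ∈ farComp G u (f s) y, v ∈ T := by
    intro v hv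
    obtain ⟨a1, a2, a3⟩ := farComp_avoid hyu hyx hxy hv
    exact ⟨a1, a2, fun h => absurd h a3⟩
  have hfT : ∀ m, 0 < m → m < n → m ≠ s → f m ∈ T := by
    intro m hm hm' hms
    refine ⟨hne m hm hm', fun h => hms (hinj _ _ hm' hs h), fun h => ?_⟩
    rcases hsa m hm hm' h with h | h <;> simp [h]
  have hstep : ∀ v ∈ T, ∀ v' ∈ T, (v ≠ v' → G.Adj v v') → (removeVerts G Tᶜ).Reachable v v' := by
    intro v hv v' hv' h
    by_cases e : v = v'
    · subst e; exact Reachable.refl _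
    · exact Adj.reachable ⟨h e, by simpa using hv, by simpa using hv'⟩
  have r1 : (removeVerts G Tᶜ).Reachable (f (s-1)) (f i) :=
    (reach_seg G T f i (s-1) (by omega) (fun m _ _ => hfT m (by omega) (by omega) (by omega))
      (fun m _ _ => hadj m (by omega))).symm
  have r2 := hstep _ (hfT i hi (by omega) (by omega)) _ (hYT _ hy1) h1
  have r3 : (removeVerts G Tᶜ).Reachable y1 y2 := by
    have : (removeVerts G {v | v = u ∨ v = f s ∨ G.Adj (f s) v}).Reachable y1 y2 :=
      (show (removeVerts G {v | v = u ∨ v = f s ∨ G.Adj (f s) v}).Reachable y y1 from hy1).symm.trans hy2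
    refine this.mono ?_
    intro a b hab
    obtain ⟨h1, h2, h3⟩ := hab
    refine ⟨h1, ?_, ?_⟩ <;> simp [T] at h2 h3 ⊢ <;> tauto
  have r4 := (hstep _ (hfT j (by omega) (by omega) (by omega)) _ (hYT _ hy2) h2).symm
  have r5 : (removeVerts G Tᶜ).Reachable (f j) (f (s+1)) :=
    (reach_seg G T f (s+1) j (by omega) (fun m _ _ => hfT m (by omega) (by omega) (by omega))
      (fun m _ _ => hadj m (by omega))).symm
  have hsm : G.Adj (f (s-1)) (f s) := by
    have := hadj (s-1) (by omega)
    rwa [show s - 1 + 1 = s by omega] at this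
  have hsp : G.Adj (f s) (f (s+1)) := hadj s hs
  have hnepq : f (s-1) ≠ f (s+1) := fun h => by
    have := hinj _ _ (by omega) (by omega) h
    omega
  obtain ⟨π, w2, hw2, hw2s, hπT⟩ := hole_of_center G (f s) (f (s-1)) (f (s+1)) T
    (fun h => h.2.1 rfl) (hfT _ (by omega) (by omega) (by omega)) hsm.symm hsp hnepq
    (fun h => by have := hch _ _ (by omega) (by omega) h; omega)
    (fun v hv h => hv.2.2 h) ((((r1.trans r2).trans r3).trans r4).trans r5)
  refine hNC _ _ w w2 hw hw2 huw ?_ ⟨f (s-1), f s, f (s+1), hnepq, ?_, ?_, ?_, ?_⟩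
  · intro h
    rcases (hw2s u).1 h with h | h
    · exact hxu h.symm
    · exact (hπT u h).1 rfl
  · exact hw.2.2 _ _ ((hsup _).2 ⟨s-1, by omega, rfl⟩) hxw hsm
  · exact hw.2.2 _ _ hxw ((hsup _).2 ⟨s+1, by omega, rfl⟩) hsp
  · exact hw2.2.2 _ _ ((hw2s _).2 (Or.inr π.start_mem_support)) ((hw2s _).2 (Or.inl rfl)) hsm
  · exact hw2.2.2 _ _ ((hw2s _).2 (Or.inl rfl)) ((hw2s _).2 (Or.inr π.end_mem_support)) hsp

theorem walk_meets {G : SimpleGraph V} {P K Q : Set V} {a b : V} (w : G.Walk a b)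
    (hPQ : ∀ x ∈ P, ∀ y ∈ Q, ¬ G.Adj x y) (hd : ∀ x ∈ P, x ∉ Q)
    (hs : ∀ v ∈ w.support, v ∈ P ∨ v ∈ K ∨ v ∈ Q) (ha : a ∈ P) (hb : b ∈ Q) :
    ∃ v ∈ w.support, v ∈ K := by
  induction w with
  | nil => exact absurd hb (hd _ ha)
  | @cons a c b h p ih =>
    rcases hs c (by simp) with hc | hc | hc
    · obtain ⟨v, hv, hvK⟩ := ih (fun v hv => hs v (by simp [hv])) hc hb
      exact ⟨v, by simp [hv], hvK⟩
    · exact ⟨c, by simp, hc⟩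
    · exact absurd h (hPQ _ ha _ hc)

theorem lc_adj {G : SimpleGraph V} {u x y : V} (h : (localChordalize G u).Adj x y) :
    G.Adj x y ∨ x = u ∨ y = u := by
  simp only [localChordalize, sup_adj, fromRel_adj] at h
  tauto

theorem lc_adj_u {G : SimpleGraph V} {u y : V} : (localChordalize G u).Adj u y ↔
    G.Adj u y ∨ (u ≠ y ∧ ∃ (a : V) (w : G.Walk a a), IsHole G w ∧ u ∈ w.support ∧ y ∈ w.support) := by
  simp only [localChordalize, sup_adj, fromRel_adj]
  constructor
  · rintro (h | ⟨h, ⟨-, h2⟩ | ⟨h3, h2⟩⟩)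
    · exact Or.inl h
    · exact Or.inr ⟨h, h2⟩
    · exact absurd h3.symm h
  · rintro (h | ⟨h, h2⟩)
    · exact Or.inl h
    · exact Or.inr ⟨h, Or.inl ⟨by trivial, h2⟩⟩

/-- After locally chordalizing by an NC vertex `u`, no hole goes through `u`. -/
theorem no_hole_through {G : SimpleGraph V} {u : V} (hNC : VertexNC G u) (a : V)
    (z : (localChordalize G u).Walk a a) (hz : IsHole _ z) : u ∉ z.support := by
  intro huz
  obtain ⟨n, f, hn, hf0, hfn, hinj, hadj, hch, hsup⟩ := hole_fun hz huz
  have hne : ∀ i, 0 < i → i < n → f i ≠ u := by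
    intro i hi hi' h
    have := hinj i 0 hi' (by omega) (h.trans hf0.symm)
    omega
  have hG : ∀ i, 0 < i → i + 1 < n → G.Adj (f i) (f (i+1)) := by
    intro i hi hi'
    rcases lc_adj (hadj i (by omega)) with h | h | h
    · exact h
    · exact absurd h (hne _ hi (by omega))
    · exact absurd h (hne _ (by omega) (by omega))
  have hux : (localChordalize G u).Adj u (f 1) := hf0 ▸ hadj 0 (by omega)
  have huy : (localChordalize G u).Adj u (f (n-1)) := by
    have := hadj (n-1) (by omega)
    rw [show n - 1 + 1 = n by omega, hfn] at this
    exact this.symm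
  have hxy : ¬ G.Adj (f 1) (f (n-1)) := by
    intro h
    have := hch 1 (n-1) (by omega) (by omega) (Or.inl h)
    omega
  have hyx : f (n-1) ≠ f 1 := fun h => by
    have := hinj _ _ (by omega) (by omega) h
    omega
  have hxu := hne 1 (by omega) (by omega)
  have hyu := hne (n-1) (by omega) (by omega)
  generalize hxd : f 1 = x at *
  generalize hyd : f (n-1) = y at *
  obtain ⟨A, p, hpA, hup, huA, hAu, hAr, hAY⟩ := side_lemma (y := y) hNC hxu hyu hyx hxy
    ((lc_adj_u.1 hux).imp id (fun h => h.2))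
  obtain ⟨B, q, hqB, huq, huB, hBu, hBr, hBX⟩ := side_lemma (y := x) hNC hyu hxu hyx.symm
    (fun h => hxy h.symm) ((lc_adj_u.1 huy).imp id (fun h => h.2))
  have hxX : x ∈ farComp G u y x := Reachable.refl _
  have hBavoid : ∀ b ∈ insert y B, b ≠ u ∧ b ≠ x ∧ ¬ G.Adj x b := by
    rintro b (rfl | hb)
    · exact ⟨hyu, hyx, hxy⟩
    · exact ⟨fun h => huB (h ▸ hb), (hBX b hb x hxX).1, fun h => (hBX b hb x hxX).2 h.symm⟩
  have hBY : ∀ b ∈ insert y B, b ∈ farComp G u x y := by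
    intro b hb
    refine Reachable.mono ?_ (hBr b hb)
    intro c d hcd
    obtain ⟨h1, h2, h3⟩ := hcd
    have hc := hBavoid c (not_not.1 h2)
    have hd := hBavoid d (not_not.1 h3)
    refine ⟨h1, ?_, ?_⟩ <;> simp <;> tauto
  have hAB : ∀ v ∈ insert x A, ∀ b ∈ insert y B, v ≠ b ∧ ¬ G.Adj v b := by
    rintro v (rfl | hv) b hb
    · exact ⟨fun h => (hBavoid b hb).2.1 h.symm, (hBavoid b hb).2.2⟩
    · exact hAY v hv b (hBY b hb)
  let K : Set V := {v | ∃ i, 2 ≤ i ∧ i ≤ n - 2 ∧ f i = v}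
  have hKn : ∀ k ∈ K, k ≠ u ∧ ¬ (localChordalize G u).Adj u k := by
    rintro k ⟨i, hi, hi', rfl⟩
    refine ⟨hne i (by omega) (by omega), fun h => ?_⟩
    have := hch 0 i (by omega) (by omega) (by rw [hf0]; exact h)
    omega
  let T : Set V := {v | v ∈ insert x A ∨ v ∈ K ∨ v ∈ insert y B}
  have hAT : insert x A ⊆ T := fun v hv => Or.inl hv
  have hBT : insert y B ⊆ T := fun v hv => Or.inr (Or.inr hv)
  have r1 := reach_mono hAT (hAr p hpA)
  have r3 := reach_mono hBT (hBr q hqB)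
  have r2 : (removeVerts G Tᶜ).Reachable x y := by
    have := reach_seg G T f 1 (n-1) (by omega) (fun m hm hm' => ?_) (fun m hm hm' => hG m (by omega) (by omega))
    · rwa [hxd, hyd] at this
    · by_cases e1 : m = 1
      · left; left; rw [e1, hxd]
      by_cases e2 : m = n - 1
      · right; right; left; rw [e2, hyd]
      exact Or.inr (Or.inl ⟨m, by omega, by omega, rfl⟩)
  have huT : u ∉ T := by
    rintro (h | h | h)
    · rcases h with h | h
      · exact hxu h.symm
      · exact huA h
    · exact (hKn u h).1 rfl
    · exact (hBavoid u h).1 rfl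
  obtain ⟨π, w, hw, hws, hπT⟩ := hole_of_center G u p q T huT (hAT hpA) hup huq
    (hAB p hpA q hqB).1 (hAB p hpA q hqB).2
    (by
      rintro v (h | h | h) huv
      · exact Or.inl (hAu v h huv)
      · exact absurd (Or.inl huv) (hKn v h).2
      · exact Or.inr (hBu v h huv))
    ((r1.symm.trans r2).trans r3)
  obtain ⟨k, hk, hkK⟩ := walk_meets (P := insert x A) (K := K) (Q := insert y B) π
    (fun v hv b hb => (hAB v hv b hb).2) (fun v hv hv' => (hAB v hv v hv').1 rfl) hπT hpA hqB
  exact (hKn k hkK).2 (lc_adj_u.2 (Or.inr ⟨(hKn k hkK).1.symm, _, w, hw, (hws u).2 (Or.inl rfl), (hws k).2 (Or.inr hk)⟩))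

theorem hole_transfer {G H : SimpleGraph V} {a : V} (z : H.Walk a a) (hz : IsHole H z)
    (h1 : ∀ x y, x ∈ z.support → y ∈ z.support → (H.Adj x y ↔ G.Adj x y)) :
    ∃ w : G.Walk a a, IsHole G w ∧ w.support = z.support ∧ w.edges = z.edges := by
  have he : ∀ e ∈ z.edges, e ∈ G.edgeSet := by
    intro e
    induction e with
    | _ x y =>
      intro h
      exact (h1 x y (z.fst_mem_support_of_mem_edges h) (z.snd_mem_support_of_mem_edges h)).1
        (z.adj_of_mem_edges h)
  refine ⟨z.transfer G he, ⟨hz.1.transfer he, by simpa using hz.2.1, ?_⟩, by simp, by simp⟩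
  intro x y hx hy hxy
  simp only [Walk.support_transfer, Walk.edges_transfer] at hx hy ⊢
  exact hz.2.2 x y hx hy ((h1 x y hx hy).2 hxy)

theorem lc_hole {G : SimpleGraph V} {u : V} (hNC : VertexNC G u) {a : V}
    (z : (localChordalize G u).Walk a a) (hz : IsHole _ z) :
    ∃ w : G.Walk a a, IsHole G w ∧ w.support = z.support ∧ w.edges = z.edges := by
  have hu := no_hole_through hNC a z hz
  refine hole_transfer z hz ?_
  intro x y hx hy
  constructor
  · intro h
    rcases lc_adj h with h | rfl | rfl
    · exact h
    · exact absurd hx hu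
    · exact absurd hy hu
  · exact fun h => Or.inl h

theorem lc_setNC {G : SimpleGraph V} {u : V} {l : List V} (h : SetNC G {v | v ∈ u :: l}) :
    SetNC (localChordalize G u) {v | v ∈ l} := by
  have hNC : VertexNC G u := h.1 u (by simp)
  constructor
  · intro v hv a b w₁ w₂ hw₁ hw₂ hv1 hv2
    obtain ⟨z₁, hz₁, s1, e1⟩ := lc_hole hNC w₁ hw₁
    obtain ⟨z₂, hz₂, s2, e2⟩ := lc_hole hNC w₂ hw₂
    rw [← e1, ← e2]
    rw [← s1] at hv1
    rw [← s2] at hv2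
    exact h.1 v (List.mem_cons_of_mem _ hv) a b z₁ z₂ hz₁ hz₂ hv1 hv2
  · intro a w hw v hv v' hv' h1 h2
    obtain ⟨z, hz, s1, -⟩ := lc_hole hNC w hw
    rw [← s1] at h1 h2
    exact h.2 a z hz v (List.mem_cons_of_mem _ hv) v' (List.mem_cons_of_mem _ hv') h1 h2

theorem le_cl (l : List V) : ∀ G : SimpleGraph V, G ≤ chordalizeList G l := by
  induction l with
  | nil => exact fun G => le_refl _
  | cons u l ih => exact fun G => le_trans le_sup_left (ih (localChordalize G u))

theorem cl_adj (l : List V) : ∀ (G : SimpleGraph V) (x y : V), (chordalizeList G l).Adj x y →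
    G.Adj x y ∨ x ∈ l ∨ y ∈ l := by
  induction l with
  | nil => exact fun G x y h => Or.inl h
  | cons u l ih =>
    intro G x y h
    rcases ih _ x y h with h | h | h
    · rcases lc_adj h with h | h | h <;> simp [h]
    · simp [h]
    · simp [h]

theorem hole_supp_adj {G : SimpleGraph V} {a v : V} {w : G.Walk a a} (hw : IsHole G w)
    (hv : v ∈ w.support) : ∃ v', G.Adj v v' := by
  obtain ⟨n, f, hn, hf0, hfn, hinj, hadj, hch, hsup⟩ := hole_fun hw hv
  exact ⟨f 1, hf0 ▸ hadj 0 (by omega)⟩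

theorem lc_off {G : SimpleGraph V} {S : Set V} (hS : ∀ x y, G.Adj x y → x ∉ S) (u : V) :
    ∀ x y, (localChordalize G u).Adj x y → x ∉ S := by
  have key : ∀ y, (localChordalize G u).Adj u y → u ∉ S ∧ y ∉ S := by
    intro y h
    rcases lc_adj_u.1 h with h | ⟨-, a, w, hw, h1, h2⟩
    · exact ⟨hS _ _ h, hS _ _ h.symm⟩
    · obtain ⟨_, h1⟩ := hole_supp_adj hw h1
      obtain ⟨_, h2⟩ := hole_supp_adj hw h2
      exact ⟨hS _ _ h1, hS _ _ h2⟩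
  intro x y h
  rcases lc_adj h with h' | rfl | rfl
  · exact hS _ _ h'
  · exact (key _ h).1
  · exact (key _ h.symm).2

theorem cl_off {S : Set V} (l : List V) : ∀ {G : SimpleGraph V}, (∀ x y, G.Adj x y → x ∉ S) →
    ∀ x y, (chordalizeList G l).Adj x y → x ∉ S := by
  induction l with
  | nil => exact fun h => h
  | cons u l ih => exact fun h => ih (lc_off h u)

theorem hole_star {G H : SimpleGraph V} {a u : V} {w : G.Walk a a} (hw : IsHole G w)
    (hu : u ∈ w.support) (hGH : G ≤ H) (hH : IsChordal H)
    (hw' : ∀ v ∈ w.support, ∀ v' ∈ w.support, v ≠ u → v' ≠ u → H.Adj v v' → G.Adj v v') :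
    ∀ y ∈ w.support, u ≠ y → H.Adj u y := by
  classical
  intro y hy huy
  by_contra hn0
  obtain ⟨n, f, hn, hf0, hfn, hinj, hadj, hch, hsup⟩ := hole_fun hw hu
  obtain ⟨s, hs, rfl⟩ := (hsup y).1 hy
  have hs0 : s ≠ 0 := by rintro rfl; exact huy hf0.symm
  have hu1 : H.Adj u (f 1) := hGH (hf0 ▸ hadj 0 (by omega))
  have hun : H.Adj u (f (n-1)) := by
    have := hadj (n-1) (by omega)
    rw [show n - 1 + 1 = n by omega, hfn] at this
    exact hGH this.symm
  have hs1 : s ≠ 1 := by rintro rfl; exact hn0 hu1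
  have hsn : s ≠ n - 1 := by rintro rfl; exact hn0 hun
  have hne : ∀ i, 0 < i → i < n → f i ≠ u := by
    intro i hi hi' h
    have := hinj i 0 hi' (by omega) (h.trans hf0.symm)
    omega
  have ex1 : ∃ t, 0 < t ∧ t < s ∧ H.Adj u (f (s - t)) :=
    ⟨s - 1, by omega, by omega, by rwa [show s - (s - 1) = 1 by omega]⟩
  have ex2 : ∃ j, s < j ∧ j < n ∧ H.Adj u (f j) := ⟨n - 1, by omega, by omega, hun⟩
  obtain ⟨t1, t2, t3⟩ := Nat.find_spec ex1
  have tmin := fun m (hm : m < Nat.find ex1) => Nat.find_min ex1 hm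
  obtain ⟨j1, j2, j3⟩ := Nat.find_spec ex2
  have jmin := fun m (hm : m < Nat.find ex2) => Nat.find_min ex2 hm
  generalize Nat.find ex1 = t at *
  generalize Nat.find ex2 = j at *
  have hmem : ∀ i, i < n → f i ∈ w.support := fun i hi => (hsup _).2 ⟨i, hi, rfl⟩
  obtain ⟨π, w2, hw2, -, -⟩ := hole_of_center H u (f (s-t)) (f j)
    {v | ∃ m, s - t ≤ m ∧ m ≤ j ∧ f m = v}
    (by rintro ⟨m, h1, h2, h3⟩; exact hne m (by omega) (by omega) h3)
    ⟨s - t, le_refl _, by omega, rfl⟩ t3 j3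
    (fun h => by have := hinj _ _ (by omega) (by omega) h; omega)
    (fun h => by
      have := hch _ _ (by omega) j2 (hw' _ (hmem (s-t) (by omega)) _ (hmem j j2)
        (hne _ (by omega) (by omega)) (hne _ (by omega) (by omega)) h)
      omega)
    (by
      rintro v ⟨m, h1, h2, rfl⟩ h
      rcases lt_trichotomy m s with e | e | e
      · left
        by_cases e' : m = s - t
        · rw [e']
        · refine absurd ⟨by omega, by omega, ?_⟩ (tmin (s - m) (by omega))
          rwa [show s - (s - m) = m by omega]
      · subst e; exact absurd h hn0
      · right
        by_cases e' : m = j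
        · rw [e']
        · exact absurd ⟨e, by omega, h⟩ (jmin m (by omega)))
    (reach_seg H _ f (s-t) j (by omega) (fun m h1 h2 => ⟨m, h1, h2, rfl⟩)
      (fun m h1 h2 => hGH (hadj m (by omega))))
  exact hH _ w2 hw2

theorem cl_min {H : SimpleGraph V} {S : Set V} (hH : IsChordal H) (l : List V) :
    ∀ (G : SimpleGraph V), SetNC G {v | v ∈ l} → (∀ x y, G.Adj x y → x ∉ S) → G ≤ H →
      (∀ x y, x ∉ S → y ∉ S → H.Adj x y → (chordalizeList G l).Adj x y) →
      chordalizeList G l ≤ H := by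
  induction l with
  | nil => exact fun G _ _ h _ => h
  | cons u l ih =>
    intro G hNC hoff hGH hHle
    refine ih (localChordalize G u) (lc_setNC hNC) (lc_off hoff u) ?_ hHle
    have key : ∀ y, (localChordalize G u).Adj u y → H.Adj u y := by
      intro y h
      rcases lc_adj_u.1 h with h | ⟨hne, a, w, hw, h1, h2⟩
      · exact hGH h
      · refine hole_star hw h1 hGH hH ?_ y h2 hne
        intro v hv v' hv' hvu hvu' hadj
        obtain ⟨_, hv1⟩ := hole_supp_adj hw hv
        obtain ⟨_, hv2⟩ := hole_supp_adj hw hv'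
        rcases cl_adj _ _ _ _ (hHle v v' (hoff _ _ hv1) (hoff _ _ hv2) hadj) with h | h | h
        · exact h
        · exact absurd (hNC.2 a w hw v h u (by simp) hv h1) hvu
        · exact absurd (hNC.2 a w hw v' h u (by simp) hv' h1) hvu'
    intro x y h
    rcases lc_adj h with h' | rfl | rfl
    · exact hGH h'
    · exact key _ h
    · exact (key _ h.symm).symm

/-- vertices of the parts with index at least `i` -/
def later {k : ℕ} (parts : Fin k → List V) (i : ℕ) : Set V :=
  {v | ∃ j : Fin k, i ≤ (j : ℕ) ∧ v ∈ parts j}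

theorem chain_succ_fst (G : SimpleGraph V) {k : ℕ} (parts : Fin k → List V) (i : ℕ) :
    (lcChain G parts (i+1)).1 = (lcChain G parts i).2 ⊔ removeVerts G (later parts (i+1)) := rfl

theorem chain_succ_snd (G : SimpleGraph V) {k : ℕ} (parts : Fin k → List V) (i : ℕ) (h : i < k) :
    (lcChain G parts (i+1)).2 = chordalizeList (lcChain G parts (i+1)).1 (parts ⟨i, h⟩) := by
  show (if h : i < k then _ else _) = _
  rw [dif_pos h]
  rfl

theorem later_mono {k : ℕ} (parts : Fin k → List V) {i j : ℕ} (h : i ≤ j) :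
    later parts j ⊆ later parts i := fun _ ⟨m, hm, hv⟩ => ⟨m, by omega, hv⟩

theorem remove_le_chain (G : SimpleGraph V) {k : ℕ} (parts : Fin k → List V) (i : ℕ) (h : i ≤ k) :
    removeVerts G (later parts i) ≤ (lcChain G parts i).2 := by
  cases i with
  | zero =>
    intro x y hxy
    refine ⟨hxy.1, ?_, ?_⟩
    · rintro ⟨j, hj⟩; exact hxy.2.1 ⟨j, by omega, hj⟩
    · rintro ⟨j, hj⟩; exact hxy.2.2 ⟨j, by omega, hj⟩
  | succ i =>
    rw [chain_succ_snd G parts i h]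
    refine le_trans ?_ (le_cl _ _)
    rw [chain_succ_fst]
    exact le_sup_right

theorem chain_off (G : SimpleGraph V) {k : ℕ} (parts : Fin k → List V) (i : ℕ) (h : i ≤ k) :
    ∀ x y, (lcChain G parts i).2.Adj x y → x ∉ later parts i := by
  induction i with
  | zero =>
    rintro x y hxy ⟨j, -, hj⟩
    exact hxy.2.1 ⟨j, hj⟩
  | succ i ih =>
    rw [chain_succ_snd G parts i h]
    apply cl_off
    rintro x y (hxy | hxy)
    · exact fun hx => ih (by omega) x y hxy (later_mono parts (by omega) hx)
    · exact hxy.2.1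

theorem chain_fst_off (G : SimpleGraph V) {k : ℕ} (parts : Fin k → List V) (i : ℕ) (h : i < k) :
    ∀ x y, (lcChain G parts (i+1)).1.Adj x y → x ∉ later parts (i+1) := by
  rintro x y (hxy | hxy)
  · exact fun hx => chain_off G parts i h.le x y hxy (later_mono parts (by omega) hx)
  · exact hxy.2.1

theorem chain_down (G : SimpleGraph V) {k : ℕ} (parts : Fin k → List V) (i : ℕ) (h : i < k)
    (x y : V) (hx : x ∉ later parts i) (hy : y ∉ later parts i)
    (hxy : (lcChain G parts (i+1)).2.Adj x y) : (lcChain G parts i).2.Adj x y := by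
  rw [chain_succ_snd G parts i h] at hxy
  rcases cl_adj _ _ _ _ hxy with h1 | h1 | h1
  · rcases h1 with h1 | h1
    · exact h1
    · exact remove_le_chain G parts i h.le ⟨h1.1, hx, hy⟩
  · exact absurd ⟨⟨i, h⟩, le_refl _, h1⟩ hx
  · exact absurd ⟨⟨i, h⟩, le_refl _, h1⟩ hy

theorem chain_down' (G : SimpleGraph V) {k : ℕ} (parts : Fin k → List V) (i m : ℕ) (him : i ≤ m)
    (h : m ≤ k) (x y : V) (hx : x ∉ later parts i) (hy : y ∉ later parts i)
    (hxy : (lcChain G parts m).2.Adj x y) : (lcChain G parts i).2.Adj x y := by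
  induction m, him using Nat.le_induction with
  | base => exact hxy
  | succ m him ih =>
    exact ih (by omega) (chain_down G parts m (by omega) x y
      (fun hh => hx (later_mono parts him hh)) (fun hh => hy (later_mono parts him hh)) hxy)

theorem chain_min (G H : SimpleGraph V) {k : ℕ} (parts : Fin k → List V) (hH : IsChordal H)
    (hGH : G ≤ H) (hHk : H ≤ (lcChain G parts k).2)
    (hNC : ∀ i : Fin k, SetNC (lcChain G parts ((i : ℕ) + 1)).1 {v | v ∈ parts i})
    (i : ℕ) (hi : i ≤ k) : (lcChain G parts i).2 ≤ H := by
  induction i with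
  | zero => exact le_trans (removeVerts_le _ _) hGH
  | succ i ih =>
    rw [chain_succ_snd G parts i hi]
    refine cl_min hH _ _ (hNC ⟨i, hi⟩) (chain_fst_off G parts i hi) ?_ ?_
    · rw [chain_succ_fst]
      exact sup_le (ih (by omega)) (le_trans (removeVerts_le _ _) hGH)
    · intro x y hx hy hxy
      rw [← chain_succ_snd G parts i hi]
      exact chain_down' G parts (i+1) k hi (le_refl _) x y hx hy (hHk hxy)

end LC

/-- the last graph of the chordalization chain corresponding to a
local chordalization partition of a hole cover of `G` is a minimal chordal
completion of `G`. -/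
theorem stmt14 {V : Type*} [Fintype V] [DecidableEq V] (G : SimpleGraph V) (C : Set V)
    {k : ℕ} (parts : Fin k → List V)
    (hcov : IsHoleCover G C) (hpart : IsLCPartition G C parts) :
    IsChordal (lcChain G parts k).2 ∧ G ≤ (lcChain G parts k).2 ∧
      ∀ H : SimpleGraph V, G ≤ H → H < (lcChain G parts k).2 → ¬ IsChordal H := by
  obtain ⟨-, -, -, hC, hp⟩ := hpart
  have hk : k ≠ 0 := by
    rintro rfl
    obtain ⟨v, hv⟩ := hcov.1
    rw [← hC] at hv
    obtain ⟨i, -⟩ := hv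
    exact i.elim0
  refine ⟨?_, ?_, ?_⟩
  · have := (hp ⟨k - 1, by omega⟩).2.2
    simpa [show k - 1 + 1 = k by omega] using this
  · refine le_trans ?_ (LC.remove_le_chain G parts k (le_refl _))
    intro x y hxy
    refine ⟨hxy, ?_, ?_⟩ <;> rintro ⟨j, hj, -⟩ <;> have := j.2 <;> omega
  · intro H hGH hH hch
    exact absurd (LC.chain_min G H parts hch hGH hH.le (fun i => (hp i).2.1) k (le_refl _))
      (not_le_of_gt hH)
end

section
/- Let G be a finite simple graph, let (C_1, …, C_ℓ) be a local chordalization partition of a hole cover C of G, and let G* be the last graph of the corresponding chordalization chain. If a vertex set K of G forms a clique in G*, then there exists a subset C* of K ∩ C such that K \ C* is a clique in G and |C* ∩ C_i| ≤ 1 for each i = 1, …, ℓ. -/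
open SimpleGraph

variable {V : Type*}

/-- `x` and `y` are joined by a walk inside `S`. -/
def RW (G : SimpleGraph V) (S : Set V) (x y : V) : Prop :=
  ∃ w : G.Walk x y, ∀ z ∈ w.support, z ∈ S

theorem RW.symm {G : SimpleGraph V} {S : Set V} {x y : V} (h : RW G S x y) : RW G S y x := by
  obtain ⟨w, hw⟩ := h
  exact ⟨w.reverse, by simpa using hw⟩

theorem RW.trans {G : SimpleGraph V} {S : Set V} {x y z : V} (h : RW G S x y) (h' : RW G S y z) :
    RW G S x z := by
  obtain ⟨w, hw⟩ := h
  obtain ⟨w', hw'⟩ := h'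
  refine ⟨w.append w', fun t ht => ?_⟩
  rw [Walk.mem_support_append_iff] at ht
  exact ht.elim (hw t) (hw' t)

theorem RW.mono {G : SimpleGraph V} {S T : Set V} {x y : V} (h : RW G S x y) (hST : S ⊆ T) :
    RW G T x y := by
  obtain ⟨w, hw⟩ := h
  exact ⟨w, fun z hz => hST (hw z hz)⟩

theorem RW.refl {G : SimpleGraph V} {S : Set V} {x : V} (h : x ∈ S) : RW G S x x :=
  ⟨Walk.nil, by simpa using h⟩

theorem RW.adj {G : SimpleGraph V} {S : Set V} {x y : V} (hx : x ∈ S) (hy : y ∈ S)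
    (h : x = y ∨ G.Adj x y) : RW G S x y := by
  rcases h with rfl | h
  · exact RW.refl hx
  · exact ⟨Walk.cons h Walk.nil, by simp [hx, hy]⟩

theorem RW.of_walk {G : SimpleGraph V} {x y z t : V} (w : G.Walk x y) (hz : z ∈ w.support)
    (ht : t ∈ w.support) : RW G {v | v ∈ w.support} z t := by
  classical
  have h : ∀ s, s ∈ w.support → RW G {v | v ∈ w.support} x s := fun s hs =>
    ⟨w.takeUntil s hs, fun v hv => w.support_takeUntil_subset_support hs hv⟩
  exact (h z hz).symm.trans (h t ht)

theorem exists_chordless {G : SimpleGraph V} {S : Set V} {a b : V} (h : RW G S a b) :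
    ∃ w : G.Walk a b, w.IsPath ∧ (∀ z ∈ w.support, z ∈ S) ∧
      ∀ x y, x ∈ w.support → y ∈ w.support → G.Adj x y → s(x, y) ∈ w.edges := by
  classical
  have hex : ∃ n, ∃ w : G.Walk a b, (∀ z ∈ w.support, z ∈ S) ∧ w.length = n := by
    obtain ⟨w, hw⟩ := h
    exact ⟨_, w, hw, rfl⟩
  obtain ⟨w, hwS, hwl⟩ := Nat.find_spec hex
  have hmin : ∀ w' : G.Walk a b, (∀ z ∈ w'.support, z ∈ S) → w.length ≤ w'.length := by
    intro w' hw'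
    rw [hwl]
    exact Nat.find_min' hex ⟨w', hw', rfl⟩
  have hkey : ∀ i j, i < j → j ≤ w.length → G.Adj (w.getVert i) (w.getVert j) →
      s(w.getVert i, w.getVert j) ∈ w.edges := by
    intro i j hij hj hadj
    have h1 := hmin ((w.take i).append (Walk.cons hadj (w.drop j))) (by
      intro z hz
      rw [Walk.mem_support_append_iff, Walk.support_cons, List.mem_cons] at hz
      rcases hz with hz | rfl | hz
      · exact hwS z ((w.isSubwalk_take i).support_subset hz)
      · exact hwS _ (w.getVert_mem_support i)
      · exact hwS z ((w.isSubwalk_drop j).support_subset hz))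
    rw [Walk.length_append, Walk.length_cons, Walk.take_length, Walk.drop_length] at h1
    have h2 : j = i + 1 := by omega
    subst h2
    rw [Walk.mk_mem_edges_iff_exists]
    exact ⟨i, by omega, rfl⟩
  refine ⟨w, ?_, hwS, ?_⟩
  · have h1 := hmin w.bypass (fun z hz => hwS z (w.support_bypass_subset_support hz))
    rw [← w.bypass_eq_self_of_length_le_length_bypass h1]
    exact w.bypass_isPath
  · intro x y hx hy hxy
    rw [Walk.mem_support_iff_exists_getVert] at hx hy
    obtain ⟨i, rfl, hi⟩ := hx
    obtain ⟨j, rfl, hj⟩ := hy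
    rcases lt_trichotomy i j with hlt | rfl | hlt
    · exact hkey i j hlt hj hxy
    · exact absurd hxy (G.loopless.irrefl _)
    · rw [Sym2.eq_swap]
      exact hkey j i hlt hi hxy.symm

theorem tool1 {G : SimpleGraph V} {v a b : V} {S : Set V} (hab : ¬ G.Adj a b) (hne : a ≠ b)
    (hva : G.Adj v a) (hvb : G.Adj v b) (hvS : v ∉ S)
    (hS : ∀ x ∈ S, G.Adj v x → x = a ∨ x = b) (h : RW G S a b) :
    ∃ w : G.Walk v v, IsHole G w ∧ s(a, v) ∈ w.edges ∧ s(v, b) ∈ w.edges ∧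
      (∀ x ∈ w.support, x = v ∨ x ∈ S) ∧
      ∃ Q : G.Walk a b, ∀ x ∈ Q.support, x ∈ S ∧ x ∈ w.support := by
  obtain ⟨Q, hQp, hQS, hQc⟩ := exists_chordless h
  have hvQ : v ∉ Q.support := fun hv => hvS (hQS v hv)
  have hlen : 2 ≤ Q.length := by
    rcases Q with _ | ⟨h1, _ | ⟨h2, Q⟩⟩
    · exact absurd rfl hne
    · exact absurd h1 hab
    · simp
  have hsup : ∀ x, x ∈ (Walk.cons hva (Q.concat hvb.symm)).support ↔ x = v ∨ x ∈ Q.support := by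
    intro x
    simp [Walk.support_concat]
    tauto
  refine ⟨Walk.cons hva (Q.concat hvb.symm), ⟨?_, ?_, ?_⟩, ?_, ?_, ?_, Q, ?_⟩
  · rw [Walk.cons_isCycle_iff]
    refine ⟨hQp.concat hvQ _, ?_⟩
    rw [Walk.edges_concat]
    simp only [List.concat_eq_append, List.mem_append, List.mem_singleton, not_or]
    refine ⟨fun hh => hvQ (Walk.fst_mem_support_of_mem_edges _ hh), fun hh => ?_⟩
    rw [Sym2.eq_iff] at hh
    rcases hh with ⟨rfl, -⟩ | ⟨-, rfl⟩
    · exact hvb.ne rfl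
    · exact hne rfl
  · simp; omega
  · intro x y hx hy hxy
    rw [hsup] at hx hy
    rw [Walk.edges_cons, Walk.edges_concat]
    simp only [List.concat_eq_append, List.mem_cons, List.mem_append, List.not_mem_nil, or_false]
    rcases hx with rfl | hx <;> rcases hy with rfl | hy
    · exact absurd hxy (G.loopless.irrefl _)
    · rcases hS y (hQS y hy) hxy with rfl | rfl
      · simp
      · simp [Sym2.eq_swap]
    · rcases hS x (hQS x hx) hxy.symm with rfl | rfl
      · simp [Sym2.eq_swap]
      · simp
    · exact Or.inr (Or.inl (hQc x y hx hy hxy))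
  · simp [Sym2.eq_swap]
  · simp [Walk.edges_concat, Sym2.eq_swap]
  · intro x hx
    rw [hsup] at hx
    exact hx.imp id (hQS x)
  · intro x hx
    exact ⟨hQS x hx, (hsup x).2 (Or.inr hx)⟩

theorem extract {G : SimpleGraph V} {c v : V} {w : G.Walk c c} (hw : IsHole G w)
    (hv : v ∈ w.support) :
    ∃ a b, ∃ Q : G.Walk a b, Q.IsPath ∧ v ∉ Q.support ∧ G.Adj v a ∧ G.Adj v b ∧ a ≠ b ∧
      ¬ G.Adj a b ∧ (∀ x ∈ Q.support, G.Adj v x → x = a ∨ x = b) ∧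
      (∀ x, x ∈ w.support ↔ x = v ∨ x ∈ Q.support) ∧
      (∀ x y, x ∈ Q.support → y ∈ Q.support → G.Adj x y → s(x, y) ∈ Q.edges) ∧
      s(a, v) ∈ w.edges ∧ s(v, b) ∈ w.edges := by
  classical
  obtain ⟨hcyc, hlen, hch⟩ := hw
  have hsupp : ∀ x, x ∈ (w.rotate v hv).support ↔ x ∈ w.support := fun x =>
    w.mem_support_rotate_iff v hv
  have hedg : ∀ e, e ∈ (w.rotate v hv).edges ↔ e ∈ w.edges := fun e =>
    (w.rotate_edges v hv).mem_iff
  have hcyc' := hcyc.rotate hv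
  have hlen' : 4 ≤ (w.rotate v hv).length := by simpa using hlen
  generalize w.rotate v hv = r at hsupp hedg hcyc' hlen'
  cases r with
  | nil => simp at hlen'
  | @cons _ a _ hva p =>
    rw [Walk.cons_isCycle_iff] at hcyc'
    obtain ⟨hp, -⟩ := hcyc'
    obtain ⟨b, Q, hb, rfl⟩ : ∃ (b : V) (Q : G.Walk a b) (hb : G.Adj b v), p = Q.concat hb := by
      cases p with
      | nil => simp at hlen'
      | cons h p =>
        obtain ⟨x, q, h', hq⟩ := Walk.exists_cons_eq_concat h p
        exact ⟨x, q, h', hq⟩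
    rw [Walk.concat_isPath_iff] at hp
    obtain ⟨hQ, hvQ⟩ := hp
    have hs : ∀ x, x ∈ w.support ↔ x = v ∨ x ∈ Q.support := by
      intro x
      rw [← hsupp]
      simp [Walk.support_concat]
      tauto
    have he : ∀ e, e ∈ w.edges ↔ e = s(v, a) ∨ e ∈ Q.edges ∨ e = s(b, v) := by
      intro e
      rw [← hedg]
      simp [Walk.edges_concat]
    have hl : 2 ≤ Q.length := by
      simp at hlen'
      omega
    have hQc : ∀ x y, x ∈ Q.support → y ∈ Q.support → G.Adj x y → s(x, y) ∈ Q.edges := by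
      intro x y hx hy hxy
      have h1 := hch x y ((hs x).2 (Or.inr hx)) ((hs y).2 (Or.inr hy)) hxy
      rw [he] at h1
      rcases h1 with h1 | h1 | h1
      · rw [Sym2.eq_iff] at h1
        rcases h1 with ⟨rfl, -⟩ | ⟨-, rfl⟩
        · exact absurd hx hvQ
        · exact absurd hy hvQ
      · exact h1
      · rw [Sym2.eq_iff] at h1
        rcases h1 with ⟨-, rfl⟩ | ⟨rfl, -⟩
        · exact absurd hy hvQ
        · exact absurd hx hvQ
    have hne : a ≠ b := by
      rintro rfl
      rw [Walk.isPath_iff_eq_nil] at hQ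
      subst hQ
      simp at hl
    refine ⟨a, b, Q, hQ, hvQ, hva, hb.symm, hne, ?_, ?_, hs, hQc, ?_, ?_⟩
    · intro hab
      have h1 := hQc a b Q.start_mem_support Q.end_mem_support hab
      cases Q with
      | nil => exact hne rfl
      | @cons _ c' _ h q =>
        rw [Walk.cons_isPath_iff] at hQ
        rw [Walk.edges_cons, List.mem_cons] at h1
        rcases h1 with h1 | h1
        · rw [Sym2.eq_iff] at h1
          rcases h1 with ⟨-, rfl⟩ | ⟨rfl, -⟩
          · have := Walk.isPath_iff_eq_nil.1 hQ.1
            subst this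
            simp at hl
          · exact h.ne rfl
        · exact hQ.2 (Walk.fst_mem_support_of_mem_edges _ h1)
    · intro x hx hvx
      have h1 := hch v x ((hs v).2 (Or.inl rfl)) ((hs x).2 (Or.inr hx)) hvx
      rw [he] at h1
      rcases h1 with h1 | h1 | h1
      · rw [Sym2.eq_iff] at h1
        rcases h1 with ⟨-, rfl⟩ | ⟨rfl, rfl⟩
        · exact Or.inl rfl
        · exact Or.inl rfl
      · exact absurd (Walk.fst_mem_support_of_mem_edges _ h1) hvQ
      · rw [Sym2.eq_iff] at h1
        rcases h1 with ⟨rfl, rfl⟩ | ⟨-, rfl⟩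
        · exact Or.inr rfl
        · exact Or.inr rfl
    · rw [he]; left; exact Sym2.eq_swap
    · rw [he]; right; right; exact Sym2.eq_swap

/-- A connected set `A` avoiding `u`, containing `p` and exactly one neighbour of `u`. -/
structure Arm (G : SimpleGraph V) (u p a : V) (A : Set V) : Prop where
  ha : a ∈ A
  hp : p ∈ A
  hu : u ∉ A
  adj : G.Adj u a
  uniq : ∀ x ∈ A, G.Adj u x → x = a
  conn : ∀ x ∈ A, ∀ y ∈ A, RW G A x y

theorem Arm.insert {G : SimpleGraph V} {u p a q : V} {A : Set V} (h : Arm G u p a A)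
    (hqu : q ≠ u) (hq : ¬ G.Adj u q) (hqp : G.Adj q p) : Arm G u q a (insert q A) where
  ha := Or.inr h.ha
  hp := Or.inl rfl
  hu := by
    rintro (h1 | h1)
    · exact hqu h1.symm
    · exact h.hu h1
  adj := h.adj
  uniq := by
    rintro x (rfl | hx) hux
    · exact absurd hux hq
    · exact h.uniq x hx hux
  conn := by
    have hm : A ⊆ Insert.insert q A := Set.subset_insert q A
    have h1 : ∀ x ∈ Insert.insert q A, RW G (Insert.insert q A) q x := by
      rintro x (rfl | hx)
      · exact RW.refl (Or.inl rfl)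
      · exact (RW.adj (y := p) (Or.inl rfl) (hm h.hp) (Or.inr hqp)).trans ((h.conn p h.hp x hx).mono hm)
    exact fun x hx y hy => (h1 x hx).symm.trans (h1 y hy)

structure ArmData (G : SimpleGraph V) (u p : V) (W : Set V) (p1 p2 a b : V) (A B : Set V) :
    Prop where
  armA : Arm G u p1 a A
  armB : Arm G u p2 b B
  adj1 : G.Adj p p1
  adj2 : G.Adj p p2
  pA : p ∉ A
  pB : p ∉ B
  uniqA : ∀ x ∈ A, G.Adj p x → x = p1
  uniqB : ∀ x ∈ B, G.Adj p x → x = p2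
  subA : A ⊆ W
  subB : B ⊆ W
  sep : ∀ S : Set V, u ∉ S → p ∉ S → (∀ x ∈ S, G.Adj p x → x = p1 ∨ x = p2) → ¬ RW G S p1 p2

theorem exists_armData {G : SimpleGraph V} {u p c : V} (hu : VertexNC G u) {w : G.Walk c c}
    (hw : IsHole G w) (huw : u ∈ w.support) (hpw : p ∈ w.support) (hpu : p ≠ u)
    (hnadj : ¬ G.Adj u p) :
    ∃ p1 p2 a b A B, ArmData G u p {x | x ∈ w.support} p1 p2 a b A B := by
  classical
  obtain ⟨p1, p2, Q, hQ, hpQ, h1, h2, hne, h12, hN, hs, hch, he1, he2⟩ := extract hw hpw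
  have huQ : u ∈ Q.support := by
    rcases (hs u).1 huw with h | h
    · exact absurd h.symm hpu
    · exact h
  have hu1 : u ≠ p1 := by
    rintro rfl; exact hnadj h1.symm
  have hu2 : u ≠ p2 := by
    rintro rfl; exact hnadj h2.symm
  obtain ⟨Q1, Q2, rfl⟩ : ∃ (Q1 : G.Walk p1 u) (Q2 : G.Walk u p2), Q = Q1.append Q2 :=
    ⟨_, _, (Q.take_spec huQ).symm⟩
  obtain ⟨a, A, hA, rfl⟩ : ∃ (a : V) (A : G.Walk p1 a) (hA : G.Adj a u), Q1 = A.concat hA := by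
    cases Q1 with
    | nil => exact absurd rfl hu1
    | cons h q =>
      obtain ⟨x, q', h', hq⟩ := Walk.exists_cons_eq_concat h q
      exact ⟨x, q', h', hq⟩
  cases Q2 with
  | nil => exact absurd rfl hu2
  | @cons _ b _ hB B =>
  have hsup : ((A.concat hA).append (Walk.cons hB B)).support = A.support ++ u :: B.support := by
    simp [Walk.support_append, Walk.support_concat]
  have hedg : ∀ e, e ∈ ((A.concat hA).append (Walk.cons hB B)).edges ↔
      e ∈ A.edges ∨ e = s(a, u) ∨ e = s(u, b) ∨ e ∈ B.edges := by
    intro e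
    simp [Walk.edges_append, Walk.edges_concat]
  have hnd := hQ.support_nodup
  rw [hsup, List.nodup_append, List.nodup_cons] at hnd
  obtain ⟨-, ⟨huB, -⟩, hdis⟩ := hnd
  have huA : u ∉ A.support := fun h => hdis u h u (by simp) rfl
  have hAB : ∀ x, x ∈ A.support → x ∉ B.support := fun x hx hx' =>
    hdis x hx x (by simp [hx']) rfl
  simp only [hsup] at hpQ hN hs hch
  have hmem : ∀ x, x ∈ A.support ++ u :: B.support ↔ x ∈ A.support ∨ x = u ∨ x ∈ B.support := by
    simp
  simp only [hmem] at hpQ hN hs hch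
  have hux : ∀ x, (x ∈ A.support ∨ x ∈ B.support) → G.Adj u x → x = a ∨ x = b := by
    intro x hx hux
    have h3 := hch u x (by simp) (by tauto) hux
    rw [hedg] at h3
    rcases h3 with h3 | h3 | h3 | h3
    · exact absurd (Walk.fst_mem_support_of_mem_edges _ h3) huA
    · rw [Sym2.eq_iff] at h3
      rcases h3 with ⟨rfl, rfl⟩ | ⟨-, rfl⟩
      · exact Or.inl rfl
      · exact Or.inl rfl
    · rw [Sym2.eq_iff] at h3
      rcases h3 with ⟨-, rfl⟩ | ⟨rfl, rfl⟩
      · exact Or.inr rfl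
      · exact Or.inr rfl
    · exact absurd (Walk.fst_mem_support_of_mem_edges _ h3) huB
  refine ⟨p1, p2, a, b, {x | x ∈ A.support}, {x | x ∈ B.support}, ?_⟩
  constructor
  · refine ⟨A.end_mem_support, A.start_mem_support, huA, hA.symm, ?_, ?_⟩
    · intro x hx h3
      rcases hux x (Or.inl hx) h3 with h4 | rfl
      · exact h4
      · exact absurd B.start_mem_support (hAB _ hx)
    · intro x hx y hy
      exact RW.of_walk A hx hy
  · refine ⟨B.start_mem_support, B.end_mem_support, huB, hB, ?_, ?_⟩
    · intro x hx h3
      rcases hux x (Or.inr hx) h3 with rfl | h4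
      · exact absurd hx (hAB _ A.end_mem_support)
      · exact h4
    · intro x hx y hy
      exact RW.of_walk B hx hy
  · exact h1
  · exact h2
  · exact fun h => hpQ (Or.inl h)
  · exact fun h => hpQ (Or.inr (Or.inr h))
  · intro x hx h3
    rcases hN x (Or.inl hx) h3 with h4 | rfl
    · exact h4
    · exact absurd B.end_mem_support (hAB _ hx)
  · intro x hx h3
    rcases hN x (Or.inr (Or.inr hx)) h3 with rfl | h4
    · exact absurd hx (hAB _ A.start_mem_support)
    · exact h4
  · intro x hx
    exact (hs x).2 (Or.inr (Or.inl hx))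
  · intro x hx
    exact (hs x).2 (Or.inr (Or.inr (Or.inr hx)))
  · intro S huS hpS hS hR
    obtain ⟨w2, hw2, e1, e2, hsub, -⟩ := tool1 h12 hne h1 h2 hpS hS hR
    refine hu c p w w2 hw hw2 huw ?_ ⟨p1, p, p2, hne, he1, he2, e1, e2⟩
    intro h3
    rcases hsub u h3 with h4 | h4
    · exact hpu h4.symm
    · exact huS h4

/-- Two anticomplete sets. -/
def Anti (G : SimpleGraph V) (A B : Set V) : Prop :=
  ∀ x ∈ A, ∀ y ∈ B, x ≠ y ∧ ¬ G.Adj x y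

/-- A middle walk from `p` to `q`. -/
def Mid (G : SimpleGraph V) (u p q : V) (Z : Set V) : Prop :=
  u ∉ Z ∧ RW G (insert p (insert q Z)) p q ∧ (∀ z ∈ Z, ¬ G.Adj u z) ∧
    ∀ z ∈ Z, ∀ (c : V) (w : G.Walk c c), IsHole G w → u ∈ w.support → z ∉ w.support

theorem Mid.symm {G : SimpleGraph V} {u p q : V} {Z : Set V} (h : Mid G u p q Z) :
    Mid G u q p Z := by
  obtain ⟨h1, h2, h3⟩ := h
  refine ⟨h1, ?_, h3⟩
  rw [Set.insert_comm]
  exact h2.symm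

theorem key {G : SimpleGraph V} {u p q a b : V} {Z A B : Set V} (hZ : Mid G u p q Z)
    (hA : Arm G u p a A) (hB : Arm G u q b B) (hAB : Anti G A B) : False := by
  obtain ⟨huZ, hR, hZu, hZh⟩ := hZ
  have hS : RW G (A ∪ B ∪ Z) a b := by
    refine ((hA.conn a hA.ha p hA.hp).mono ?_).trans ((hR.mono ?_).trans
      ((hB.conn q hB.hp b hB.ha).mono ?_))
    · intro x hx; exact Or.inl (Or.inl hx)
    · rintro x (rfl | rfl | hx)
      · exact Or.inl (Or.inl hA.hp)
      · exact Or.inl (Or.inr hB.hp)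
      · exact Or.inr hx
    · intro x hx; exact Or.inl (Or.inr hx)
  obtain ⟨w, hw, e1, -, -, Q, hQ⟩ := tool1 (hAB a hA.ha b hB.ha).2 (hAB a hA.ha b hB.ha).1
    hA.adj hB.adj (v := u) (S := A ∪ B ∪ Z)
    (by
      rintro ((h | h) | h)
      · exact hA.hu h
      · exact hB.hu h
      · exact huZ h)
    (by
      rintro x ((h | h) | h) hux
      · exact Or.inl (hA.uniq x h hux)
      · exact Or.inr (hB.uniq x h hux)
      · exact absurd hux (hZu x h)) hS
  have huw : u ∈ w.support := w.start_mem_support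
  obtain ⟨d, hd, hd1, hd2⟩ := Q.exists_boundary_dart A hA.ha
    (fun h => (hAB b h b hB.ha).1 rfl)
  have h1 := hQ _ (Q.dart_snd_mem_support_of_mem_darts hd)
  rcases h1 with ⟨(h | h) | h, h2⟩
  · exact hd2 h
  · exact (hAB _ hd1 _ h).2 d.adj
  · exact hZh _ h _ w hw huw h2

theorem stepX {G : SimpleGraph V} {u p q c b : V} {Z B : Set V} (hu : VertexNC G u)
    (hZ : Mid G u p q Z) {w : G.Walk c c} (hw : IsHole G w) (huw : u ∈ w.support)
    (hpw : p ∈ w.support) (hpu : p ≠ u) (hnadj : ¬ G.Adj u p)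
    (hB : Arm G u q b B) (hpB : ∀ x ∈ B, p ≠ x ∧ ¬ G.Adj p x) : False := by
  obtain ⟨p1, p2, a1, a2, A1, A2, hD⟩ := exists_armData hu hw huw hpw hpu hnadj
  by_cases h1 : Anti G A1 B
  · refine key hZ (hD.armA.insert hpu hnadj hD.adj1) hB ?_
    rintro x (rfl | hx) y hy
    · exact hpB y hy
    · exact h1 x hx y hy
  by_cases h2 : Anti G A2 B
  · refine key hZ (hD.armB.insert hpu hnadj hD.adj2) hB ?_
    rintro x (rfl | hx) y hy
    · exact hpB y hy
    · exact h2 x hx y hy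
  have hx : ∀ A : Set V, ¬ Anti G A B → ∃ x ∈ A, ∃ y ∈ B, x = y ∨ G.Adj x y := by
    intro A h
    unfold Anti at h
    push Not at h
    obtain ⟨x, hx, y, hy, h⟩ := h
    exact ⟨x, hx, y, hy, or_iff_not_imp_left.2 h⟩
  obtain ⟨x1, hx1, y1, hy1, h1⟩ := hx A1 h1
  obtain ⟨x2, hx2, y2, hy2, h2⟩ := hx A2 h2
  have m1 : A1 ⊆ A1 ∪ A2 ∪ B := fun x hx => Or.inl (Or.inl hx)
  have m2 : A2 ⊆ A1 ∪ A2 ∪ B := fun x hx => Or.inl (Or.inr hx)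
  have m3 : B ⊆ A1 ∪ A2 ∪ B := fun x hx => Or.inr hx
  refine hD.sep (A1 ∪ A2 ∪ B) ?_ ?_ ?_ ?_
  · rintro ((h | h) | h)
    · exact hD.armA.hu h
    · exact hD.armB.hu h
    · exact hB.hu h
  · rintro ((h | h) | h)
    · exact hD.pA h
    · exact hD.pB h
    · exact (hpB p h).1 rfl
  · rintro x ((h | h) | h) h3
    · exact Or.inl (hD.uniqA x h h3)
    · exact Or.inr (hD.uniqB x h h3)
    · exact absurd h3 (hpB x h).2
  · exact ((hD.armA.conn p1 hD.armA.hp x1 hx1).mono m1).trans <|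
      (RW.adj (m1 hx1) (m3 hy1) h1).trans <|
      ((hB.conn y1 hy1 y2 hy2).mono m3).trans <|
      (RW.adj (m2 hx2) (m3 hy2) h2).symm.trans <|
      ((hD.armB.conn x2 hx2 p2 hD.armB.hp).mono m2)

theorem nilArm {G : SimpleGraph V} {u q : V} (h : G.Adj u q) : Arm G u q q {q} where
  ha := rfl
  hp := rfl
  hu := fun h' => h.ne h'
  adj := h
  uniq := fun _ hx _ => hx
  conn := by
    rintro x rfl y rfl
    exact RW.refl rfl

/-- `x`, `y` lie on a common hole of `G`. -/
def CoHole (G : SimpleGraph V) (x y : V) : Prop :=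
  ∃ (c : V) (w : G.Walk c c), IsHole G w ∧ x ∈ w.support ∧ y ∈ w.support

theorem touch_sep {G : SimpleGraph V} {u p p1 p2 a b v : V} {W A B : Set V}
    (hD : ArmData G u p W p1 p2 a b A B) (hvu : v ≠ u) (hvp : v ≠ p) (hnp : ¬ G.Adj p v)
    (hA : ∃ x ∈ A, x = v ∨ G.Adj x v) (hB : ∃ x ∈ B, x = v ∨ G.Adj x v) : False := by
  obtain ⟨x1, hx1, h1⟩ := hA
  obtain ⟨x2, hx2, h2⟩ := hB
  have m1 : A ⊆ insert v (A ∪ B) := fun x hx => Or.inr (Or.inl hx)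
  have m2 : B ⊆ insert v (A ∪ B) := fun x hx => Or.inr (Or.inr hx)
  have m3 : v ∈ insert v (A ∪ B) := Or.inl rfl
  refine hD.sep (insert v (A ∪ B)) ?_ ?_ ?_ ?_
  · rintro (h | h | h)
    · exact hvu h.symm
    · exact hD.armA.hu h
    · exact hD.armB.hu h
  · rintro (h | h | h)
    · exact hvp h.symm
    · exact hD.pA h
    · exact hD.pB h
  · rintro x (rfl | h | h) h3
    · exact absurd h3 hnp
    · exact Or.inl (hD.uniqA x h h3)
    · exact Or.inr (hD.uniqB x h h3)
  · exact ((hD.armA.conn p1 hD.armA.hp x1 hx1).mono m1).trans <|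
      (RW.adj (m1 hx1) m3 h1).trans <|
      (RW.adj (m2 hx2) m3 h2).symm.trans <|
      ((hD.armB.conn x2 hx2 p2 hD.armB.hp).mono m2)

theorem stepY {G : SimpleGraph V} {u p q : V} {Z : Set V} (hu : VertexNC G u)
    (hZ : Mid G u p q Z) (hpq : p ≠ q) (hnpq : ¬ G.Adj p q) (hpu : p ≠ u) (hqu : q ≠ u)
    (hnadj : ¬ G.Adj u p) (hp : CoHole G u p) (hq : G.Adj u q ∨ CoHole G u q) : False := by
  obtain ⟨c, w, hw, huw, hpw⟩ := hp
  by_cases hqa : G.Adj u q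
  · refine stepX hu hZ hw huw hpw hpu hnadj (nilArm hqa) ?_
    rintro x rfl
    exact ⟨hpq, hnpq⟩
  obtain ⟨c', w', hw', huw', hqw'⟩ := hq.resolve_left hqa
  obtain ⟨q1, q2, a1, a2, A1, A2, hD⟩ := exists_armData hu hw' huw' hqw' hqu hqa
  have hx : ∀ A : Set V, ∀ q' a, Arm G u q' a A → G.Adj q q' → ∃ x ∈ A, x = p ∨ G.Adj x p := by
    intro A q' a hA hqq'
    by_contra! hcon
    refine stepX hu hZ hw huw hpw hpu hnadj (hA.insert hqu hqa hqq') ?_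
    rintro x (rfl | hx)
    · exact ⟨hpq, hnpq⟩
    · exact ⟨(hcon x hx).1.symm, fun h => (hcon x hx).2 h.symm⟩
  exact touch_sep hD hpu hpq (fun h => hnpq h.symm) (hx _ _ _ hD.armA hD.adj1)
    (hx _ _ _ hD.armB hD.adj2)

theorem localChordalize_adj {G : SimpleGraph V} {u x y : V} :
    (localChordalize G u).Adj x y ↔
      G.Adj x y ∨ x ≠ y ∧ ((x = u ∧ CoHole G u y) ∨ (y = u ∧ CoHole G u x)) := by
  simp [localChordalize, CoHole]

theorem le_localChordalize (G : SimpleGraph V) (u : V) : G ≤ localChordalize G u := le_sup_left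

theorem holes_localChordalize {G : SimpleGraph V} {u c : V} (hu : VertexNC G u)
    {w : (localChordalize G u).Walk c c} (hw : IsHole (localChordalize G u) w) :
    ∃ w' : G.Walk c c, IsHole G w' ∧ w'.support = w.support ∧ w'.edges = w.edges := by
  have hback : ∀ x y, x ≠ u → y ≠ u → (localChordalize G u).Adj x y → G.Adj x y := by
    intro x y hx hy h
    rw [localChordalize_adj] at h
    tauto
  have htr : ∀ {a b : V} (r : (localChordalize G u).Walk a b), u ∉ r.support →
      ∀ e ∈ r.edges, e ∈ G.edgeSet := by
    intro a b r hr e he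
    induction e with
    | _ x y =>
      refine hback x y ?_ ?_ (r.adj_of_mem_edges he)
      · rintro rfl; exact hr (r.fst_mem_support_of_mem_edges he)
      · rintro rfl; exact hr (r.snd_mem_support_of_mem_edges he)
  have huw : u ∉ w.support := by
    intro huw
    obtain ⟨p, q, Q, hQ, huQ, h1, h2, hne, h12, hN, -, -, -, -⟩ := extract hw huw
    have hpu : p ≠ u := h1.ne.symm
    have hqu : q ≠ u := h2.ne.symm
    have hnpq : ¬ G.Adj p q := fun h => h12 (le_localChordalize G u h)
    have hZ : Mid G u p q {x | x ∈ Q.support ∧ x ≠ p ∧ x ≠ q} := by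
      refine ⟨fun h => huQ h.1, ⟨Q.transfer G (htr Q huQ), ?_⟩, ?_, ?_⟩
      · intro z hz
        rw [Walk.support_transfer] at hz
        by_cases hzp : z = p
        · exact Or.inl hzp
        by_cases hzq : z = q
        · exact Or.inr (Or.inl hzq)
        exact Or.inr (Or.inr ⟨hz, hzp, hzq⟩)
      · rintro z ⟨hz, hzp, hzq⟩ h
        rcases hN z hz (le_localChordalize G u h) with h | h
        · exact hzp h
        · exact hzq h
      · rintro z ⟨hz, hzp, hzq⟩ c' w' hw' huw' hzw'
        rcases hN z hz (localChordalize_adj.2 (Or.inr ⟨by rintro rfl; exact huQ hz,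
          Or.inl ⟨rfl, c', w', hw', huw', hzw'⟩⟩)) with h | h
        · exact hzp h
        · exact hzq h
    have hor : ∀ x, (localChordalize G u).Adj u x → G.Adj u x ∨ CoHole G u x := by
      intro x hx
      rw [localChordalize_adj] at hx
      rcases hx with h | ⟨hne, ⟨-, h⟩ | ⟨rfl, h⟩⟩
      · exact Or.inl h
      · exact Or.inr h
      · exact absurd rfl hne
    by_cases hp : G.Adj u p
    · by_cases hq : G.Adj u q
      · refine key hZ (nilArm hp) (nilArm hq) ?_
        rintro x rfl y rfl
        exact ⟨hne, hnpq⟩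
      · exact stepY hu hZ.symm hne.symm (fun h => hnpq h.symm) hqu hpu hq
          ((hor q h2).resolve_left hq) (hor p h1)
    · exact stepY hu hZ hne hnpq hpu hqu hp ((hor p h1).resolve_left hp) (hor q h2)
  refine ⟨w.transfer G (htr w huw), ⟨hw.1.transfer _, ?_, ?_⟩, ?_, ?_⟩
  · rw [Walk.length_transfer]; exact hw.2.1
  · intro x y hx hy hxy
    rw [Walk.support_transfer] at hx hy
    rw [Walk.edges_transfer]
    exact hw.2.2 x y hx hy (le_localChordalize G u hxy)
  · rw [Walk.support_transfer]
  · rw [Walk.edges_transfer]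

theorem chordalizeList_adj (l : List V) : ∀ (G : SimpleGraph V), (∀ u ∈ l, VertexNC G u) →
    ∀ x y, (chordalizeList G l).Adj x y →
      G.Adj x y ∨ (x ∈ l ∧ CoHole G x y) ∨ (y ∈ l ∧ CoHole G y x) := by
  induction l with
  | nil => intro G _ x y h; exact Or.inl h
  | cons u l ih =>
    intro G hG x y h
    have hu : VertexNC G u := hG u (by simp)
    have hco : ∀ x y, CoHole (localChordalize G u) x y → CoHole G x y := by
      rintro x y ⟨c, w, hw, hx, hy⟩
      obtain ⟨w', hw', hs, -⟩ := holes_localChordalize hu hw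
      exact ⟨c, w', hw', hs ▸ hx, hs ▸ hy⟩
    have h1 := ih (localChordalize G u) (by
      intro v hv a b w1 w2 hw1 hw2 hv1 hv2
      obtain ⟨w1', hw1', hs1, he1⟩ := holes_localChordalize hu hw1
      obtain ⟨w2', hw2', hs2, he2⟩ := holes_localChordalize hu hw2
      rw [← he1, ← he2]
      exact hG v (by simp [hv]) a b w1' w2' hw1' hw2' (hs1 ▸ hv1) (hs2 ▸ hv2)) x y h
    rcases h1 with h1 | ⟨h1, h2⟩ | ⟨h1, h2⟩
    · rw [localChordalize_adj] at h1
      rcases h1 with h1 | ⟨-, ⟨rfl, h1⟩ | ⟨rfl, h1⟩⟩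
      · exact Or.inl h1
      · exact Or.inr (Or.inl ⟨by simp, h1⟩)
      · exact Or.inr (Or.inr ⟨by simp, h1⟩)
    · exact Or.inr (Or.inl ⟨by simp [h1], hco _ _ h2⟩)
    · exact Or.inr (Or.inr ⟨by simp [h1], hco _ _ h2⟩)

theorem le_chordalizeList (l : List V) : ∀ G : SimpleGraph V, G ≤ chordalizeList G l := by
  induction l with
  | nil => exact fun G => le_refl G
  | cons u l ih => exact fun G => (le_localChordalize G u).trans (ih _)

theorem exists_free_arm {G : SimpleGraph V} {D : Set V} (hD : SetNC G D) {u v y : V}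
    (hu : u ∈ D) (hv : v ∈ D) (hne : u ≠ v) (hyu : y ≠ u) (hnu : ¬ G.Adj u y)
    (hnv : ¬ G.Adj v y) (hco : CoHole G u y) :
    ∃ a A, Arm G u y a A ∧ ∀ x ∈ A, x ≠ v ∧ ¬ G.Adj v x := by
  obtain ⟨c, w, hw, huw, hyw⟩ := hco
  have hvw : v ∉ w.support := fun h => hne (hD.2 c w hw u hu v hv huw h)
  obtain ⟨p1, p2, a, b, A, B, hd⟩ := exists_armData (hD.1 u hu) hw huw hyw hyu hnu
  have hyv : y ≠ v := by
    rintro rfl; exact hvw hyw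
  by_cases hA : ∃ x ∈ A, x = v ∨ G.Adj x v
  · by_cases hB : ∃ x ∈ B, x = v ∨ G.Adj x v
    · exact (touch_sep hd hne.symm hyv.symm (fun h => hnv h.symm) hA hB).elim
    · push Not at hB
      refine ⟨b, _, hd.armB.insert hyu hnu hd.adj2, ?_⟩
      rintro x (rfl | hx)
      · exact ⟨hyv, hnv⟩
      · exact ⟨(hB x hx).1, fun h => (hB x hx).2 h.symm⟩
  · push Not at hA
    refine ⟨a, _, hd.armA.insert hyu hnu hd.adj1, ?_⟩
    rintro x (rfl | hx)
    · exact ⟨hyv, hnv⟩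
    · exact ⟨(hA x hx).1, fun h => (hA x hx).2 h.symm⟩

theorem lemmaB {G : SimpleGraph V} {D : Set V} (hD : SetNC G D) {u v y : V}
    (hu : u ∈ D) (hv : v ∈ D) (huv : G.Adj u v) (hyu : y ≠ u) (hyv : y ≠ v)
    (hnu : ¬ G.Adj u y) (hnv : ¬ G.Adj v y) (hcu : CoHole G u y) (hcv : CoHole G v y) :
    False := by
  obtain ⟨a, A, hA, hAv⟩ := exists_free_arm hD hu hv huv.ne hyu hnu hnv hcu
  obtain ⟨b, B, hB, hBu⟩ := exists_free_arm hD hv hu huv.ne.symm hyv hnv hnu hcv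
  have mA : A ⊆ insert v (A ∪ B) := fun x hx => Or.inr (Or.inl hx)
  have mB : B ⊆ insert v (A ∪ B) := fun x hx => Or.inr (Or.inr hx)
  have mv : v ∈ insert v (A ∪ B) := Or.inl rfl
  obtain ⟨w, hw, -, e2, -, -⟩ := tool1 (S := insert v (A ∪ B)) (v := u) (a := a) (b := v)
    (fun h => (hAv a hA.ha).2 h.symm) (hAv a hA.ha).1 hA.adj huv
    (by
      rintro (h | h | h)
      · exact huv.ne h
      · exact hA.hu h
      · exact (hBu u h).1 rfl)
    (by
      rintro x (rfl | h | h) hux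
      · exact Or.inr rfl
      · exact Or.inl (hA.uniq x h hux)
      · exact absurd hux (hBu x h).2)
    (((hA.conn a hA.ha y hA.hp).mono mA).trans <| ((hB.conn y hB.hp b hB.ha).mono mB).trans <|
      RW.adj (mB hB.ha) mv (Or.inr hB.adj.symm))
  exact huv.ne (hD.2 u w hw u hu v hv w.start_mem_support (w.snd_mem_support_of_mem_edges e2))

theorem star {G : SimpleGraph V} {D K : Set V} (hD : SetNC G D)
    (hK : ∀ x ∈ K, ∀ y ∈ K, x ≠ y →
      G.Adj x y ∨ (x ∈ D ∧ CoHole G x y) ∨ (y ∈ D ∧ CoHole G y x)) :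
    ∃ Cs : Set V, Cs ⊆ K ∩ D ∧ Cs.Subsingleton ∧ G.IsClique (K \ Cs) := by
  -- a set which is not a clique has a missing pair `u ∈ D`, `y`
  have hmiss : ∀ K' ⊆ K, ¬ G.IsClique K' →
      ∃ u ∈ K', ∃ y ∈ K', u ≠ y ∧ ¬ G.Adj u y ∧ u ∈ D ∧ CoHole G u y := by
    intro K' hK' h
    rw [SimpleGraph.isClique_iff, Set.Pairwise] at h
    push Not at h
    obtain ⟨x, hx, y, hy, hne, hn⟩ := h
    rcases hK x (hK' hx) y (hK' hy) hne with h | ⟨h1, h2⟩ | ⟨h1, h2⟩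
    · exact absurd h hn
    · exact ⟨x, hx, y, hy, hne, hn, h1, h2⟩
    · exact ⟨y, hy, x, hx, hne.symm, fun h => hn h.symm, h1, h2⟩
  have huniq : ∀ u v, u ∈ D → v ∈ D → CoHole G u v → u = v := by
    rintro u v hu hv ⟨c, w, hw, h1, h2⟩
    exact hD.2 c w hw u hu v hv h1 h2
  by_cases hc : G.IsClique K
  · exact ⟨∅, by simp, by simp, by simpa using hc⟩
  obtain ⟨u, hu, y, hy, huy, hnuy, huD, hco⟩ := hmiss K subset_rfl hc
  refine ⟨{u}, by simpa using ⟨hu, huD⟩, by simp, ?_⟩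
  by_contra hc'
  obtain ⟨v, ⟨hv, hvu⟩, z, ⟨hz, hzu⟩, hvz, hnvz, hvD, hco'⟩ := hmiss _ Set.diff_subset hc'
  have hvu : v ≠ u := hvu
  have hzu : z ≠ u := hzu
  have hyD : y ∉ D := fun h => huy (huniq u y huD h hco)
  have hzD : z ∉ D := fun h => hvz (huniq v z hvD h hco')
  have hyv : y ≠ v := by
    rintro rfl; exact hyD hvD
  have huv : G.Adj u v := by
    rcases hK u hu v hv hvu.symm with h | ⟨-, h⟩ | ⟨-, h⟩
    · exact h
    · exact absurd (huniq u v huD hvD h).symm hvu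
    · exact absurd (huniq v u hvD huD h) hvu
  by_cases h1 : G.Adj v y
  · by_cases h2 : G.Adj u z
    · have hyz : y ≠ z := by
        rintro rfl; exact hnvz h1
      have hadj : G.Adj y z := by
        rcases hK y hy z hz hyz with h | ⟨h, -⟩ | ⟨h, -⟩
        · exact h
        · exact absurd h hyD
        · exact absurd h hzD
      obtain ⟨w, hw, e1, -, -, -⟩ := tool1 (S := {v, y, z}) (v := u) (a := v) (b := z)
        hnvz hvz huv h2
        (by
          rintro (h | h | h)
          · exact hvu h.symm
          · exact huy h
          · exact hzu h.symm)
        (by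
          rintro x (rfl | rfl | rfl) hux
          · exact Or.inl rfl
          · exact absurd hux hnuy
          · exact Or.inr rfl)
        ((RW.adj (y := y) (by simp) (by simp) (Or.inr h1)).trans
          (RW.adj (by simp) (by simp) (Or.inr hadj)))
      exact hvu (hD.2 u w hw v hvD u huD (w.fst_mem_support_of_mem_edges e1) w.start_mem_support)
    · have hco2 : CoHole G u z := by
        rcases hK u hu z hz hzu.symm with h | ⟨-, h⟩ | ⟨h, -⟩
        · exact absurd h h2
        · exact h
        · exact absurd h hzD
      exact lemmaB hD huD hvD huv hzu hvz.symm h2 hnvz hco2 hco'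
  · have hco2 : CoHole G v y := by
      rcases hK v hv y hy hyv.symm with h | ⟨-, h⟩ | ⟨h, -⟩
      · exact absurd h h1
      · exact h
      · exact absurd h hyD
    exact lemmaB hD huD hvD huv huy.symm hyv hnuy h1 hco hco2

theorem lcChain_succ_fst (G : SimpleGraph V) {k : ℕ} (parts : Fin k → List V) (i : ℕ) :
    (lcChain G parts (i + 1)).1 = (lcChain G parts i).2 ⊔
      removeVerts G {v | ∃ j : Fin k, i + 1 ≤ (j : ℕ) ∧ v ∈ parts j} := rfl

theorem lcChain_succ_snd (G : SimpleGraph V) {k : ℕ} (parts : Fin k → List V) (i : ℕ)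
    (h : i < k) : (lcChain G parts (i + 1)).2 =
      chordalizeList (lcChain G parts (i + 1)).1 (parts ⟨i, h⟩) := by
  rw [lcChain_succ_fst]
  simp only [lcChain, dif_pos h]

theorem chain_lower (G : SimpleGraph V) {k : ℕ} (parts : Fin k → List V) (i : ℕ) (hi : i ≤ k) :
    removeVerts G {v | ∃ j : Fin k, i ≤ (j : ℕ) ∧ v ∈ parts j} ≤ (lcChain G parts i).2 := by
  cases i with
  | zero => simp [lcChain]
  | succ i =>
    rw [lcChain_succ_snd G parts i hi]
    refine le_trans ?_ (le_chordalizeList _ _)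
    rw [lcChain_succ_fst]
    exact le_sup_right

theorem CoHole.adj_left {G : SimpleGraph V} {x y : V} (h : CoHole G x y) : ∃ z, G.Adj x z := by
  obtain ⟨c, w, hw, hx, -⟩ := h
  obtain ⟨a, b, Q, -, -, h, -⟩ := extract hw hx
  exact ⟨a, h⟩

theorem CoHole.symm {G : SimpleGraph V} {x y : V} (h : CoHole G x y) : CoHole G y x := by
  obtain ⟨c, w, hw, hx, hy⟩ := h
  exact ⟨c, w, hw, hy, hx⟩

theorem chain_avoid (G : SimpleGraph V) {k : ℕ} (parts : Fin k → List V)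
    (hNC : ∀ i : Fin k, SetNC (lcChain G parts ((i : ℕ) + 1)).1 {v | v ∈ parts i}) (i : ℕ) :
    i ≤ k → ∀ x y, (lcChain G parts i).2.Adj x y →
      ∀ j : Fin k, i ≤ (j : ℕ) → x ∉ parts j := by
  induction i with
  | zero =>
    intro _ x y h j _ hx
    exact h.2.1 ⟨j, hx⟩
  | succ i ih =>
    intro hi x y h j hj
    have h1 : ∀ x y, (lcChain G parts (i + 1)).1.Adj x y → x ∉ parts j := by
      intro x y h hx
      rw [lcChain_succ_fst] at h
      rcases h with h | h
      · exact ih (by omega) x y h j (by omega) hx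
      · exact h.2.1 ⟨j, hj, hx⟩
    rw [lcChain_succ_snd G parts i hi] at h
    rcases chordalizeList_adj _ _ (hNC ⟨i, hi⟩).1 x y h with h | ⟨-, h⟩ | ⟨-, h⟩
    · exact h1 x y h
    · obtain ⟨z, hz⟩ := h.adj_left
      exact h1 x z hz
    · obtain ⟨z, hz⟩ := h.symm.adj_left
      exact h1 x z hz

theorem chain_clique (G : SimpleGraph V) {k : ℕ} (parts : Fin k → List V)
    (hdis : Pairwise fun i j : Fin k => ∀ v, v ∈ parts i → v ∉ parts j)
    (hNC : ∀ i : Fin k, SetNC (lcChain G parts ((i : ℕ) + 1)).1 {v | v ∈ parts i}) (i : ℕ) :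
    i ≤ k → ∀ K : Set V, (lcChain G parts i).2.IsClique K →
      ∃ Cs : Set V, Cs ⊆ K ∩ {v | ∃ i, v ∈ parts i} ∧ G.IsClique (K \ Cs) ∧
        ∀ j : Fin k, (Cs ∩ {v | v ∈ parts j}).Subsingleton := by
  induction i with
  | zero =>
    intro _ K hK
    refine ⟨∅, by simp, ?_, by simp⟩
    intro x hx y hy hne
    exact (hK hx.1 hy.1 hne).1
  | succ i ih =>
    intro hi K hK
    rw [lcChain_succ_snd G parts i hi] at hK
    obtain ⟨C1, hC1, hC1s, hC1c⟩ := star (K := K) (hNC ⟨i, hi⟩) (fun x hx y hy hne =>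
      chordalizeList_adj _ _ (hNC ⟨i, hi⟩).1 x y (hK hx hy hne))
    obtain ⟨C0, hC0, hC0c, hC0s⟩ := ih (by omega) (K \ {v | v ∈ parts ⟨i, hi⟩}) (by
      rintro x ⟨hx, hxi⟩ y ⟨hy, hyi⟩ hne
      have h := hC1c ⟨hx, fun h => hxi (hC1 h).2⟩ ⟨hy, fun h => hyi (hC1 h).2⟩ hne
      have h : (lcChain G parts i).2.Adj x y ∨
        (removeVerts G {v | ∃ j : Fin k, i + 1 ≤ (j : ℕ) ∧ v ∈ parts j}).Adj x y := h
      rcases h with h | ⟨h, hx', hy'⟩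
      · exact h
      · have hav : ∀ z, z ∉ parts ⟨i, hi⟩ →
            z ∉ {v | ∃ j : Fin k, i + 1 ≤ (j : ℕ) ∧ v ∈ parts j} →
            z ∉ {v | ∃ j : Fin k, i ≤ (j : ℕ) ∧ v ∈ parts j} := by
          rintro z hz hz' ⟨j, hj, hzj⟩
          rcases Nat.eq_or_lt_of_le hj with hj | hj
          · have : j = ⟨i, hi⟩ := Fin.ext hj.symm
            exact hz (this ▸ hzj)
          · exact hz' ⟨j, hj, hzj⟩
        exact chain_lower G parts i (by omega) ⟨h, hav x hxi hx', hav y hyi hy'⟩)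
    refine ⟨C0 ∪ C1, ?_, ?_, ?_⟩
    · rintro x (hx | hx)
      · exact ⟨(hC0 hx).1.1, (hC0 hx).2⟩
      · exact ⟨(hC1 hx).1, ⟨i, hi⟩, (hC1 hx).2⟩
    · rintro x ⟨hx, hxC⟩ y ⟨hy, hyC⟩ hne
      have hx0 : x ∉ C0 := fun h => hxC (Or.inl h)
      have hx1 : x ∉ C1 := fun h => hxC (Or.inr h)
      have hy0 : y ∉ C0 := fun h => hyC (Or.inl h)
      have hy1 : y ∉ C1 := fun h => hyC (Or.inr h)
      have h := hC1c ⟨hx, hx1⟩ ⟨hy, hy1⟩ hne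
      have h : (lcChain G parts i).2.Adj x y ∨
        (removeVerts G {v | ∃ j : Fin k, i + 1 ≤ (j : ℕ) ∧ v ∈ parts j}).Adj x y := h
      rcases h with h | h
      · have hxi := chain_avoid G parts hNC i (by omega) x y h ⟨i, hi⟩ le_rfl
        have hyi := chain_avoid G parts hNC i (by omega) y x h.symm ⟨i, hi⟩ le_rfl
        exact hC0c ⟨⟨hx, hxi⟩, hx0⟩ ⟨⟨hy, hyi⟩, hy0⟩ hne
      · exact h.1
    · intro j
      by_cases hj : j = ⟨i, hi⟩
      · subst hj
        rintro x ⟨hx | hx, hxj⟩ y ⟨hy | hy, hyj⟩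
        · exact absurd hxj (hC0 hx).1.2
        · exact absurd hxj (hC0 hx).1.2
        · exact absurd hyj (hC0 hy).1.2
        · exact hC1s hx hy
      · rintro x ⟨hx | hx, hxj⟩ y ⟨hy | hy, hyj⟩
        · exact hC0s j ⟨hx, hxj⟩ ⟨hy, hyj⟩
        · exact absurd hyj (hdis (Ne.symm hj) y (hC1 hy).2)
        · exact absurd hxj (hdis (Ne.symm hj) x (hC1 hx).2)
        · exact hC1s hx hy

/-- a clique `K` of the last graph `G*` of the chordalization chain
admits a subset `C* ⊆ K ∩ C` with `K \ C*` a clique of `G` and `|C* ∩ Cᵢ| ≤ 1`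
for each part `Cᵢ`. -/
theorem stmt15 {V : Type*} [Fintype V] [DecidableEq V] (G : SimpleGraph V) (C : Set V)
    {k : ℕ} (parts : Fin k → List V)
    (hcov : IsHoleCover G C) (hpart : IsLCPartition G C parts)
    (K : Set V) (hK : ((lcChain G parts k).2).IsClique K) :
    ∃ Cs : Set V, Cs ⊆ K ∩ C ∧ G.IsClique (K \ Cs) ∧
      ∀ i : Fin k, (Cs ∩ {v | v ∈ parts i}).Subsingleton := by
  obtain ⟨-, -, hdis, hC, hch⟩ := hpart
  subst hC
  exact chain_clique G parts hdis (fun i => (hch i).2.1) k le_rfl K hK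
end
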